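/- A set A ⊆ ω is weakly ML-cuppable if and only if A is not K-trivial. -/

import Mathlib

open MeasureTheory ENNReal

/-! ### Cantor space and the uniform (coin-flipping) measure -/

/-- The binary digits of a real number in `[0,1)`, giving a point of Cantor space. -/
noncomputable def binaryDigits (x : ℝ) : ℕ → Bool :=
  fun n => decide (⌊x * 2 ^ (n + 1)⌋ % 2 = 1)

/-- The uniform (Lebesgue / coin-flipping) measure on Cantor space `2^ω`,
obtained as the pushforward of Lebesgue measure on `[0,1)` under binary expansion. -/
noncomputable def μCantor : Measure (ℕ → Bool) :=
  Measure.map binaryDigits (volume.restrict (Set.Ico (0 : ℝ) 1))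

/-- `σ` is an initial segment of the infinite sequence `X`. -/
def IsPrefixOf (σ : List Bool) (X : ℕ → Bool) : Prop :=
  ∀ i : Fin σ.length, X i = σ.get i

/-- The cylinder determined by a finite binary string. -/
def cylinder (σ : List Bool) : Set (ℕ → Bool) := {X | IsPrefixOf σ X}

/-- The open set generated by a set of finite binary strings. -/
def openOf (S : Set (List Bool)) : Set (ℕ → Bool) := ⋃ σ ∈ S, cylinder σ

/-- The density of a set `P` above the string `τ`: `μ([τ] ∩ P) · 2^{|τ|}`. -/
noncomputable def dens (τ : List Bool) (P : Set (ℕ → Bool)) : ℝ≥0∞ :=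
  μCantor (cylinder τ ∩ P) * 2 ^ τ.length

/-- The length-`n` initial segment of `X`, as a finite binary string. -/
def strPrefix (X : ℕ → Bool) (n : ℕ) : List Bool := (List.range n).map X

/-- A set of strings is prefix-free if no element is a proper prefix of another. -/
def PrefixFreeSet (S : Set (List Bool)) : Prop :=
  ∀ σ ∈ S, ∀ τ ∈ S, σ <+: τ → σ = τ

/-- The weight `∑_{σ ∈ S} 2^{-|σ|}` of a set of strings. -/
noncomputable def weight (S : Set (List Bool)) : ℝ≥0∞ :=
  ∑' σ : S, 2⁻¹ ^ (σ : List Bool).length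

/-- A set of strings is bounded if its weight is finite. -/
def BoundedStr (S : Set (List Bool)) : Prop := weight S < ⊤

/-- The tail `X(·+k)` of an infinite binary sequence. -/
def tailSeq (X : ℕ → Bool) (k : ℕ) : ℕ → Bool := fun n => X (n + k)

/-! ### Oracle computability -/

/-- The `e`-th computably enumerable set of naturals (the domain of the `e`-th
partial computable function). -/
def WEnum (e n : ℕ) : Prop := ((Denumerable.ofNat Nat.Partrec.Code e).eval n).Dom

/-- `OracleComputes e X n m` holds if the `e`-th Turing functional with oracle `X`
outputs `m` on input `n`; a Turing functional is presented by the c.e. set `W_e`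
of coded axioms `(σ, n, m)`, and `Γ_e^X(n) = m` iff some initial segment `σ` of `X`
has `(σ, n, m) ∈ W_e`. -/
def OracleComputes (e : ℕ) (X : ℕ → Bool) (n m : ℕ) : Prop :=
  ∃ σ : List Bool, IsPrefixOf σ X ∧
    WEnum e (Nat.pair (Encodable.encode σ) (Nat.pair n m))

def natOfBool (b : Bool) : ℕ := cond b 1 0

/-- `f : ℕ → ℕ` is computable with oracle `A`: some Turing functional with oracle `A`
has graph exactly `f`. -/
def FnComputableIn (f : ℕ → ℕ) (A : ℕ → Bool) : Prop :=
  ∃ e, ∀ n m, OracleComputes e A n m ↔ m = f n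

/-- Turing reducibility `B ≤_T A` for subsets of `ω` (as elements of Cantor space). -/
def TuringLE (B A : ℕ → Bool) : Prop := FnComputableIn (fun n => natOfBool (B n)) A

/-- Turing equivalence. -/
def TuringEquiv (A B : ℕ → Bool) : Prop := TuringLE A B ∧ TuringLE B A

/-- The Turing join `A ⊕ B`. -/
def joinSet (A B : ℕ → Bool) : ℕ → Bool :=
  fun n => if n % 2 = 0 then A (n / 2) else B (n / 2)

open Classical in
/-- The Turing jump `A′ = {e : Γ_e^A(e)↓}`. -/
noncomputable def jump (A : ℕ → Bool) : ℕ → Bool :=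
  fun e => decide (∃ m, OracleComputes e A e m)

/-- The empty oracle. -/
def emptyOracle : ℕ → Bool := fun _ => false

/-- The halting problem `∅′`. -/
noncomputable def zeroJump : ℕ → Bool := jump emptyOracle

/-- A set is computable iff it is Turing reducible to the empty oracle. -/
def ComputableSet (A : ℕ → Bool) : Prop := TuringLE A emptyOracle

/-- A set of naturals is c.e. in `A`. -/
def CeIn (A : ℕ → Bool) (S : Set ℕ) : Prop :=
  ∃ e, ∀ n, n ∈ S ↔ ∃ m, OracleComputes e A n m

/-- A set of strings is c.e. in `A`. -/
def CeStrIn (A : ℕ → Bool) (S : Set (List Bool)) : Prop :=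
  ∃ e, ∀ σ : List Bool, σ ∈ S ↔ ∃ m, OracleComputes e A (Encodable.encode σ) m

/-- A c.e. set of strings. -/
def CeStr (S : Set (List Bool)) : Prop := CeStrIn emptyOracle S

/-! ### Π⁰₁ classes, Martin-Löf randomness, K-triviality -/

/-- A `Π⁰₁(A)` class: the complement of the union of cylinders over an `A`-c.e.
set of strings. -/
def Pi01In (A : ℕ → Bool) (P : Set (ℕ → Bool)) : Prop :=
  ∃ S : Set (List Bool), CeStrIn A S ∧ P = (openOf S)ᶜ

/-- A `Π⁰₁` class. -/
def Pi01 (P : Set (ℕ → Bool)) : Prop := Pi01In emptyOracle P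

/-- The `n`-th level of the `e`-th `A`-effective sequence of open sets. -/
def testLevel (e : ℕ) (A : ℕ → Bool) (n : ℕ) : Set (ℕ → Bool) :=
  openOf {σ | ∃ m, OracleComputes e A (Nat.pair n (Encodable.encode σ)) m}

/-- A Martin-Löf test relative to `A`: a uniformly `A`-c.e. sequence of open sets
`G n` with `μ(G n) ≤ 2^{-n}`. -/
def MLTestIn (A : ℕ → Bool) (G : ℕ → Set (ℕ → Bool)) : Prop :=
  (∃ e, ∀ n, G n = testLevel e A n) ∧ ∀ n, μCantor (G n) ≤ 2⁻¹ ^ n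

/-- `X` is Martin-Löf random relative to `A`: it passes every `A`-Martin-Löf test. -/
def MLRandomIn (A X : ℕ → Bool) : Prop :=
  ∀ G : ℕ → Set (ℕ → Bool), MLTestIn A G → ∃ n, X ∉ G n

/-- `X` is Martin-Löf random. -/
def MLRandom (X : ℕ → Bool) : Prop := MLRandomIn emptyOracle X

/-- The domain of the `e`-th machine, viewed as a set of binary strings. -/
def machineDom (e : ℕ) : Set (List Bool) :=
  {σ | ((Denumerable.ofNat Nat.Partrec.Code e).eval (Encodable.encode σ)).Dom}

/-- The `e`-th machine is prefix-free. -/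
def PrefixFreeMachine (e : ℕ) : Prop := PrefixFreeSet (machineDom e)

/-- Prefix-free Kolmogorov complexity (defined, up to an additive constant, as the
least `|σ| + 2e + 2` over prefix-free machines `e` and programs `σ` producing `x`). -/
noncomputable def Kcpx (x : ℕ) : ℕ :=
  sInf {k | ∃ e, ∃ σ : List Bool, PrefixFreeMachine e ∧
    x ∈ (Denumerable.ofNat Nat.Partrec.Code e).eval (Encodable.encode σ) ∧
    k = σ.length + 2 * e + 2}

/-- `K(n)` means `K(1^n)`. -/
noncomputable def KofNat (n : ℕ) : ℕ := Kcpx (Encodable.encode (List.replicate n true))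

/-- `A` is K-trivial: `K(A↾n) ≤ K(n) + c` for some constant `c`. -/
def KTrivial (A : ℕ → Bool) : Prop :=
  ∃ c, ∀ n, Kcpx (Encodable.encode (strPrefix A n)) ≤ KofNat n + c

/-- A set `A` is weakly ML-cuppable if some incomplete Martin-Löf random `X`
joins it above `∅′`. -/
def WeaklyMLCuppable (A : ℕ → Bool) : Prop :=
  ∃ X : ℕ → Bool, MLRandom X ∧ ¬ TuringLE zeroJump X ∧
    TuringLE zeroJump (joinSet A X)


/-! ### Automation for primitive recursive functions and predicates -/

attribute [fun_prop] Primrec PrimrecPred REPred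
attribute [fun_prop] Primrec.id Primrec.const Primrec.comp

section prauto

variable {α β γ δ : Type} [Primcodable α] [Primcodable β] [Primcodable γ] [Primcodable δ]

@[fun_prop] theorem pr_pair {f : α → β} {g : α → γ} (hf : Primrec f) (hg : Primrec g) :
    Primrec (fun a => (f a, g a)) := hf.pair hg
@[fun_prop] theorem pr_fst {f : α → β × γ} (hf : Primrec f) : Primrec (fun a => (f a).1) :=
  Primrec.fst.comp hf
@[fun_prop] theorem pr_snd {f : α → β × γ} (hf : Primrec f) : Primrec (fun a => (f a).2) :=
  Primrec.snd.comp hf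
@[fun_prop] theorem pr_add {f g : α → ℕ} (hf : Primrec f) (hg : Primrec g) :
    Primrec (fun a => f a + g a) := Primrec.nat_add.comp hf hg
@[fun_prop] theorem pr_mul {f g : α → ℕ} (hf : Primrec f) (hg : Primrec g) :
    Primrec (fun a => f a * g a) := Primrec.nat_mul.comp hf hg
@[fun_prop] theorem pr_sub {f g : α → ℕ} (hf : Primrec f) (hg : Primrec g) :
    Primrec (fun a => f a - g a) := Primrec.nat_sub.comp hf hg
@[fun_prop] theorem pr_div {f g : α → ℕ} (hf : Primrec f) (hg : Primrec g) :
    Primrec (fun a => f a / g a) := Primrec.nat_div.comp hf hg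
@[fun_prop] theorem pr_mod {f g : α → ℕ} (hf : Primrec f) (hg : Primrec g) :
    Primrec (fun a => f a % g a) := Primrec.nat_mod.comp hf hg
@[fun_prop] theorem pr_max {f g : α → ℕ} (hf : Primrec f) (hg : Primrec g) :
    Primrec (fun a => max (f a) (g a)) := Primrec.nat_max.comp hf hg
@[fun_prop] theorem pr_min {f g : α → ℕ} (hf : Primrec f) (hg : Primrec g) :
    Primrec (fun a => min (f a) (g a)) := Primrec.nat_min.comp hf hg
@[fun_prop] theorem pr_succ {f : α → ℕ} (hf : Primrec f) :
    Primrec (fun a => Nat.succ (f a)) := Primrec.succ.comp hf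
@[fun_prop] theorem pr_natpair {f g : α → ℕ} (hf : Primrec f) (hg : Primrec g) :
    Primrec (fun a => Nat.pair (f a) (g a)) := Primrec₂.natPair.comp hf hg
@[fun_prop] theorem pr_unpair {f : α → ℕ} (hf : Primrec f) :
    Primrec (fun a => Nat.unpair (f a)) := Primrec.unpair.comp hf
@[fun_prop] theorem pr_pow {f g : α → ℕ} (hf : Primrec f) (hg : Primrec g) :
    Primrec (fun a => f a ^ g a) := by
  have : Primrec fun a => (g a).rec (motive := fun _ => ℕ) 1 fun n IH => (fun a (p : ℕ × ℕ) => p.2 * f a) a (n, IH) :=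
    Primrec.nat_rec' hg (Primrec.const 1) (h := fun a (p : ℕ × ℕ) => p.2 * f a) (by
      show Primrec (fun x : α × (ℕ × ℕ) => x.2.2 * f x.1)
      fun_prop)
  refine this.of_eq fun a => ?_
  induction g a with
  | zero => simp
  | succ n ih => simp [pow_succ, ih]
@[fun_prop] theorem pr_encode {f : α → β} (hf : Primrec f) :
    Primrec (fun a => Encodable.encode (f a)) := Primrec.encode.comp hf
@[fun_prop] theorem pr_decode {f : α → ℕ} (hf : Primrec f) :
    Primrec (fun a => (Encodable.decode (f a) : Option β)) := Primrec.decode.comp hf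

@[fun_prop] theorem pr_some {f : α → β} (hf : Primrec f) :
    Primrec (fun a => some (f a)) := Primrec.option_some.comp hf
@[fun_prop] theorem pr_getD {f : α → Option β} {g : α → β} (hf : Primrec f) (hg : Primrec g) :
    Primrec (fun a => (f a).getD (g a)) := Primrec.option_getD.comp hf hg
@[fun_prop] theorem pr_isSome {f : α → Option β} (hf : Primrec f) :
    Primrec (fun a => (f a).isSome) := Primrec.option_isSome.comp hf
@[fun_prop] theorem pr_omap {f : α → Option β} {g : α → β → γ} (hf : Primrec f)
    (hg : Primrec (fun p : α × β => g p.1 p.2)) : Primrec (fun a => (f a).map (g a)) :=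
  Primrec.option_map hf hg
@[fun_prop] theorem pr_obind {f : α → Option β} {g : α → β → Option γ} (hf : Primrec f)
    (hg : Primrec (fun p : α × β => g p.1 p.2)) : Primrec (fun a => (f a).bind (g a)) :=
  Primrec.option_bind hf hg

@[fun_prop] theorem pr_cons {f : α → β} {g : α → List β} (hf : Primrec f) (hg : Primrec g) :
    Primrec (fun a => f a :: g a) := Primrec.list_cons.comp hf hg
@[fun_prop] theorem pr_append {f g : α → List β} (hf : Primrec f) (hg : Primrec g) :
    Primrec (fun a => f a ++ g a) := Primrec.list_append.comp hf hg
@[fun_prop] theorem pr_length {f : α → List β} (hf : Primrec f) :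
    Primrec (fun a => (f a).length) := Primrec.list_length.comp hf
@[fun_prop] theorem pr_reverse {f : α → List β} (hf : Primrec f) :
    Primrec (fun a => (f a).reverse) := Primrec.list_reverse.comp hf
@[fun_prop] theorem pr_head? {f : α → List β} (hf : Primrec f) :
    Primrec (fun a => (f a).head?) := Primrec.list_head?.comp hf
@[fun_prop] theorem pr_tail {f : α → List β} (hf : Primrec f) :
    Primrec (fun a => (f a).tail) := Primrec.list_tail.comp hf
@[fun_prop] theorem pr_take {f : α → ℕ} {g : α → List β} (hf : Primrec f) (hg : Primrec g) :
    Primrec (fun a => (g a).take (f a)) := Primrec.list_take.comp hf hg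
@[fun_prop] theorem pr_drop {f : α → ℕ} {g : α → List β} (hf : Primrec f) (hg : Primrec g) :
    Primrec (fun a => (g a).drop (f a)) := Primrec.list_drop.comp hf hg
@[fun_prop] theorem pr_dropLast {f : α → List β} (hf : Primrec f) :
    Primrec (fun a => (f a).dropLast) := by
  simp only [List.dropLast_eq_take]; fun_prop
@[fun_prop] theorem pr_range {f : α → ℕ} (hf : Primrec f) :
    Primrec (fun a => List.range (f a)) := Primrec.list_range.comp hf
@[fun_prop] theorem pr_getElem? {f : α → List β} {g : α → ℕ} (hf : Primrec f) (hg : Primrec g) :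
    Primrec (fun a => (f a)[g a]?) := Primrec.list_getElem?.comp hf hg
@[fun_prop] theorem pr_lgetD {f : α → List β} {g : α → ℕ} {d : α → β} (hf : Primrec f)
    (hg : Primrec g) (hd : Primrec d) :
    Primrec (fun a => (f a).getD (g a) (d a)) := by
  simp only [List.getD_eq_getElem?_getD]; fun_prop
@[fun_prop] theorem pr_map {f : α → List β} {g : α → β → γ} (hf : Primrec f)
    (hg : Primrec (fun p : α × β => g p.1 p.2)) : Primrec (fun a => (f a).map (g a)) :=
  Primrec.list_map hf hg
@[fun_prop] theorem pr_flatMap {f : α → List β} {g : α → β → List γ} (hf : Primrec f)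
    (hg : Primrec (fun p : α × β => g p.1 p.2)) : Primrec (fun a => (f a).flatMap (g a)) :=
  Primrec.list_flatMap hf hg
@[fun_prop] theorem pr_foldl {f : α → List β} {g : α → γ} {h : α → γ → β → γ} (hf : Primrec f)
    (hg : Primrec g) (hh : Primrec (fun p : α × γ × β => h p.1 p.2.1 p.2.2)) :
    Primrec (fun a => (f a).foldl (h a) (g a)) :=
  Primrec.list_foldl (h := fun a p => h a p.1 p.2) hf hg hh
@[fun_prop] theorem pr_foldr {f : α → List β} {g : α → γ} {h : α → β → γ → γ} (hf : Primrec f)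
    (hg : Primrec g) (hh : Primrec (fun p : α × β × γ => h p.1 p.2.1 p.2.2)) :
    Primrec (fun a => (f a).foldr (h a) (g a)) :=
  Primrec.list_foldr (h := fun a p => h a p.1 p.2) hf hg hh
@[fun_prop] theorem pr_sum {f : α → List ℕ} (hf : Primrec f) : Primrec (fun a => (f a).sum) := by
  simp only [List.sum_eq_foldr]; fun_prop
@[fun_prop] theorem pr_replicate {f : α → ℕ} {g : α → β} (hf : Primrec f) (hg : Primrec g) :
    Primrec (fun a => List.replicate (f a) (g a)) := by
  have : Primrec (fun a => (List.range (f a)).map fun _ => g a) := by fun_prop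
  exact this.of_eq fun a => by simp [List.map_const']
@[fun_prop] theorem pr_iterate {f : α → ℕ} {g : α → β} {h : α → β → β} (hf : Primrec f)
    (hg : Primrec g) (hh : Primrec (fun p : α × β => h p.1 p.2)) :
    Primrec (fun a => (h a)^[f a] (g a)) := Primrec.nat_iterate hf hg hh

@[fun_prop] theorem pr_band {f g : α → Bool} (hf : Primrec f) (hg : Primrec g) :
    Primrec (fun a => f a && g a) := Primrec.and.comp hf hg
@[fun_prop] theorem pr_bor {f g : α → Bool} (hf : Primrec f) (hg : Primrec g) :
    Primrec (fun a => f a || g a) := Primrec.or.comp hf hg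
@[fun_prop] theorem pr_bnot {f : α → Bool} (hf : Primrec f) :
    Primrec (fun a => !(f a)) := Primrec.not.comp hf
@[fun_prop] theorem pr_cond {c : α → Bool} {f g : α → β} (hc : Primrec c) (hf : Primrec f)
    (hg : Primrec g) : Primrec (fun a => cond (c a) (f a) (g a)) := Primrec.cond hc hf hg
@[fun_prop] theorem pr_decide {p : α → Prop} {i : DecidablePred p} (hp : PrimrecPred p) :
    Primrec (fun a => decide (p a)) := hp.decide
@[fun_prop] theorem pr_ite {f g : α → β} {p : α → Prop} {i : DecidablePred p} (hp : PrimrecPred p)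
    (hf : Primrec f) (hg : Primrec g) : Primrec (fun a => if p a then f a else g a) :=
  Primrec.ite hp hf hg

@[fun_prop] theorem pp_const (p : Prop) : PrimrecPred (fun _ : α => p) := by
  classical
  exact ⟨fun _ => inferInstance, Primrec.const (decide p)⟩
@[fun_prop] theorem pp_eq {f g : α → β} (hf : Primrec f) (hg : Primrec g) :
    PrimrecPred (fun a => f a = g a) := Primrec.eq.comp hf hg
@[fun_prop] theorem pp_lt {f g : α → ℕ} (hf : Primrec f) (hg : Primrec g) :
    PrimrecPred (fun a => f a < g a) := Primrec.nat_lt.comp hf hg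
@[fun_prop] theorem pp_le {f g : α → ℕ} (hf : Primrec f) (hg : Primrec g) :
    PrimrecPred (fun a => f a ≤ g a) := Primrec.nat_le.comp hf hg
@[fun_prop] theorem pp_not {p : α → Prop} (hp : PrimrecPred p) :
    PrimrecPred (fun a => ¬ p a) := hp.not
@[fun_prop] theorem pp_ne {f g : α → β} (hf : Primrec f) (hg : Primrec g) :
    PrimrecPred (fun a => f a ≠ g a) := (pp_eq hf hg).not
@[fun_prop] theorem pp_and {p q : α → Prop} (hp : PrimrecPred p) (hq : PrimrecPred q) :
    PrimrecPred (fun a => p a ∧ q a) := hp.and hq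
@[fun_prop] theorem pp_or {p q : α → Prop} (hp : PrimrecPred p) (hq : PrimrecPred q) :
    PrimrecPred (fun a => p a ∨ q a) := hp.or hq
theorem pp_imp {p q : α → Prop} (hp : PrimrecPred p) (hq : PrimrecPred q) :
    PrimrecPred (fun a => p a → q a) :=
  (hp.not.or hq).of_eq fun a => by tauto
@[fun_prop] theorem pp_ball {f : α → List β} {p : α → β → Prop} (hf : Primrec f)
    (hp : PrimrecPred (fun x : α × β => p x.1 x.2)) :
    PrimrecPred (fun a => ∀ b ∈ f a, p a b) := by
  have h : PrimrecRel (fun (b : β) (a : α) => p a b) :=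
    hp.comp (Primrec.snd.pair Primrec.fst)
  exact h.forall_mem_list.comp hf Primrec.id
@[fun_prop] theorem pp_bex {f : α → List β} {p : α → β → Prop} (hf : Primrec f)
    (hp : PrimrecPred (fun x : α × β => p x.1 x.2)) :
    PrimrecPred (fun a => ∃ b ∈ f a, p a b) := by
  have h : PrimrecRel (fun (b : β) (a : α) => p a b) :=
    hp.comp (Primrec.snd.pair Primrec.fst)
  exact h.exists_mem_list.comp hf Primrec.id
theorem pp_mem {f : α → List β} {g : α → β} (hf : Primrec f) (hg : Primrec g) :
    PrimrecPred (fun a => g a ∈ f a) := by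
  have : PrimrecPred (fun a => ∃ b ∈ f a, b = g a) := by fun_prop
  exact this.of_eq fun a => by simp
@[fun_prop] theorem pp_exlt {f : α → ℕ} {p : α → ℕ → Prop} (hf : Primrec f)
    (hp : PrimrecPred (fun x : α × ℕ => p x.1 x.2)) :
    PrimrecPred (fun a => ∃ i < f a, p a i) := by
  have : PrimrecPred (fun a => ∃ b ∈ List.range (f a), p a b) := by fun_prop
  exact this.of_eq fun a => by simp
@[fun_prop] theorem pp_alllt {f : α → ℕ} {p : α → ℕ → Prop} (hf : Primrec f)
    (hp : PrimrecPred (fun x : α × ℕ => p x.1 x.2)) :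
    PrimrecPred (fun a => ∀ i < f a, p a i) := by
  have : PrimrecPred (fun a => ∀ b ∈ List.range (f a), p a b) := by fun_prop
  exact this.of_eq fun a => by simp
@[fun_prop] theorem pp_exle {f : α → ℕ} {p : α → ℕ → Prop} (hf : Primrec f)
    (hp : PrimrecPred (fun x : α × ℕ => p x.1 x.2)) :
    PrimrecPred (fun a => ∃ i ≤ f a, p a i) := by
  have : PrimrecPred (fun a => ∃ b ∈ List.range (f a + 1), p a b) := by fun_prop
  exact this.of_eq fun a => by simp
@[fun_prop] theorem pp_allle {f : α → ℕ} {p : α → ℕ → Prop} (hf : Primrec f)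
    (hp : PrimrecPred (fun x : α × ℕ => p x.1 x.2)) :
    PrimrecPred (fun a => ∀ i ≤ f a, p a i) := by
  have : PrimrecPred (fun a => ∀ b ∈ List.range (f a + 1), p a b) := by fun_prop
  exact this.of_eq fun a => by simp
@[fun_prop] theorem pp_prefix {f g : α → List β} (hf : Primrec f) (hg : Primrec g) :
    PrimrecPred (fun a => f a <+: g a) := by
  have : PrimrecPred (fun a => f a = (g a).take (f a).length) := by fun_prop
  exact this.of_eq fun a => List.prefix_iff_eq_take.symm
@[fun_prop] theorem pr_filter {f : α → List β} {p : α → β → Bool} (hf : Primrec f)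
    (hp : Primrec (fun x : α × β => p x.1 x.2)) :
    Primrec (fun a => (f a).filter (p a)) := by
  have : Primrec (fun a => (f a).flatMap (fun b => if p a b = true then [b] else [])) := by
    fun_prop
  refine this.of_eq fun a => ?_
  induction f a with
  | nil => rfl
  | cons b l ih => by_cases h : p a b = true <;> simp [List.flatMap_cons, h, ih]
@[fun_prop] theorem pr_find? {f : α → List β} {p : α → β → Bool} (hf : Primrec f)
    (hp : Primrec (fun x : α × β => p x.1 x.2)) :
    Primrec (fun a => (f a).find? (p a)) := by
  have : Primrec (fun a => ((f a).filter (p a)).head?) := by fun_prop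
  exact this.of_eq fun a => by simp

/-! RE predicates -/

@[fun_prop] theorem re_of_pp {p : α → Prop} (h : PrimrecPred p) : REPred p :=
  h.computablePred.to_re

@[fun_prop] theorem re_const (p : Prop) : REPred (fun _ : α => p) := re_of_pp (pp_const p)
@[fun_prop] theorem re_eq {f g : α → β} (hf : Primrec f) (hg : Primrec g) :
    REPred (fun a => f a = g a) := re_of_pp (pp_eq hf hg)
@[fun_prop] theorem re_ne {f g : α → β} (hf : Primrec f) (hg : Primrec g) :
    REPred (fun a => f a ≠ g a) := re_of_pp (pp_ne hf hg)
@[fun_prop] theorem re_lt {f g : α → ℕ} (hf : Primrec f) (hg : Primrec g) :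
    REPred (fun a => f a < g a) := re_of_pp (pp_lt hf hg)
@[fun_prop] theorem re_le {f g : α → ℕ} (hf : Primrec f) (hg : Primrec g) :
    REPred (fun a => f a ≤ g a) := re_of_pp (pp_le hf hg)
@[fun_prop] theorem re_prefix {f g : α → List β} (hf : Primrec f) (hg : Primrec g) :
    REPred (fun a => f a <+: g a) := re_of_pp (pp_prefix hf hg)
@[fun_prop] theorem re_not {p : α → Prop} (hp : PrimrecPred p) :
    REPred (fun a => ¬ p a) := re_of_pp (pp_not hp)

/-- normal form: an RE predicate has a monotone primitive recursive approximation. -/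
theorem re_stage {p : α → Prop} (h : REPred p) :
    ∃ f : α × ℕ → Bool, Primrec f ∧ (∀ a s t, s ≤ t → f (a, s) = true → f (a, t) = true) ∧
      ∀ a, p a ↔ ∃ s, f (a, s) = true := by
  obtain ⟨c, hc⟩ := Nat.Partrec.Code.exists_code.1 h
  refine ⟨fun x => (Nat.Partrec.Code.evaln x.2 c (Encodable.encode x.1)).isSome, ?_, ?_, ?_⟩
  · have := Nat.Partrec.Code.primrec_evaln
    have h2 : Primrec (fun x : α × ℕ => ((x.2, c), Encodable.encode x.1)) := by fun_prop
    exact Primrec.option_isSome.comp (this.comp h2)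
  · intro a s t hst hs
    obtain ⟨y, hy⟩ := Option.isSome_iff_exists.1 hs
    exact Option.isSome_iff_exists.2 ⟨y, Nat.Partrec.Code.evaln_mono hst hy⟩
  · intro a
    have h1 : p a ↔ (c.eval (Encodable.encode a)).Dom := by
      rw [hc]; simp [Part.assert]
    rw [h1, Part.dom_iff_mem]
    constructor
    · rintro ⟨y, hy⟩
      obtain ⟨k, hk⟩ := Nat.Partrec.Code.evaln_complete.1 hy
      exact ⟨k, Option.isSome_iff_exists.2 ⟨y, hk⟩⟩
    · rintro ⟨s, hs⟩
      obtain ⟨y, hy⟩ := Option.isSome_iff_exists.1 hs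
      exact ⟨y, Nat.Partrec.Code.evaln_sound hy⟩

theorem re_of_stage {f : α × ℕ → Bool} (hf : Primrec f) : REPred (fun a => ∃ s, f (a, s) = true) := by
  have h2 : Partrec₂ (fun (a : α) (s : ℕ) => (Part.some (f (a, s)) : Part Bool)) :=
    hf.to_comp.partrec
  refine (Partrec.rfind h2).dom_re.of_eq fun a => ?_
  refine Nat.rfind_dom.trans ?_
  constructor
  · rintro ⟨n, h, -⟩
    exact ⟨n, by simpa using h⟩
  · rintro ⟨n, h⟩
    exact ⟨n, by simpa using h, by simp⟩

theorem re_comp {p : β → Prop} {f : α → β} (hp : REPred p) (hf : Primrec f) :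
    REPred (fun a => p (f a)) := by
  unfold REPred at hp ⊢
  exact Partrec.comp hp hf.to_comp

@[fun_prop] theorem re_ex {p : α → β → Prop} (hp : REPred (fun x : α × β => p x.1 x.2)) :
    REPred (fun a => ∃ b, p a b) := by
  obtain ⟨f, hf, -, hfp⟩ := re_stage hp
  have hg : Primrec (fun x : α × ℕ =>
      ((Encodable.decode x.2.unpair.1 : Option β).map (fun b => f ((x.1, b), x.2.unpair.2))).getD
        false) := by fun_prop
  refine (re_of_stage hg).of_eq fun a => ?_
  constructor
  · rintro ⟨s, hs⟩
    cases h : (Encodable.decode s.unpair.1 : Option β) with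
    | none => simp [h] at hs
    | some b => exact ⟨b, (hfp (a, b)).2 ⟨_, by simpa [h] using hs⟩⟩
  · rintro ⟨b, hb⟩
    obtain ⟨s, hs⟩ := (hfp (a, b)).1 hb
    exact ⟨Nat.pair (Encodable.encode b) s, by simpa using hs⟩

@[fun_prop] theorem re_and {p q : α → Prop} (hp : REPred p) (hq : REPred q) :
    REPred (fun a => p a ∧ q a) := by
  obtain ⟨f, hf, hfm, hfp⟩ := re_stage hp
  obtain ⟨g, hg, hgm, hgp⟩ := re_stage hq
  have : Primrec (fun x : α × ℕ => f x && g x) := by fun_prop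
  refine (re_of_stage this).of_eq fun a => ?_
  rw [hfp, hgp]
  constructor
  · rintro ⟨s, hs⟩
    simp at hs
    exact ⟨⟨s, hs.1⟩, s, hs.2⟩
  · rintro ⟨⟨s, hs⟩, t, ht⟩
    exact ⟨max s t, by simp [hfm a s _ (le_max_left s t) hs, hgm a t _ (le_max_right s t) ht]⟩

@[fun_prop] theorem re_or {p q : α → Prop} (hp : REPred p) (hq : REPred q) :
    REPred (fun a => p a ∨ q a) := by
  obtain ⟨f, hf, hfm, hfp⟩ := re_stage hp
  obtain ⟨g, hg, hgm, hgp⟩ := re_stage hq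
  have : Primrec (fun x : α × ℕ => f x || g x) := by fun_prop
  refine (re_of_stage this).of_eq fun a => ?_
  rw [hfp, hgp]
  simp [exists_or]

@[fun_prop] theorem re_ball {f : α → List β} {p : α → β → Prop} (hf : Primrec f)
    (hp : REPred (fun x : α × β => p x.1 x.2)) :
    REPred (fun a => ∀ b ∈ f a, p a b) := by
  obtain ⟨g, hg, hgm, hgp⟩ := re_stage hp
  have h : PrimrecPred (fun x : α × ℕ => ∀ b ∈ f x.1, g ((x.1, b), x.2) = true) := by fun_prop
  have h2 : REPred (fun a => ∃ s : ℕ, ∀ b ∈ f a, g ((a, b), s) = true) :=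
    re_ex (p := fun a s => ∀ b ∈ f a, g ((a, b), s) = true) (re_of_pp h)
  clear h
  refine h2.of_eq fun a => ?_
  constructor
  · rintro ⟨s, hs⟩ b hb
    exact (hgp (a, b)).2 ⟨s, hs b hb⟩
  · intro H
    clear h2
    generalize f a = l at H
    induction l with
    | nil => exact ⟨0, by simp⟩
    | cons b l ih =>
      obtain ⟨s, hs⟩ := ih fun b' hb' => H b' (List.mem_cons_of_mem _ hb')
      obtain ⟨t, ht⟩ := (hgp (a, b)).1 (H b List.mem_cons_self)
      refine ⟨max s t, fun b' hb' => ?_⟩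
      rcases List.mem_cons.1 hb' with rfl | h
      · exact hgm _ t _ (le_max_right s t) ht
      · exact hgm _ s _ (le_max_left s t) (hs b' h)

@[fun_prop] theorem re_alllt {f : α → ℕ} {p : α → ℕ → Prop} (hf : Primrec f)
    (hp : REPred (fun x : α × ℕ => p x.1 x.2)) :
    REPred (fun a => ∀ i < f a, p a i) := by
  have : REPred (fun a => ∀ b ∈ List.range (f a), p a b) := by fun_prop
  exact this.of_eq fun a => by simp

@[fun_prop] theorem re_allle {f : α → ℕ} {p : α → ℕ → Prop} (hf : Primrec f)
    (hp : REPred (fun x : α × ℕ => p x.1 x.2)) :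
    REPred (fun a => ∀ i ≤ f a, p a i) := by
  have : REPred (fun a => ∀ b ∈ List.range (f a + 1), p a b) := by fun_prop
  exact this.of_eq fun a => by simp

/-! strings -/

/-- all binary strings of length `n` -/
def allStr : ℕ → List (List Bool)
  | 0 => [[]]
  | n + 1 => (allStr n).flatMap fun σ => [σ ++ [false], σ ++ [true]]

theorem mem_allStr {n : ℕ} {σ : List Bool} : σ ∈ allStr n ↔ σ.length = n := by
  induction n generalizing σ with
  | zero => simp [allStr]
  | succ n ih =>
    simp only [allStr, List.mem_flatMap, ih]
    constructor
    · rintro ⟨τ, h, h2⟩; simp at h2; rcases h2 with rfl | rfl <;> simp [h]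
    · intro h
      obtain ⟨τ, b, rfl⟩ : ∃ τ b, σ = τ ++ [b] :=
        ⟨σ.dropLast, σ.getLast (by rintro rfl; simp at h), (List.dropLast_append_getLast _).symm⟩
      refine ⟨τ, by simpa using h, ?_⟩
      cases b <;> simp

theorem nodup_allStr (n : ℕ) : (allStr n).Nodup := by
  induction n with
  | zero => simp [allStr]
  | succ n ih =>
    rw [allStr, List.nodup_flatMap]
    refine ⟨fun σ _ => by simp, ?_⟩
    refine ih.imp ?_
    intro σ τ h
    simp [Function.onFun, List.disjoint_left, h]

theorem length_allStr (n : ℕ) : (allStr n).length = 2 ^ n := by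
  induction n with
  | zero => rfl
  | succ n ih => simp [allStr, List.length_flatMap, ih, pow_succ]

@[fun_prop] theorem pr_allStr {f : α → ℕ} (hf : Primrec f) : Primrec (fun a => allStr (f a)) := by
  have : Primrec (fun a => (fun l : List (List Bool) =>
      l.flatMap fun σ => [σ ++ [false], σ ++ [true]])^[f a] [[]]) := by fun_prop
  refine this.of_eq fun a => ?_
  induction f a with
  | zero => rfl
  | succ n ih => rw [Function.iterate_succ_apply', ih]; rfl

end prauto

/-! ### Strings and prefixes -/

theorem sp_length (X : ℕ → Bool) (n : ℕ) : (strPrefix X n).length = n := by simp [strPrefix]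

theorem sp_get? (X : ℕ → Bool) (n i : ℕ) : (strPrefix X n)[i]? = if i < n then some (X i) else none := by
  simp only [strPrefix, List.getElem?_map]
  split_ifs with h
  · simp [h]
  · simp [h]

theorem sp_getD (X : ℕ → Bool) {n i : ℕ} (h : i < n) (b : Bool) : (strPrefix X n).getD i b = X i := by
  simp [List.getD_eq_getElem?_getD, sp_get?, h]

theorem sp_take (X : ℕ → Bool) (n k : ℕ) : (strPrefix X n).take k = strPrefix X (min k n) := by
  simp [strPrefix, ← List.map_take, List.take_range]

theorem sp_mono (X : ℕ → Bool) {m n : ℕ} (h : m ≤ n) : strPrefix X m <+: strPrefix X n := by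
  rw [List.prefix_iff_eq_take, sp_take, sp_length, min_eq_left h]

theorem sp_succ (X : ℕ → Bool) (n : ℕ) : strPrefix X (n + 1) = strPrefix X n ++ [X n] := by
  simp [strPrefix, List.range_succ]

theorem sp_zero (X : ℕ → Bool) : strPrefix X 0 = [] := rfl

theorem isPrefixOf_iff {σ : List Bool} {X : ℕ → Bool} :
    IsPrefixOf σ X ↔ strPrefix X σ.length = σ := by
  constructor
  · intro h
    apply List.ext_getElem?
    intro i
    rw [sp_get?]
    split_ifs with hi
    · have := h ⟨i, hi⟩
      simp at this
      rw [this]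
      simp
    · simp at hi; simp [hi]
  · intro h i
    have := sp_getD X i.2 false
    rw [h] at this
    rw [← this]
    simp

theorem isPrefixOf_sp (X : ℕ → Bool) (n : ℕ) : IsPrefixOf (strPrefix X n) X := by
  rw [isPrefixOf_iff, sp_length]

theorem sp_prefix_iff {σ : List Bool} {X : ℕ → Bool} {n : ℕ} :
    σ <+: strPrefix X n ↔ IsPrefixOf σ X ∧ σ.length ≤ n := by
  constructor
  · intro h
    have hl : σ.length ≤ n := by simpa [sp_length] using h.length_le
    refine ⟨?_, hl⟩
    rw [List.prefix_iff_eq_take, sp_take, min_eq_left hl] at h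
    exact isPrefixOf_iff.2 h.symm
  · rintro ⟨h, hl⟩
    rw [isPrefixOf_iff] at h
    rw [← h]; exact sp_mono _ (by simpa [sp_length] using hl)

theorem prefix_sp_eq {σ : List Bool} {X : ℕ → Bool} {n : ℕ} (h : σ <+: strPrefix X n) :
    σ = strPrefix X σ.length := (isPrefixOf_iff.1 (sp_prefix_iff.1 h).1).symm

theorem isPrefixOf_of_prefix {σ τ : List Bool} {X : ℕ → Bool} (h : σ <+: τ) (hτ : IsPrefixOf τ X) :
    IsPrefixOf σ X := by
  rw [isPrefixOf_iff] at hτ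
  rw [← hτ] at h
  exact (sp_prefix_iff.1 h).1

theorem isPrefixOf_nil (X : ℕ → Bool) : IsPrefixOf [] X := fun i => i.elim0

theorem mem_cyl {σ : List Bool} {X : ℕ → Bool} : X ∈ cylinder σ ↔ IsPrefixOf σ X := Iff.rfl

theorem mem_openOf {S : Set (List Bool)} {X : ℕ → Bool} :
    X ∈ openOf S ↔ ∃ n, strPrefix X n ∈ S := by
  simp only [openOf, Set.mem_iUnion, exists_prop, mem_cyl]
  constructor
  · rintro ⟨σ, h, h2⟩; exact ⟨σ.length, by rwa [isPrefixOf_iff.1 h2]⟩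
  · rintro ⟨n, h⟩; exact ⟨_, h, isPrefixOf_sp X n⟩

/-- extend a string by zeros -/
def padS (σ : List Bool) : ℕ → Bool := fun i => σ.getD i false

theorem isPrefixOf_padS (σ : List Bool) : IsPrefixOf σ (padS σ) := by
  intro i; simp [padS]

theorem sp_padS (σ : List Bool) : strPrefix (padS σ) σ.length = σ :=
  isPrefixOf_iff.1 (isPrefixOf_padS σ)

theorem sp_congr {X Y : ℕ → Bool} {n : ℕ} : strPrefix X n = strPrefix Y n ↔ ∀ i < n, X i = Y i := by
  constructor
  · intro h i hi
    rw [← sp_getD X hi false, h, sp_getD Y hi false]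
  · intro h
    simp only [strPrefix]
    apply List.map_congr_left
    simpa using h

/-! ### Σ₁ predicates relative to oracles -/

section sig
variable {α β γ : Type} [Primcodable α] [Primcodable β] [Primcodable γ]

theorem re_nf {Φ : List Bool × α → Prop} (h : REPred Φ) :
    ∃ f : List Bool × α → Bool, Primrec f ∧
      (∀ a b z, a <+: b → f (a, z) = true → f (b, z) = true) ∧
      ∀ A z, (∃ n, Φ (strPrefix A n, z)) ↔ ∃ n, f (strPrefix A n, z) = true := by
  obtain ⟨g, hg, hgm, hgp⟩ := re_stage h
  have hp : PrimrecPred (fun x : List Bool × α => ∃ k ≤ x.1.length,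
    g ((x.1.take k, x.2), x.1.length) = true) := by fun_prop
  classical
  refine ⟨fun x => decide (∃ k ≤ x.1.length, g ((x.1.take k, x.2), x.1.length) = true),
    by fun_prop, ?_, ?_⟩
  · intro a b z hab
    simp only [decide_eq_true_eq]
    rintro ⟨k, hk, hgk⟩
    refine ⟨k, hk.trans hab.length_le, ?_⟩
    have : b.take k = a.take k := by
      rw [List.prefix_iff_eq_take.1 hab, List.take_take, min_eq_left hk]
    rw [this]
    exact hgm _ _ _ hab.length_le hgk
  · intro A z
    simp only [decide_eq_true_eq, sp_length, hgp]
    constructor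
    · rintro ⟨n, s, hs⟩
      refine ⟨max n s, n, le_max_left _ _, ?_⟩
      rw [sp_take, min_eq_left (le_max_left _ _)]
      exact hgm _ _ _ (le_max_right _ _) hs
    · rintro ⟨n, k, hk, h⟩
      rw [sp_take, min_eq_left hk] at h
      exact ⟨_, _, h⟩

/-- `S` is Σ₁ in the oracle `A`. -/
def Sig (A : ℕ → Bool) (S : α → Prop) : Prop :=
  ∃ f : List Bool × α → Bool, Primrec f ∧
    (∀ a b z, a <+: b → f (a, z) = true → f (b, z) = true) ∧
    ∀ z, S z ↔ ∃ n, f (strPrefix A n, z) = true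

variable {A : ℕ → Bool}

attribute [fun_prop] Sig

theorem Sig.of_eq {S T : α → Prop} (h : Sig A S) (e : ∀ z, S z ↔ T z) : Sig A T := by
  obtain ⟨f, hf, hm, hs⟩ := h
  exact ⟨f, hf, hm, fun z => (e z).symm.trans (hs z)⟩

theorem sig_of_re {Φ : List Bool × α → Prop} (h : REPred Φ) :
    Sig A (fun z => ∃ n, Φ (strPrefix A n, z)) := by
  obtain ⟨f, hf, hm, hs⟩ := re_nf h
  exact ⟨f, hf, hm, hs A⟩

@[fun_prop] theorem sig_re {p : α → Prop} (h : REPred p) : Sig A p :=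
  (sig_of_re (A := A) (Φ := fun x => p x.2) (re_comp h Primrec.snd)).of_eq fun z => by simp

@[fun_prop] theorem sig_const (p : Prop) : Sig A (fun _ : α => p) := sig_re (re_const p)
@[fun_prop] theorem sig_eq {f g : α → β} (hf : Primrec f) (hg : Primrec g) :
    Sig A (fun a => f a = g a) := sig_re (re_eq hf hg)
@[fun_prop] theorem sig_ne {f g : α → β} (hf : Primrec f) (hg : Primrec g) :
    Sig A (fun a => f a ≠ g a) := sig_re (re_ne hf hg)
@[fun_prop] theorem sig_lt {f g : α → ℕ} (hf : Primrec f) (hg : Primrec g) :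
    Sig A (fun a => f a < g a) := sig_re (re_lt hf hg)
@[fun_prop] theorem sig_le {f g : α → ℕ} (hf : Primrec f) (hg : Primrec g) :
    Sig A (fun a => f a ≤ g a) := sig_re (re_le hf hg)
@[fun_prop] theorem sig_prefix {f g : α → List β} (hf : Primrec f) (hg : Primrec g) :
    Sig A (fun a => f a <+: g a) := sig_re (re_prefix hf hg)
@[fun_prop] theorem sig_not {p : α → Prop} (hp : PrimrecPred p) :
    Sig A (fun a => ¬ p a) := sig_re (re_not hp)

theorem sig_comp {p : β → Prop} {f : α → β} (h : Sig A p) (hf : Primrec f) :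
    Sig A (fun a => p (f a)) := by
  obtain ⟨g, hg, hm, hs⟩ := h
  exact ⟨fun x => g (x.1, f x.2), by fun_prop, fun a b z => hm a b (f z), fun z => hs (f z)⟩

/-- Using the oracle. -/
theorem sig_orc {f : α → ℕ} {g : α → List Bool} (hf : Primrec f) (hg : Primrec g) :
    Sig A (fun z => strPrefix A (f z) = g z) := by
  have : REPred (fun x : List Bool × α => x.1.length = f x.2 ∧ x.1 = g x.2) := by fun_prop
  refine (sig_of_re this).of_eq fun z => ?_
  constructor
  · rintro ⟨n, h1, h2⟩
    rw [sp_length] at h1; rw [← h1]; exact h2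
  · intro h; exact ⟨f z, sp_length _ _, h⟩

@[fun_prop] theorem sig_and {p q : α → Prop} (hp : Sig A p) (hq : Sig A q) :
    Sig A (fun a => p a ∧ q a) := by
  obtain ⟨f, hf, fm, fs⟩ := hp
  obtain ⟨g, hg, gm, gs⟩ := hq
  refine ⟨fun x => f x && g x, by fun_prop, fun a b z h => ?_, fun z => ?_⟩
  · simp only [Bool.and_eq_true]
    exact And.imp (fm a b z h) (gm a b z h)
  · dsimp only
    rw [fs, gs]
    constructor
    · rintro ⟨⟨s, hs⟩, t, ht⟩
      exact ⟨max s t, by simp [fm _ _ z (sp_mono A (le_max_left s t)) hs,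
        gm _ _ z (sp_mono A (le_max_right s t)) ht]⟩
    · rintro ⟨n, hn⟩
      simp at hn
      exact ⟨⟨n, hn.1⟩, n, hn.2⟩

@[fun_prop] theorem sig_or {p q : α → Prop} (hp : Sig A p) (hq : Sig A q) :
    Sig A (fun a => p a ∨ q a) := by
  obtain ⟨f, hf, fm, fs⟩ := hp
  obtain ⟨g, hg, gm, gs⟩ := hq
  refine ⟨fun x => f x || g x, by fun_prop, fun a b z h => ?_, fun z => ?_⟩
  · simp only [Bool.or_eq_true]
    exact Or.imp (fm a b z h) (gm a b z h)
  · dsimp only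
    rw [fs, gs]; simp [exists_or]

@[fun_prop] theorem sig_ex {p : α → β → Prop} (hp : Sig A (fun x : α × β => p x.1 x.2)) :
    Sig A (fun a => ∃ b, p a b) := by
  obtain ⟨f, hf, fm, fs⟩ := hp
  have : REPred (fun x : List Bool × α => ∃ b, f (x.1, (x.2, b)) = true) := by fun_prop
  refine (sig_of_re this).of_eq fun z => ?_
  constructor
  · rintro ⟨n, b, h⟩; exact ⟨b, (fs (z, b)).2 ⟨n, h⟩⟩
  · rintro ⟨b, h⟩
    obtain ⟨n, hn⟩ := (fs (z, b)).1 h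
    exact ⟨n, b, hn⟩

@[fun_prop] theorem sig_ball {f : α → List β} {p : α → β → Prop} (hf : Primrec f)
    (hp : Sig A (fun x : α × β => p x.1 x.2)) :
    Sig A (fun a => ∀ b ∈ f a, p a b) := by
  obtain ⟨g, hg, gm, gs⟩ := hp
  have : REPred (fun x : List Bool × α => ∀ b ∈ f x.2, g (x.1, (x.2, b)) = true) := by fun_prop
  refine (sig_of_re this).of_eq fun a => ?_
  clear this
  constructor
  · rintro ⟨s, hs⟩ b hb
    exact (gs (a, b)).2 ⟨s, hs b hb⟩
  · intro H
    dsimp only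
    generalize f a = l at H
    induction l with
    | nil => exact ⟨0, by simp⟩
    | cons b l ih =>
      obtain ⟨s, hs⟩ := ih fun b' hb' => H b' (List.mem_cons_of_mem _ hb')
      obtain ⟨t, ht⟩ := (gs (a, b)).1 (H b List.mem_cons_self)
      refine ⟨max s t, fun b' hb' => ?_⟩
      rcases List.mem_cons.1 hb' with rfl | h
      · exact gm _ _ _ (sp_mono A (le_max_right s t)) ht
      · exact gm _ _ _ (sp_mono A (le_max_left s t)) (hs b' h)

@[fun_prop] theorem sig_alllt {f : α → ℕ} {p : α → ℕ → Prop} (hf : Primrec f)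
    (hp : Sig A (fun x : α × ℕ => p x.1 x.2)) :
    Sig A (fun a => ∀ i < f a, p a i) := by
  have : Sig A (fun a => ∀ b ∈ List.range (f a), p a b) := by fun_prop
  exact this.of_eq fun a => by simp

theorem re_of_sig_empty {p : α → Prop} (h : Sig emptyOracle p) : REPred p := by
  obtain ⟨f, hf, fm, fs⟩ := h
  have : REPred (fun z => ∃ n : ℕ, f ((List.replicate n false), z) = true) := by fun_prop
  refine this.of_eq fun z => ?_
  rw [fs]
  have : ∀ n, strPrefix emptyOracle n = List.replicate n false := by
    intro n; rw [strPrefix]; unfold emptyOracle; rw [List.map_const']; simp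
  simp [this]

/-! ### Links with the frozen definitions -/

open Nat.Partrec (Code)

theorem re_WEnum : REPred (fun x : ℕ × ℕ => WEnum x.1 x.2) := by
  have h : Partrec (fun x : ℕ × ℕ => (Denumerable.ofNat Code x.1).eval x.2) :=
    Code.eval_part.comp ((Computable.ofNat Code).comp Computable.fst) Computable.snd
  exact h.dom_re

theorem exists_WEnum {p : ℕ → Prop} (h : REPred p) : ∃ e, ∀ n, WEnum e n ↔ p n := by
  obtain ⟨c, hc⟩ := Code.exists_code.1 h
  refine ⟨Encodable.encode c, fun n => ?_⟩
  rw [WEnum, Denumerable.ofNat_encode, hc]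
  simp [Part.assert]

theorem re_decode {p : α → Prop} (h : REPred p) :
    REPred (fun n : ℕ => ∃ a : α, Encodable.encode a = n ∧ p a) := by
  obtain ⟨f, hf, -, hs⟩ := re_stage h
  have : REPred (fun n : ℕ => ∃ a : α, Encodable.encode a = n ∧ ∃ s, f (a, s) = true) := by fun_prop
  exact this.of_eq fun n => by simp only [hs]

theorem exists_oracle {Φ : List Bool × ℕ × ℕ → Prop} (h : REPred Φ) :
    ∃ e, ∀ X n m, OracleComputes e X n m ↔ ∃ k, Φ (strPrefix X k, n, m) := by
  obtain ⟨f, hf, -, hs⟩ := re_stage h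
  have h' : REPred (fun z : ℕ => ∃ σ : List Bool, z.unpair.1 = Encodable.encode σ ∧
    ∃ s, f ((σ, z.unpair.2.unpair.1, z.unpair.2.unpair.2), s) = true) := by fun_prop
  obtain ⟨e, he⟩ := exists_WEnum h'
  refine ⟨e, fun X n m => ?_⟩
  simp only [OracleComputes, he, Nat.unpair_pair, Encodable.encode_inj, hs]
  constructor
  · rintro ⟨σ, h1, _, rfl, h2⟩
    rw [isPrefixOf_iff] at h1
    exact ⟨σ.length, by rwa [h1]⟩
  · rintro ⟨k, hk⟩
    exact ⟨_, isPrefixOf_sp X k, _, rfl, hk⟩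

theorem re_oracle : REPred (fun x : ℕ × List Bool × ℕ × ℕ =>
    WEnum x.1 (Nat.pair (Encodable.encode x.2.1) (Nat.pair x.2.2.1 x.2.2.2))) :=
  re_comp (f := fun x : ℕ × List Bool × ℕ × ℕ =>
    (x.1, Nat.pair (Encodable.encode x.2.1) (Nat.pair x.2.2.1 x.2.2.2))) re_WEnum (by fun_prop)

theorem oracleComputes_iff {e : ℕ} {X : ℕ → Bool} {n m : ℕ} : OracleComputes e X n m ↔
    ∃ k, WEnum e (Nat.pair (Encodable.encode (strPrefix X k)) (Nat.pair n m)) := by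
  constructor
  · rintro ⟨σ, h1, h2⟩
    rw [isPrefixOf_iff] at h1
    exact ⟨σ.length, by rwa [h1]⟩
  · rintro ⟨k, hk⟩
    exact ⟨_, isPrefixOf_sp X k, hk⟩

theorem sig_oracle (A : ℕ → Bool) :
    Sig A (fun x : ℕ × ℕ × ℕ => OracleComputes x.1 A x.2.1 x.2.2) := by
  have : REPred (fun y : List Bool × (ℕ × ℕ × ℕ) =>
      WEnum y.2.1 (Nat.pair (Encodable.encode y.1) (Nat.pair y.2.2.1 y.2.2.2))) :=
    re_comp (f := fun y : List Bool × (ℕ × ℕ × ℕ) => (y.2.1, y.1, y.2.2.1, y.2.2.2)) re_oracle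
      (by fun_prop)
  refine (sig_of_re this).of_eq fun z => ?_
  rw [oracleComputes_iff]

theorem re_zeroJump : REPred (fun n => zeroJump n = true) := by
  have h := re_of_sig_empty (sig_oracle emptyOracle)
  have h2 : REPred (fun n : ℕ => ∃ m : ℕ, OracleComputes n emptyOracle n m) :=
    re_ex (re_comp (f := fun x : ℕ × ℕ => (x.1, x.1, x.2)) h (by fun_prop))
  exact h2.of_eq fun n => by simp [zeroJump, jump]

theorem turingLE_of_sig {Y : ℕ → Bool} (h : Sig Y (fun n => zeroJump n = false)) :
    TuringLE zeroJump Y := by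
  have h2 : Sig Y (fun n => zeroJump n = true) := sig_re re_zeroJump
  have h3 : Sig Y (fun x : ℕ × ℕ => (zeroJump x.1 = true ∧ x.2 = 1) ∨ (zeroJump x.1 = false ∧ x.2 = 0)) := by
    have a := sig_comp h (f := fun x : ℕ × ℕ => x.1) (by fun_prop)
    have b := sig_comp h2 (f := fun x : ℕ × ℕ => x.1) (by fun_prop)
    exact sig_or (sig_and b (by fun_prop)) (sig_and a (by fun_prop))
  obtain ⟨f, hf, -, hs⟩ := h3
  obtain ⟨e, he⟩ := exists_oracle (Φ := fun x => f x = true) (by fun_prop)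
  refine ⟨e, fun n m => ?_⟩
  rw [he, ← hs (n, m)]
  cases h : zeroJump n <;> simp [natOfBool, h]

theorem re_reduce_zeroJump {D : α → Prop} (h : REPred D) :
    ∃ g : α → ℕ, Primrec g ∧ ∀ a, D a ↔ zeroJump (g a) = true := by
  have h1 : REPred (fun n : ℕ => ∃ a : α, Encodable.encode a = n.unpair.1 ∧ D a) := by
    exact re_comp (f := fun n : ℕ => n.unpair.1) (re_decode h) (by fun_prop)
  obtain ⟨c, hc⟩ := Code.exists_code.1 h1
  refine ⟨fun a => Encodable.encode (Code.curry c (Encodable.encode a)), ?_, fun a => ?_⟩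
  · exact Primrec.encode.comp (Code.primrec₂_curry.comp (Primrec.const c) Primrec.encode)
  · have key : ∀ x, WEnum (Encodable.encode (Code.curry c (Encodable.encode a))) x ↔ D a := by
      intro x
      rw [WEnum, Denumerable.ofNat_encode, Code.eval_curry, hc]
      simp [Part.assert]
    simp [zeroJump, jump, oracleComputes_iff, key]

theorem sig_of_turingLE {Y : ℕ → Bool} (h : TuringLE zeroJump Y) :
    Sig Y (fun n => zeroJump n = false) := by
  obtain ⟨e, he⟩ := h
  refine (sig_comp (sig_oracle Y) (f := fun n : ℕ => (e, n, 0)) (by fun_prop)).of_eq fun n => ?_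
  rw [he]
  dsimp only
  cases zeroJump n <;> simp [natOfBool]

theorem sig_co_re {Y : ℕ → Bool} (h : TuringLE zeroJump Y) {D : α → Prop} (hD : REPred D) :
    Sig Y (fun a => ¬ D a) := by
  obtain ⟨g, hg, hgs⟩ := re_reduce_zeroJump hD
  exact (sig_comp (sig_of_turingLE h) hg).of_eq fun a => by simp [hgs]

/-! joins -/

/-- prefix of the join from prefixes of the parts -/
def joinStr (a b : List Bool) : List Bool :=
  (List.range (2 * min a.length b.length)).map fun i =>
    if i % 2 = 0 then a.getD (i / 2) false else b.getD (i / 2) false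

@[fun_prop] theorem pr_joinStr {f g : α → List Bool} (hf : Primrec f) (hg : Primrec g) :
    Primrec (fun a => joinStr (f a) (g a)) := by
  unfold joinStr; fun_prop

theorem joinStr_sp (A X : ℕ → Bool) (n : ℕ) :
    joinStr (strPrefix A n) (strPrefix X n) = strPrefix (joinSet A X) (2 * n) := by
  simp only [joinStr, sp_length, min_self]
  conv_rhs => rw [strPrefix]
  apply List.map_congr_left
  intro i hi
  simp at hi
  have : i / 2 < n := by omega
  simp only [joinSet, sp_getD _ this]

theorem sig_join_iff {A X : ℕ → Bool} {p : α → Prop} : Sig (joinSet A X) p ↔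
    ∃ f : List Bool × List Bool × α → Bool, Primrec f ∧
      (∀ a a' b b' z, a <+: a' → b <+: b' → f (a, b, z) = true → f (a', b', z) = true) ∧
      ∀ z, p z ↔ ∃ n, f (strPrefix A n, strPrefix X n, z) = true := by
  constructor
  · rintro ⟨f, hf, fm, fs⟩
    refine ⟨fun x => f (joinStr x.1 x.2.1, x.2.2), by fun_prop, ?_, ?_⟩
    · intro a a' b b' z h1 h2 h
      refine fm _ _ z ?_ h
      simp only [joinStr]
      rw [List.prefix_iff_getElem?]
      intro i hi
      simp only [List.length_map, List.length_range] at hi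
      have l1 := h1.length_le
      have l2 := h2.length_le
      have : i < 2 * min a'.length b'.length := by omega
      have i1 : i / 2 < a.length := by omega
      have i2 : i / 2 < b.length := by omega
      simp only [List.getElem?_map, List.getElem?_range this, Option.map_some, List.getElem_map,
        List.getElem_range, Option.some_inj]
      have e1 : a'.getD (i / 2) false = a.getD (i / 2) false := by
        obtain ⟨t, rfl⟩ := h1
        exact List.getD_append _ _ _ _ i1
      have e2 : b'.getD (i / 2) false = b.getD (i / 2) false := by
        obtain ⟨t, rfl⟩ := h2
        exact List.getD_append _ _ _ _ i2
      rw [e1, e2]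
    · intro z
      simp only [joinStr_sp, fs]
      constructor
      · rintro ⟨n, hn⟩
        exact ⟨n, fm _ _ _ (sp_mono _ (by omega)) hn⟩
      · rintro ⟨n, hn⟩; exact ⟨_, hn⟩
  · rintro ⟨f, hf, fm, fs⟩
    have : REPred (fun y : List Bool × α => f (
      (List.range (y.1.length / 2)).map (fun i => y.1.getD (2 * i) false),
      (List.range (y.1.length / 2)).map (fun i => y.1.getD (2 * i + 1) false), y.2) = true) := by
      fun_prop
    refine (sig_of_re this).of_eq fun z => ?_
    rw [fs]
    have key : ∀ n, (List.range (n / 2)).map (fun i => (strPrefix (joinSet A X) n).getD (2 * i) false) =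
      strPrefix A (n / 2) ∧ (List.range (n / 2)).map
        (fun i => (strPrefix (joinSet A X) n).getD (2 * i + 1) false) = strPrefix X (n / 2) := by
      intro n
      constructor <;>
      · conv_rhs => rw [strPrefix]
        apply List.map_congr_left
        intro i hi
        simp only [List.mem_range] at hi
        rw [sp_getD _ (by omega)]
        simp only [joinSet]
        have a1 : 2 * i / 2 = i := by omega
        have a2 : (2 * i + 1) / 2 = i := by omega
        have a3 : (2 * i + 1) % 2 = 1 := by omega
        simp [a1, a2, a3]
    simp only [sp_length, (key _).1, (key _).2]
    constructor
    · rintro ⟨n, hn⟩; exact ⟨_, hn⟩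
    · rintro ⟨n, hn⟩; exact ⟨2 * n, by simpa using hn⟩

end sig

/-! ### Measure on Cantor space -/

/-- value of a string as a binary number -/
def valS (σ : List Bool) : ℕ := σ.foldl (fun n b => 2 * n + natOfBool b) 0

theorem valS_concat (σ : List Bool) (b : Bool) : valS (σ ++ [b]) = 2 * valS σ + natOfBool b := by
  simp [valS]

theorem valS_lt (σ : List Bool) : valS σ < 2 ^ σ.length := by
  induction σ using List.reverseRecOn with
  | nil => simp [valS]
  | append_singleton σ b ih =>
    rw [valS_concat]; cases b <;> simp [natOfBool, pow_succ] <;> omega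

theorem isPrefixOf_concat {σ : List Bool} {b : Bool} {X : ℕ → Bool} :
    IsPrefixOf (σ ++ [b]) X ↔ IsPrefixOf σ X ∧ X σ.length = b := by
  simp only [isPrefixOf_iff]
  simp only [List.length_append, List.length_singleton, sp_succ]
  constructor
  · intro h
    obtain ⟨h1, h2⟩ := List.append_inj' h rfl
    exact ⟨h1, by simpa using h2⟩
  · rintro ⟨h1, h2⟩
    rw [h1, h2]

theorem floor_two_mul (y : ℝ) : ⌊y * 2⌋ = 2 * ⌊y⌋ ∨ ⌊y * 2⌋ = 2 * ⌊y⌋ + 1 := by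
  have h1 := Int.floor_le y
  have h2 := Int.lt_floor_add_one y
  rcases lt_or_ge y (⌊y⌋ + 1 / 2) with h | h
  · left; rw [Int.floor_eq_iff]; push_cast; constructor <;> linarith
  · right; rw [Int.floor_eq_iff]; push_cast; constructor <;> linarith

theorem binaryDigits_prefix (σ : List Bool) {x : ℝ} (hx : x ∈ Set.Ico (0 : ℝ) 1) :
    IsPrefixOf σ (binaryDigits x) ↔ ⌊x * 2 ^ σ.length⌋ = (valS σ : ℤ) := by
  induction σ using List.reverseRecOn with
  | nil =>
    simp only [isPrefixOf_nil, true_iff, valS, List.length_nil, pow_zero, mul_one, List.foldl_nil]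
    rw [Int.floor_eq_iff]; simpa using hx
  | append_singleton σ b ih =>
    rw [isPrefixOf_concat, ih, valS_concat]
    simp only [List.length_append, List.length_singleton, binaryDigits]
    have h := floor_two_mul (x * 2 ^ σ.length)
    rw [mul_assoc, ← pow_succ] at h
    cases b <;> simp [natOfBool] <;> omega

theorem measurable_binaryDigits : Measurable binaryDigits := by
  rw [measurable_pi_iff]
  intro n
  unfold binaryDigits
  have h : Measurable (fun x : ℝ => ⌊x * 2 ^ (n + 1)⌋) :=
    Int.measurable_floor.comp (measurable_id.mul_const _)
  exact (Measurable.of_discrete (f := fun k : ℤ => decide (k % 2 = 1))).comp h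

theorem measurableSet_cyl (σ : List Bool) : MeasurableSet (cylinder σ) := by
  have : cylinder σ = ⋂ i : Fin σ.length, (fun X : ℕ → Bool => X i) ⁻¹' {σ.get i} := by
    ext X; simp [_root_.cylinder, IsPrefixOf]
  rw [this]
  exact MeasurableSet.iInter fun i => measurable_pi_apply _ (measurableSet_singleton _)

theorem mu_cyl (σ : List Bool) : μCantor (cylinder σ) = 2⁻¹ ^ σ.length := by
  rw [μCantor, Measure.map_apply measurable_binaryDigits (measurableSet_cyl σ),
    Measure.restrict_apply (measurable_binaryDigits (measurableSet_cyl σ))]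
  have h2 : (0 : ℝ) < 2 ^ σ.length := by positivity
  have : binaryDigits ⁻¹' cylinder σ ∩ Set.Ico 0 1 =
      Set.Ico ((valS σ : ℝ) / 2 ^ σ.length) ((valS σ + 1) / 2 ^ σ.length) := by
    ext x
    have hv := valS_lt σ
    have hv' : (valS σ : ℝ) + 1 ≤ 2 ^ σ.length := by exact_mod_cast hv
    constructor
    · rintro ⟨h, hx⟩
      have := (binaryDigits_prefix σ hx).1 h
      rw [Int.floor_eq_iff] at this
      simp only [Set.mem_Ico, div_le_iff₀ h2, lt_div_iff₀ h2]
      exact_mod_cast this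
    · intro h
      simp only [Set.mem_Ico, div_le_iff₀ h2, lt_div_iff₀ h2] at h
      have hx : x ∈ Set.Ico (0 : ℝ) 1 := by
        constructor
        · have : 0 ≤ x * 2 ^ σ.length := le_trans (by positivity) h.1
          exact nonneg_of_mul_nonneg_left this h2
        · by_contra hc
          push Not at hc
          nlinarith
      refine ⟨(binaryDigits_prefix σ hx).2 ?_, hx⟩
      rw [Int.floor_eq_iff]; exact_mod_cast h
  rw [this, Real.volume_Ico, ← sub_div, add_sub_cancel_left,
    ENNReal.ofReal_div_of_pos h2, ENNReal.ofReal_one, ENNReal.ofReal_pow (by norm_num)]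
  simp [ENNReal.inv_pow]

instance : IsProbabilityMeasure μCantor := by
  constructor
  have : (Set.univ : Set (ℕ → Bool)) = cylinder [] := by
    ext X; simp [mem_cyl, isPrefixOf_nil]
  rw [this, mu_cyl]; simp

theorem measurableSet_openOf (S : Set (List Bool)) : MeasurableSet (openOf S) :=
  MeasurableSet.biUnion S.to_countable fun σ _ => measurableSet_cyl σ

theorem mu_openOf_le (S : Set (List Bool)) : μCantor (openOf S) ≤ weight S := by
  refine (measure_biUnion_le μCantor S.to_countable _).trans ?_
  simp [weight, mu_cyl]

theorem cyl_disjoint {σ τ : List Bool} (h1 : ¬ σ <+: τ) (h2 : ¬ τ <+: σ) :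
    Disjoint (cylinder σ) (cylinder τ) := by
  rw [Set.disjoint_left]
  intro X hσ hτ
  rw [mem_cyl, isPrefixOf_iff] at hσ hτ
  rcases le_total σ.length τ.length with h | h
  · apply h1; rw [← hσ, ← hτ]; exact sp_mono X (by simpa [sp_length] using h)
  · apply h2; rw [← hσ, ← hτ]; exact sp_mono X (by simpa [sp_length] using h)

theorem mu_openOf_eq {S : Set (List Bool)} (h : PrefixFreeSet S) : μCantor (openOf S) = weight S := by
  rw [openOf, measure_biUnion S.to_countable _ fun σ _ => measurableSet_cyl σ]
  · simp [weight, mu_cyl]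
  · intro σ hσ τ hτ hne
    exact cyl_disjoint (fun hp => hne (h σ hσ τ hτ hp)) (fun hp => hne (h τ hτ σ hσ hp).symm)

theorem cyl_subset {σ τ : List Bool} (h : σ <+: τ) : cylinder τ ⊆ cylinder σ :=
  fun _ hX => isPrefixOf_of_prefix h hX

theorem weight_le_of_above {S : Set (List Bool)} (h : PrefixFreeSet S) {τ : List Bool}
    (hτ : ∀ σ ∈ S, τ <+: σ) : weight S ≤ 2⁻¹ ^ τ.length := by
  rw [← mu_openOf_eq h, ← mu_cyl]
  apply measure_mono
  intro X hX
  obtain ⟨n, hn⟩ := mem_openOf.1 hX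
  exact isPrefixOf_of_prefix (hτ _ hn) (isPrefixOf_sp X n)

/-- the set of sequences whose length `s` prefix satisfies `p` -/
def lvl (p : List Bool → Bool) (s : ℕ) : Set (ℕ → Bool) := {X | p (strPrefix X s) = true}

/-- the number of strings of length `s` satisfying `p` -/
def cnt (p : List Bool → Bool) (s : ℕ) : ℕ := ((allStr s).filter p).length

@[fun_prop] theorem pr_cnt {α : Type} [Primcodable α] {p : α → List Bool → Bool} {f : α → ℕ}
    (hp : Primrec (fun x : α × List Bool => p x.1 x.2)) (hf : Primrec f) :
    Primrec (fun a => cnt (p a) (f a)) := by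
  unfold cnt; fun_prop

theorem lvl_eq_openOf (p : List Bool → Bool) (s : ℕ) :
    lvl p s = openOf {σ | σ.length = s ∧ p σ = true} := by
  ext X
  rw [mem_openOf]
  simp [lvl, sp_length]

theorem measurableSet_lvl (p : List Bool → Bool) (s : ℕ) : MeasurableSet (lvl p s) := by
  rw [lvl_eq_openOf]; exact measurableSet_openOf _

theorem prefixFree_lvl (p : List Bool → Prop) (s : ℕ) :
    PrefixFreeSet {σ | σ.length = s ∧ p σ} := by
  rintro σ ⟨h1, -⟩ τ ⟨h2, -⟩ h
  exact h.eq_of_length (h1.trans h2.symm)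

theorem mu_lvl (p : List Bool → Bool) (s : ℕ) : μCantor (lvl p s) = cnt p s * 2⁻¹ ^ s := by
  rw [lvl_eq_openOf, mu_openOf_eq (prefixFree_lvl _ s), weight]
  have hS : {σ : List Bool | σ.length = s ∧ p σ = true} = ↑(((allStr s).filter p).toFinset) := by
    ext σ; simp [mem_allStr]
  rw [hS, Finset.tsum_subtype' (((allStr s).filter p).toFinset) (fun σ : List Bool => (2⁻¹ : ℝ≥0∞) ^ σ.length)]
  rw [Finset.sum_congr rfl (g := fun _ => (2⁻¹ : ℝ≥0∞) ^ s)]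
  · rw [Finset.sum_const, List.toFinset_card_of_nodup ((nodup_allStr s).filter _), cnt]
    simp
  · intro σ hσ; simp [mem_allStr] at hσ; rw [hσ.1]

theorem isOpen_cyl (σ : List Bool) : IsOpen (cylinder σ) := by
  have : cylinder σ = ⋂ i : Fin σ.length, (fun X : ℕ → Bool => X i) ⁻¹' {σ.get i} := by
    ext X; simp [_root_.cylinder, IsPrefixOf]
  rw [this]
  exact isOpen_iInter_of_finite fun i => (isOpen_discrete _).preimage (continuous_apply _)

theorem isOpen_openOf (S : Set (List Bool)) : IsOpen (openOf S) :=
  isOpen_biUnion fun σ _ => isOpen_cyl σ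

/-- extension closed -/
def ExtC (U : List Bool → Bool) : Prop := ∀ a b, a <+: b → U a = true → U b = true

theorem lvl_mono {U : List Bool → Bool} (h : ExtC U) : Monotone (lvl U) := fun _ _ hst X hX =>
  h _ _ (sp_mono X hst) hX

theorem openOf_eq_iUnion_lvl (U : List Bool → Bool) :
    openOf {σ | U σ = true} = ⋃ s, lvl U s := by
  ext X; simp [mem_openOf, lvl]

theorem bar_lemma {U : List Bool → Bool} (h : ExtC U) (hb : ∀ X, ∃ n, U (strPrefix X n) = true) :
    ∃ N, ∀ η : List Bool, η.length = N → U η = true := by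
  have hc : IsCompact (Set.univ : Set (ℕ → Bool)) := isCompact_univ
  obtain ⟨N, hN⟩ := hc.elim_directed_cover (lvl U)
    (fun s => by rw [lvl_eq_openOf]; exact isOpen_openOf _)
    (fun X _ => Set.mem_iUnion.2 (hb X))
    (lvl_mono h).directed_le
  refine ⟨N, fun η hη => ?_⟩
  have := hN (Set.mem_univ (padS η))
  simpa [lvl, ← hη, sp_padS] using this

/-- minimal elements -/
def minE (U : List Bool → Bool) : Set (List Bool) :=
  {η | U η = true ∧ (η = [] ∨ U η.dropLast = false)}

theorem dropLast_prefix' {σ τ : List Bool} (h : σ <+: τ) (hne : σ ≠ τ) : σ <+: τ.dropLast := by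
  have h1 := h.length_le
  have h2 : σ.length ≠ τ.length := fun e => hne (h.eq_of_length e)
  rw [List.prefix_iff_eq_take, List.dropLast_eq_take, List.take_take,
    min_eq_left (by omega)]
  exact List.prefix_iff_eq_take.1 h

theorem minE_prefixFree {U : List Bool → Bool} (h : ExtC U) : PrefixFreeSet (minE U) := by
  rintro σ ⟨h1, -⟩ τ ⟨h2, h3⟩ hp
  by_contra hne
  rcases h3 with rfl | h3
  · exact hne (List.prefix_nil.1 hp)
  · have := h _ _ (dropLast_prefix' hp hne) h1
    simp [h3] at this

theorem minE_exists {U : List Bool → Bool} {σ : List Bool} (h : U σ = true) :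
    ∃ τ ∈ minE U, τ <+: σ := by
  induction hn : σ.length using Nat.strong_induction_on generalizing σ with
  | _ n ih =>
    by_cases hm : σ ∈ minE U
    · exact ⟨σ, hm, List.prefix_refl σ⟩
    · simp only [minE, Set.mem_ofPred_eq, h, true_and, not_or] at hm
      have h2 : U σ.dropLast = true := by simpa using hm.2
      have : 0 < σ.length := List.length_pos_iff.2 hm.1
      obtain ⟨τ, h3, h4⟩ := ih σ.dropLast.length (by simp; omega) h2 rfl
      exact ⟨τ, h3, h4.trans (List.dropLast_prefix σ)⟩

theorem openOf_minE (U : List Bool → Bool) :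
    openOf (minE U) = openOf {σ | U σ = true} := by
  ext X
  rw [mem_openOf, mem_openOf]
  constructor
  · rintro ⟨n, h, -⟩; exact ⟨n, h⟩
  · rintro ⟨n, h⟩
    obtain ⟨τ, h1, h2⟩ := minE_exists (U := U) h
    exact ⟨τ.length, by rwa [← prefix_sp_eq h2]⟩

/-! ### Weights -/

section wts
variable {α β : Type}

/-- weight of a set with exponents `r` -/
noncomputable def wtf (r : α → ℕ) (S : Set α) : ℝ≥0∞ := ∑' x : S, 2⁻¹ ^ (r x)

theorem weight_eq (S : Set (List Bool)) : weight S = wtf List.length S := rfl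

theorem wtf_mono (r : α → ℕ) {S T : Set α} (h : S ⊆ T) : wtf r S ≤ wtf r T :=
  ENNReal.tsum_mono_subtype (fun x => 2⁻¹ ^ (r x)) h

theorem wtf_union (r : α → ℕ) (S T : Set α) : wtf r (S ∪ T) ≤ wtf r S + wtf r T :=
  ENNReal.tsum_union_le (fun x => 2⁻¹ ^ (r x)) S T

theorem wtf_iUnion (r : α → ℕ) {ι : Type} (S : ι → Set α) : wtf r (⋃ i, S i) ≤ ∑' i, wtf r (S i) :=
  ENNReal.tsum_iUnion_le_tsum (fun x => 2⁻¹ ^ (r x)) S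

theorem wtf_finset (r : α → ℕ) (F : Finset α) : wtf r (F : Set α) = ∑ x ∈ F, 2⁻¹ ^ r x :=
  Finset.tsum_subtype' F (fun x => (2⁻¹ : ℝ≥0∞) ^ r x)

theorem wtf_le_of_finset (r : α → ℕ) {S : Set α} {C : ℝ≥0∞}
    (h : ∀ F : Finset α, (F : Set α) ⊆ S → ∑ x ∈ F, 2⁻¹ ^ r x ≤ C) : wtf r S ≤ C := by
  classical
  unfold wtf
  rw [ENNReal.tsum_eq_iSup_sum]
  refine iSup_le fun F => ?_
  have := h (F.map ⟨Subtype.val, Subtype.val_injective⟩) (by intro x; simp; tauto)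
  simpa using this

theorem wtf_finite (r : α → ℕ) {S : Set α} (h : S.Finite) : wtf r S < ⊤ := by
  rw [← h.coe_toFinset, wtf_finset]
  exact ENNReal.sum_lt_top.2 fun x _ => ENNReal.pow_lt_top (by simp)

theorem wtf_shift (r : α → ℕ) (d : ℕ) (S : Set α) :
    wtf (fun x => r x + d) S = wtf r S * 2⁻¹ ^ d := by
  unfold wtf; rw [← ENNReal.tsum_mul_right]; simp [pow_add]

/-- images (not necessarily injective) -/
theorem wtf_image_le (r : α → ℕ) (q : β → ℕ) (f : α → β) (S : Set α) (h : ∀ x ∈ S, q (f x) = r x) :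
    wtf q (f '' S) ≤ wtf r S := by
  classical
  choose g hg using fun y : f '' S => y.2
  have hinj : Function.Injective (fun y : f '' S => (⟨g y, (hg y).1⟩ : S)) := by
    intro y y' e
    simp only [Subtype.mk.injEq] at e
    apply Subtype.ext
    rw [← (hg y).2, ← (hg y').2, e]
  unfold wtf
  calc ∑' y : f '' S, (2⁻¹ : ℝ≥0∞) ^ q y = ∑' y : f '' S, (2⁻¹ : ℝ≥0∞) ^ r (g y) := by
        congr 1; ext y; rw [← h _ (hg y).1, (hg y).2]
    _ ≤ _ := ENNReal.tsum_comp_le_tsum_of_injective hinj (fun x : S => (2⁻¹ : ℝ≥0∞) ^ r x)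

theorem wtf_inj_le (r : α → ℕ) (q : β → ℕ) (f : α → β) (S : Set α) (T : Set β)
    (hf : Set.InjOn f S) (hm : ∀ x ∈ S, f x ∈ T) (h : ∀ x ∈ S, q (f x) ≤ r x) :
    wtf r S ≤ wtf q T := by
  have hinj : Function.Injective (fun x : S => (⟨f x, hm x x.2⟩ : T)) := by
    intro x x' e
    simp only [Subtype.mk.injEq] at e
    exact Subtype.ext (hf x.2 x'.2 e)
  unfold wtf
  refine le_trans (ENNReal.tsum_le_tsum fun x : S => ?_)
    (ENNReal.tsum_comp_le_tsum_of_injective hinj (fun x : T => (2⁻¹ : ℝ≥0∞) ^ q x))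
  exact pow_le_pow_right_of_le_one' (by simp) (h x x.2)

theorem tsum_geom : ∑' n : ℕ, (2⁻¹ : ℝ≥0∞) ^ n = 2 := by
  rw [ENNReal.tsum_geometric]
  have : (1 : ℝ≥0∞) - 2⁻¹ = 2⁻¹ := by
    rw [ENNReal.sub_eq_of_eq_add (by simp)]; exact (ENNReal.inv_two_add_inv_two).symm
  rw [this, inv_inv]

end wts

/-! ### Solovay's lemma -/

theorem exists_testLevel {G : ℕ × List Bool → Prop} (h : REPred G) :
    ∃ e, ∀ n, testLevel e emptyOracle n = openOf {σ | G (n, σ)} := by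
  obtain ⟨f, hf, -, hs⟩ := re_stage h
  have h' : REPred (fun x : List Bool × ℕ × ℕ => ∃ σ : List Bool, x.2.1.unpair.2 = Encodable.encode σ ∧
    ∃ s, f ((x.2.1.unpair.1, σ), s) = true) := by fun_prop
  obtain ⟨e, he⟩ := exists_oracle h'
  refine ⟨e, fun n => ?_⟩
  unfold testLevel
  congr 1
  ext σ
  simp [he, hs]

theorem exists_pow_ge {w : ℝ≥0∞} (h : w < ⊤) : ∃ M : ℕ, w ≤ 2 ^ M := by
  obtain ⟨n, hn⟩ := ENNReal.exists_nat_gt h.ne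
  refine ⟨n, hn.le.trans ?_⟩
  exact_mod_cast Nat.lt_two_pow_self.le

theorem solovay {X : ℕ → Bool} (hX : MLRandom X) {S : List Bool → Prop} (hS : REPred S)
    (hw : weight {σ | S σ} < ⊤) : {n | S (strPrefix X n)}.Finite := by
  classical
  by_contra hinf
  obtain ⟨M, hM⟩ := exists_pow_ge hw
  obtain ⟨f, hf, hfm, hfs⟩ := re_stage hS
  have hG : REPred (fun x : ℕ × List Bool => ∃ s : ℕ, 2 ^ (x.1 + M) ≤
      ((List.range (x.2.length + 1)).filter (fun k => f (x.2.take k, s))).length) := by fun_prop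
  obtain ⟨e, he⟩ := exists_testLevel hG
  have htest : ∀ n, μCantor (testLevel e emptyOracle n) ≤ 2⁻¹ ^ n := by
    intro n
    rw [he]
    let g : (ℕ → Bool) → ℝ≥0∞ := fun Y => ∑' σ : {σ | S σ}, (cylinder σ.1).indicator 1 Y
    have hg : ∫⁻ Y, g Y ∂μCantor = weight {σ | S σ} := by
      rw [lintegral_tsum fun σ => (measurable_one.indicator (measurableSet_cyl _)).aemeasurable]
      simp only [weight]
      congr 1; ext σ
      rw [lintegral_indicator_one (measurableSet_cyl _), mu_cyl]
    have hgm : Measurable g := Measurable.tsum fun σ =>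
      (measurable_one.indicator (measurableSet_cyl _))
    have hmk := mul_meas_ge_le_lintegral (μ := μCantor) hgm (2 ^ (n + M))
    rw [hg] at hmk
    have hsub : openOf {σ | (fun x : ℕ × List Bool => ∃ s : ℕ, 2 ^ (x.1 + M) ≤
      ((List.range (x.2.length + 1)).filter (fun k => f (x.2.take k, s))).length) (n, σ)} ⊆
        {Y | (2 : ℝ≥0∞) ^ (n + M) ≤ g Y} := by
      intro Y hY
      obtain ⟨m, s, hm⟩ := mem_openOf.1 hY
      dsimp only at hm
      simp only [sp_length] at hm
      set l := (List.range (m + 1)).filter (fun k => f ((strPrefix Y m).take k, s)) with hl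
      have hnd : l.Nodup := List.nodup_range.filter _
      have hmem : ∀ k ∈ l, S (strPrefix Y k) := by
        intro k hk
        simp only [hl, List.mem_filter, List.mem_range, sp_take] at hk
        rw [min_eq_left (by omega)] at hk
        exact (hfs _).2 ⟨s, hk.2⟩
      have : ((l.length : ℕ) : ℝ≥0∞) ≤ g Y := by
        let F : Finset {σ | S σ} := Finset.univ.image
          (fun k : {k // k ∈ l} => (⟨strPrefix Y k.1, hmem k.1 k.2⟩ : {σ | S σ}))
        have hF : F.card = l.length := by
          rw [Finset.card_image_of_injective, Finset.card_univ]
          · rw [Fintype.card_of_subtype l.toFinset (by simp), List.toFinset_card_of_nodup hnd]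
          · intro a b hab
            have := congrArg (fun z : {σ | S σ} => z.1.length) hab
            simp only [sp_length] at this
            exact Subtype.ext this
        calc ((l.length : ℕ) : ℝ≥0∞) = ∑ σ ∈ F, 1 := by simp [hF]
          _ ≤ ∑ σ ∈ F, (cylinder σ.1).indicator 1 Y := by
              apply Finset.sum_le_sum
              intro σ hσ
              simp only [F, Finset.mem_image] at hσ
              obtain ⟨k, -, rfl⟩ := hσ
              rw [Set.indicator_of_mem (mem_cyl.2 (isPrefixOf_sp Y k.1))]; simp
          _ ≤ g Y := ENNReal.sum_le_tsum _
      refine le_trans ?_ this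
      exact_mod_cast hm
    refine (measure_mono hsub).trans ?_
    have h2 : (2 : ℝ≥0∞) ^ (n + M) * μCantor {Y | (2 : ℝ≥0∞) ^ (n + M) ≤ g Y} ≤ 2 ^ M :=
      hmk.trans hM
    have h3 : (2 : ℝ≥0∞) ^ M ≠ 0 := by simp
    have h4 : (2 : ℝ≥0∞) ^ M ≠ ⊤ := by simp
    generalize μCantor {Y | (2 : ℝ≥0∞) ^ (n + M) ≤ g Y} = w at h2 ⊢
    rw [pow_add, mul_comm ((2:ℝ≥0∞) ^ n), mul_assoc] at h2
    have h2 : (2:ℝ≥0∞) ^ M * (2 ^ n * w) ≤ 2 ^ M * 1 := by simpa using h2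
    rw [ENNReal.mul_le_mul_iff_right h3 h4] at h2
    rw [← ENNReal.inv_pow, ENNReal.le_inv_iff_mul_le, mul_comm]
    exact h2
  obtain ⟨n, hn⟩ := hX (testLevel e emptyOracle) ⟨⟨e, fun _ => rfl⟩, htest⟩
  · apply hn
    rw [he, mem_openOf]
    obtain ⟨F, hF, hc⟩ := (show Set.Infinite _ from hinf).exists_subset_card_eq (2 ^ (n + M))
    have : ∃ s, ∀ k ∈ F, f (strPrefix X k, s) = true := by
      have h1 : ∀ k ∈ F, ∃ s, f (strPrefix X k, s) = true := fun k hk => (hfs _).1 (hF hk)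
      clear hF hc
      induction F using Finset.induction_on with
      | empty => simp
      | insert a F ha ih =>
        obtain ⟨s, hs⟩ := ih fun k hk => h1 k (Finset.mem_insert_of_mem hk)
        obtain ⟨t, ht⟩ := h1 a (Finset.mem_insert_self _ _)
        refine ⟨max s t, fun k hk => ?_⟩
        rcases Finset.mem_insert.1 hk with rfl | hk
        · exact hfm _ _ _ (le_max_right _ _) ht
        · exact hfm _ _ _ (le_max_left _ _) (hs k hk)
    obtain ⟨s, hs⟩ := this
    refine ⟨F.sup id, s, ?_⟩
    rw [← hc]
    dsimp only
    have hnd : ((List.range ((strPrefix X (F.sup id)).length + 1)).filter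
      (fun k => f ((strPrefix X (F.sup id)).take k, s))).Nodup := List.nodup_range.filter _
    rw [← List.toFinset_card_of_nodup hnd]
    apply Finset.card_le_card
    intro k hk
    have hk' : k ≤ F.sup id := Finset.le_sup (f := id) hk
    simp [sp_length, sp_take, hk', hs k hk]

/-! ### Kraft-Chaitin -/

theorem re_enum {α : Type} [Primcodable α] {L : α → Prop} (h : REPred L) :
    ∃ en : ℕ → Option α, Primrec en ∧ (∀ i j x, en i = some x → en j = some x → i = j) ∧
      ∀ x, L x ↔ ∃ i, en i = some x := by
  obtain ⟨f, hf, hfm, hfs⟩ := re_stage h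
  have hp : Primrec (fun i : ℕ => (Encodable.decode i : Option (α × ℕ)).bind fun y =>
    if (f y = true ∧ ∀ t < y.2, f (y.1, t) = false) ∧ Encodable.encode y = i then some y.1 else none) := by fun_prop
  refine ⟨_, hp, ?_, ?_⟩
  · intro i j x hi hj
    rw [Option.bind_eq_some_iff] at hi hj
    obtain ⟨⟨a, s⟩, h1, h2⟩ := hi
    obtain ⟨⟨b, t⟩, h3, h4⟩ := hj
    split_ifs at h2 h4 with h5 h6
    cases h2; cases h4
    have : s = t := by
      rcases lt_trichotomy s t with h | h | h
      · have := h6.1.2 s h; simp_all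
      · exact h
      · have := h5.1.2 t h; simp_all
    subst this
    rw [← h5.2, ← h6.2]
  · intro x
    rw [hfs]
    constructor
    · intro hx
      classical
      refine ⟨Encodable.encode (x, Nat.find hx), ?_⟩
      rw [Encodable.encodek, Option.bind_some, if_pos]
      refine ⟨⟨Nat.find_spec hx, fun t ht => ?_⟩, rfl⟩
      simpa using Nat.find_min hx ht
    · rintro ⟨i, hi⟩
      rw [Option.bind_eq_some_iff] at hi
      obtain ⟨⟨a, s⟩, h1, h2⟩ := hi
      split_ifs at h2 with h5
      cases h2
      exact ⟨s, h5.1.1⟩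

theorem exists_valS (n v : ℕ) (h : v < 2 ^ n) : ∃ σ : List Bool, σ.length = n ∧ valS σ = v := by
  induction n generalizing v with
  | zero => exact ⟨[], rfl, by simp at h; simp [valS, h]⟩
  | succ n ih =>
    obtain ⟨σ, h1, h2⟩ := ih (v / 2) (by rw [pow_succ] at h; omega)
    rcases Nat.mod_two_eq_zero_or_one v with h3 | h3
    · exact ⟨σ ++ [false], by simp [h1], by rw [valS_concat, h2]; simp [natOfBool]; omega⟩
    · exact ⟨σ ++ [true], by simp [h1], by rw [valS_concat, h2]; simp [natOfBool]; omega⟩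

theorem valS_inj {σ τ : List Bool} (h : σ.length = τ.length) (hv : valS σ = valS τ) : σ = τ := by
  induction σ using List.reverseRecOn generalizing τ with
  | nil => simp at h; exact (List.length_eq_zero_iff.1 h.symm).symm
  | append_singleton σ b ih =>
    obtain ⟨τ', b', rfl⟩ : ∃ τ' b', τ = τ' ++ [b'] :=
      ⟨τ.dropLast, τ.getLast (by rintro rfl; simp at h), (List.dropLast_append_getLast _).symm⟩
    rw [valS_concat, valS_concat] at hv
    have hb : b = b' ∧ valS σ = valS τ' := by
      cases b <;> cases b' <;> simp [natOfBool] at hv ⊢ <;> omega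
    rw [hb.1, ih (by simpa using h) hb.2]

theorem valS_prefix {σ τ : List Bool} (h : σ <+: τ) :
    (valS σ : ℝ) / 2 ^ σ.length ≤ valS τ / 2 ^ τ.length ∧
      (valS τ : ℝ) / 2 ^ τ.length < (valS σ + 1) / 2 ^ σ.length := by
  obtain ⟨ρ, rfl⟩ := h
  have key : ((valS σ : ℝ) / 2 ^ σ.length ≤ valS (σ ++ ρ) / 2 ^ (σ ++ ρ).length) ∧
      (valS (σ ++ ρ) + 1 : ℝ) / 2 ^ (σ ++ ρ).length ≤ (valS σ + 1) / 2 ^ σ.length := by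
    induction ρ using List.reverseRecOn with
    | nil => simp
    | append_singleton ρ b ih =>
      rw [← List.append_assoc, valS_concat, List.length_append (as := σ ++ ρ)]
      have h2 : (0 : ℝ) < 2 ^ (σ ++ ρ).length := by positivity
      refine ⟨ih.1.trans ?_, le_trans ?_ ih.2⟩
      · rw [div_le_div_iff₀ (by positivity) (by positivity), pow_add]; push_cast
        generalize (2:ℝ) ^ (σ ++ ρ).length = z at h2
        cases b <;> simp [natOfBool] <;> nlinarith
      · rw [div_le_div_iff₀ (by positivity) (by positivity), pow_add]; push_cast
        generalize (2:ℝ) ^ (σ ++ ρ).length = z at h2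
        cases b <;> simp [natOfBool] <;> nlinarith
  refine ⟨key.1, lt_of_lt_of_le ?_ key.2⟩
  gcongr; linarith

@[fun_prop] theorem pr_valS {α : Type} [Primcodable α] {f : α → List Bool} (hf : Primrec f) :
    Primrec (fun a => valS (f a)) := by
  have hb : Primrec (fun b : Bool => natOfBool b) := Primrec.dom_finite _
  have : Primrec (fun x : (α × ℕ) × Bool => natOfBool x.2) := hb.comp Primrec.snd
  unfold valS; fun_prop

/-- an RE single valued graph, given by a primrec enumeration, is the graph of some machine -/
theorem exists_machine {g : List Bool × ℕ → Option ℕ} (hg : Primrec g)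
    (huniq : ∀ σ i j x y, g (σ, i) = some x → g (σ, j) = some y → x = y) :
    ∃ e, ∀ σ x, x ∈ (Denumerable.ofNat Nat.Partrec.Code e).eval (Encodable.encode σ) ↔
      ∃ i, g (σ, i) = some x := by
  have h1 : Primrec (fun x : ℕ × ℕ => (Encodable.decode x.1 : Option (List Bool)).bind fun σ =>
    g (σ, x.2)) := by fun_prop
  have h2 : Partrec (fun n : ℕ => Nat.rfindOpt (fun i =>
    (Encodable.decode n : Option (List Bool)).bind fun σ => g (σ, i))) :=
    Partrec.rfindOpt (f := fun n i => (Encodable.decode n : Option (List Bool)).bind fun σ => g (σ, i))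
      h1.to_comp
  obtain ⟨c, hc⟩ := Nat.Partrec.Code.exists_code.1 (Partrec.nat_iff.1 h2)
  refine ⟨Encodable.encode c, fun σ x => ?_⟩
  rw [Denumerable.ofNat_encode, hc]
  simp only [Encodable.encodek, Option.bind_some]
  constructor
  · intro h; simpa using Nat.rfindOpt_spec h
  · rintro ⟨i, hi⟩
    have hd := Nat.rfindOpt_dom (f := fun i => g (σ, i)).2 ⟨i, x, hi⟩
    obtain ⟨y, hy⟩ := Part.dom_iff_mem.1 hd
    obtain ⟨j, hj⟩ := Nat.rfindOpt_spec hy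
    rwa [huniq _ _ _ _ _ hi hj]

theorem kraft_aux {L : ℕ × ℕ → Prop} (hL : REPred L) (hw : wtf Prod.fst {x | L x} < ⊤) :
    ∃ d, ∀ r x, L (r, x) → ∃ e, ∃ σ : List Bool, PrefixFreeMachine e ∧
      x ∈ (Denumerable.ofNat Nat.Partrec.Code e).eval (Encodable.encode σ) ∧
      σ.length + 2 * e + 2 ≤ r + d := by
  classical
  obtain ⟨M, hM⟩ := exists_pow_ge hw
  obtain ⟨en, hen, hinj, hsurj⟩ := re_enum hL
  -- running sums
  let stp : ℕ × ℕ → ℕ → ℕ × ℕ := fun acc j =>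
    ((en j).map (fun y => (acc.1 * 2 ^ (y.1 + M) + 2 ^ acc.2, acc.2 + (y.1 + M)))).getD acc
  let st : ℕ → ℕ × ℕ := fun i => (List.range i).foldl stp (0, 0)
  have hst : Primrec st := by unfold st stp; fun_prop
  let S : ℕ → ℝ := fun i => (st i).1 / 2 ^ (st i).2
  have hSs : ∀ i y, en i = some y → S (i + 1) = S i + 1 / 2 ^ (y.1 + M) := by
    intro i y hy
    have : st (i + 1) = stp (st i) i := by simp [st, List.range_succ]
    simp only [S, this, stp, hy, Option.map_some, Option.getD_some]
    push_cast
    field_simp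
    ring
  have hSn : ∀ i, en i = none → S (i + 1) = S i := by
    intro i hy
    have : st (i + 1) = stp (st i) i := by simp [st, List.range_succ]
    simp only [S, this, stp, hy, Option.map_none, Option.getD_none]
  have hS0 : S 0 = 0 := by simp [S, st]
  have hSmono : Monotone S := by
    apply monotone_nat_of_le_succ
    intro i
    cases h : en i with
    | none => rw [hSn i h]
    | some y => rw [hSs i y h]; have : (0:ℝ) ≤ 1 / 2 ^ (y.1 + M) := by positivity
                linarith
  have hSle : ∀ i, S i ≤ 1 := by
    intro i
    let T : Set ℕ := {j | (en j).isSome = true}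
    let q : ℕ → ℕ := fun j => ((en j).getD (0, 0)).1
    have h1 : wtf q T ≤ 2 ^ M := by
      refine le_trans (wtf_inj_le q Prod.fst (fun j => (en j).getD (0, 0)) T {x | L x} ?_ ?_ ?_) hM
      · intro a ha b hb hab
        obtain ⟨x, hx⟩ := Option.isSome_iff_exists.1 ha
        obtain ⟨y, hy⟩ := Option.isSome_iff_exists.1 hb
        simp only [hx, hy, Option.getD_some] at hab
        exact hinj a b x hx (hab ▸ hy)
      · intro a ha
        obtain ⟨x, hx⟩ := Option.isSome_iff_exists.1 ha
        simp only [hx, Option.getD_some]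
        exact (hsurj x).2 ⟨a, hx⟩
      · intro a _; exact le_rfl
    have h2 : ENNReal.ofReal (S i) * 2 ^ M = ∑ j ∈ (Finset.range i).filter (· ∈ T), 2⁻¹ ^ q j := by
      induction i with
      | zero => simp [hS0]
      | succ i ih =>
        rw [Finset.range_add_one, Finset.filter_insert]
        rcases Option.eq_none_or_eq_some (en i) with h | ⟨y, h⟩
        ·
          rw [hSn i h, ih, if_neg (by simp [T, h])]
        ·
          rw [hSs i y h, if_pos (by simp [T, h]), Finset.sum_insert (by simp), ← ih,
            ENNReal.ofReal_add (by simp only [S]; positivity) (by positivity), add_mul, add_comm]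
          congr 1
          have : q i = y.1 := by simp [q, h]
          rw [this, one_div, ENNReal.ofReal_inv_of_pos (by positivity), ENNReal.ofReal_pow (by norm_num),
            pow_add, ENNReal.mul_inv (by simp) (by simp), mul_assoc]
          rw [show ENNReal.ofReal 2 = 2 by simp, ENNReal.inv_mul_cancel (by simp) (by simp)]
          simp [ENNReal.inv_pow]
    have h3 : ENNReal.ofReal (S i) * 2 ^ M ≤ 1 * 2 ^ M := by
      rw [h2, one_mul, ← wtf_finset]
      exact (wtf_mono q (by intro j hj; simpa using (Finset.mem_filter.1 hj).2)).trans h1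
    rw [ENNReal.mul_le_mul_iff_left (by simp) (by simp)] at h3
    simpa using h3
  -- the allocated value
  let v : ℕ → ℕ → ℕ := fun i r => ((st i).1 * 2 ^ (r + 1) + 2 ^ (st i).2 - 1) / 2 ^ (st i).2
  have hv : ∀ i r, S i * 2 ^ (r + 1) ≤ v i r ∧ (v i r : ℝ) < S i * 2 ^ (r + 1) + 1 := by
    intro i r
    have hq : (0:ℝ) < 2 ^ (st i).2 := by positivity
    have hq' : 0 < 2 ^ (st i).2 := by positivity
    have e : S i * 2 ^ (r + 1) = ((st i).1 * 2 ^ (r + 1)) / 2 ^ (st i).2 := by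
      simp only [S]; ring
    rw [e]
    have := Nat.div_add_mod ((st i).1 * 2 ^ (r + 1) + 2 ^ (st i).2 - 1) (2 ^ (st i).2)
    have hm := Nat.mod_lt ((st i).1 * 2 ^ (r + 1) + 2 ^ (st i).2 - 1) hq'
    change 2 ^ (st i).2 * v i r + _ = _ at this
    constructor
    · rw [div_le_iff₀ hq]
      have : (st i).1 * 2 ^ (r + 1) ≤ v i r * 2 ^ (st i).2 := by rw [mul_comm (v i r)]; omega
      exact_mod_cast this
    · have h3 : v i r * 2 ^ (st i).2 < (st i).1 * 2 ^ (r + 1) + 2 ^ (st i).2 := by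
        rw [mul_comm (v i r)]; omega
      have h4 : (v i r : ℝ) * 2 ^ (st i).2 < (st i).1 * 2 ^ (r + 1) + 2 ^ (st i).2 := by
        exact_mod_cast h3
      rw [← sub_lt_iff_lt_add, lt_div_iff₀ hq]
      linarith
  let g : List Bool × ℕ → Option ℕ := fun x => (en x.2).bind fun y =>
    if x.1.length = y.1 + M + 1 ∧ valS x.1 = v x.2 (y.1 + M) then some y.2 else none
  have hg : Primrec g := by unfold g v; fun_prop
  have hgs : ∀ σ i x, g (σ, i) = some x ↔ ∃ r, en i = some (r, x) ∧ σ.length = r + M + 1 ∧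
      valS σ = v i (r + M) := by
    intro σ i x
    simp only [g, Option.bind_eq_some_iff]
    constructor
    · rintro ⟨⟨r, y⟩, h1, h2⟩
      split_ifs at h2 with h3
      cases h2
      exact ⟨r, h1, h3⟩
    · rintro ⟨r, h1, h2⟩
      exact ⟨(r, x), h1, by rw [if_pos h2]⟩
  have hintv : ∀ σ i x, g (σ, i) = some x → S i ≤ valS σ / 2 ^ σ.length ∧
      ((valS σ : ℝ) + 1) / 2 ^ σ.length ≤ S (i + 1) := by
    intro σ i x h
    obtain ⟨r, h1, h2, h3⟩ := (hgs _ _ _).1 h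
    have hs := hSs i _ h1
    obtain ⟨h4, h5⟩ := hv i (r + M)
    rw [h2, h3, hs]
    constructor
    · rw [le_div_iff₀ (by positivity)]; exact h4
    · rw [div_le_iff₀ (by positivity), add_mul]
      have : (1:ℝ) / 2 ^ (r + M) * 2 ^ (r + M + 1) = 2 := by field_simp; ring
      rw [this]; linarith
  have hpre : ∀ σ τ i j x y, σ <+: τ → g (σ, i) = some x → g (τ, j) = some y → i = j := by
    intro σ τ i j x y hp h1 h2
    obtain ⟨a1, a2⟩ := hintv _ _ _ h1
    obtain ⟨b1, b2⟩ := hintv _ _ _ h2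
    obtain ⟨c1, c2⟩ := valS_prefix hp
    have b3 : (valS τ : ℝ) / 2 ^ τ.length < (valS τ + 1) / 2 ^ τ.length := by gcongr; linarith
    by_contra hne
    rcases lt_or_gt_of_ne hne with h | h
    · have := hSmono (show i + 1 ≤ j from h); linarith
    · have := hSmono (show j + 1 ≤ i from h); linarith
  obtain ⟨e, he⟩ := exists_machine hg (by
    intro σ i j x y h1 h2
    have := hpre σ σ i j x y (List.prefix_refl σ) h1 h2
    subst this
    rw [h1] at h2; exact Option.some.inj h2)
  have hpf : PrefixFreeMachine e := by
    intro σ hσ τ hτ hp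
    obtain ⟨x, hx⟩ := Part.dom_iff_mem.1 hσ
    obtain ⟨y, hy⟩ := Part.dom_iff_mem.1 hτ
    obtain ⟨i, hi⟩ := (he _ _).1 hx
    obtain ⟨j, hj⟩ := (he _ _).1 hy
    have := hpre _ _ _ _ _ _ hp hi hj
    subst this
    obtain ⟨r, h1, h2, h3⟩ := (hgs _ _ _).1 hi
    obtain ⟨r', h1', h2', h3'⟩ := (hgs _ _ _).1 hj
    rw [h1] at h1'
    cases h1'
    exact hp.eq_of_length (h2.trans h2'.symm)
  refine ⟨M + 2 * e + 3, fun r x hx => ?_⟩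
  obtain ⟨i, hi⟩ := (hsurj _).1 hx
  obtain ⟨σ, h1, h2⟩ := exists_valS (r + M + 1) (v i (r + M)) (by
    have h5 := (hv i (r + M)).2
    have hs := hSs i _ hi
    have h6 := hSle (i + 1)
    have h7 : S i ≤ 1 - 1 / 2 ^ (r + M) := by simp only at hs; linarith
    have h8 : S i * 2 ^ (r + M + 1) ≤ 2 ^ (r + M + 1) - 2 := by
      calc S i * 2 ^ (r + M + 1) ≤ (1 - 1 / 2 ^ (r + M)) * 2 ^ (r + M + 1) := by gcongr
        _ = _ := by field_simp; ring
    have : (v i (r + M) : ℝ) < 2 ^ (r + M + 1) := by linarith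
    exact_mod_cast this)
  refine ⟨e, σ, hpf, (he _ _).2 ⟨i, (hgs _ _ _).2 ⟨r, hi, h1, h2⟩⟩, by omega⟩

theorem kraft {L : ℕ × ℕ → Prop} (hL : REPred L) (hw : wtf Prod.fst {x | L x} < ⊤) :
    ∃ d, ∀ r x, L (r, x) → Kcpx x ≤ r + d := by
  obtain ⟨d, hd⟩ := kraft_aux hL hw
  refine ⟨d, fun r x h => ?_⟩
  obtain ⟨e, σ, h1, h2, h3⟩ := hd r x h
  refine le_trans (Nat.sInf_le ?_) h3
  exact ⟨e, σ, h1, h2, rfl⟩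

theorem wtf_id_diag : wtf Prod.fst {x : ℕ × ℕ | x.1 = x.2} < ⊤ := by
  refine lt_of_le_of_lt (wtf_inj_le Prod.fst id Prod.fst _ Set.univ ?_ (fun _ _ => trivial)
    (fun _ _ => le_rfl)) ?_
  · rintro ⟨a, b⟩ h ⟨c, d⟩ h' e
    simp at *; omega
  · have : wtf (id : ℕ → ℕ) Set.univ = 2 := by
      rw [wtf]; exact (tsum_univ (fun n : ℕ => (2⁻¹ : ℝ≥0∞) ^ n)).trans tsum_geom
    rw [this]; simp

theorem Kcpx_mem (x : ℕ) : ∃ e, ∃ σ : List Bool, PrefixFreeMachine e ∧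
    x ∈ (Denumerable.ofNat Nat.Partrec.Code e).eval (Encodable.encode σ) ∧
    Kcpx x = σ.length + 2 * e + 2 := by
  have hL : REPred (fun x : ℕ × ℕ => x.1 = x.2) := by fun_prop
  obtain ⟨d, hd⟩ := kraft_aux hL wtf_id_diag
  obtain ⟨e, σ, h1, h2, -⟩ := hd x x rfl
  exact Nat.sInf_mem (s := {k | ∃ e, ∃ σ : List Bool, PrefixFreeMachine e ∧
    x ∈ (Denumerable.ofNat Nat.Partrec.Code e).eval (Encodable.encode σ) ∧
    k = σ.length + 2 * e + 2}) ⟨_, e, σ, h1, h2, rfl⟩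

/-- stage-wise enumeration of all prefix-free descriptions -/
def Rst (x : (ℕ × ℕ) × ℕ × List Bool × ℕ) : Prop :=
  x.1.1 = x.2.2.1.length + 2 * x.2.1 + 2 ∧
  Nat.Partrec.Code.evaln x.2.2.2 (Denumerable.ofNat Nat.Partrec.Code x.2.1)
    (Encodable.encode x.2.2.1) = some x.1.2 ∧
  ∀ a < x.2.2.2, ∀ b < x.2.2.2,
    (Nat.Partrec.Code.evaln x.2.2.2 (Denumerable.ofNat Nat.Partrec.Code x.2.1)
      (Encodable.encode ((Encodable.decode a : Option (List Bool)).getD []))).isSome = false ∨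
    (Nat.Partrec.Code.evaln x.2.2.2 (Denumerable.ofNat Nat.Partrec.Code x.2.1)
      (Encodable.encode ((Encodable.decode b : Option (List Bool)).getD []))).isSome = false ∨
    ¬ (Encodable.decode a : Option (List Bool)).getD [] <+:
        (Encodable.decode b : Option (List Bool)).getD [] ∨
    (Encodable.decode a : Option (List Bool)).getD [] =
        (Encodable.decode b : Option (List Bool)).getD []

@[fun_prop] theorem pr_evaln {α : Type} [Primcodable α] {k e n : α → ℕ} (hk : Primrec k)
    (he : Primrec e) (hn : Primrec n) :
    Primrec (fun a => Nat.Partrec.Code.evaln (k a) (Denumerable.ofNat Nat.Partrec.Code (e a)) (n a)) :=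
  Nat.Partrec.Code.primrec_evaln.comp ((hk.pair ((Primrec.ofNat _).comp he)).pair hn)

/-- the set of all pairs `(length of description, described number)` -/
def Rset (x : ℕ × ℕ) : Prop := ∃ y : ℕ × List Bool × ℕ, Rst (x, y)

theorem re_Rset : REPred Rset := by
  unfold Rset Rst; fun_prop

theorem Rset_K (x : ℕ) : Rset (Kcpx x, x) := by
  obtain ⟨e, σ, h1, h2, h3⟩ := Kcpx_mem x
  obtain ⟨k, hk⟩ := Nat.Partrec.Code.evaln_complete.1 h2
  refine ⟨(e, σ, k), h3, hk, fun a _ b _ => ?_⟩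
  by_contra hc
  push Not at hc
  obtain ⟨ha, hb, hp, hne⟩ := hc
  simp only [ne_eq, Bool.not_eq_false, Option.isSome_iff_exists] at ha hb
  obtain ⟨y, hy⟩ := ha
  obtain ⟨z, hz⟩ := hb
  exact hne (h1 _ (Part.dom_iff_mem.2 ⟨y, Nat.Partrec.Code.evaln_sound hy⟩) _
    (Part.dom_iff_mem.2 ⟨z, Nat.Partrec.Code.evaln_sound hz⟩) hp)

theorem Rset_wt : wtf Prod.fst {x | Rset x} < ⊤ := by
  classical
  let D : ℕ → Set (List Bool) := fun e => {σ | ∃ s x, Rst (x, e, σ, s)}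
  have hD : ∀ e, PrefixFreeSet (D e) := by
    have key : ∀ e σ τ s t x y, Rst (x, e, σ, s) → Rst (y, e, τ, t) → s ≤ t →
        (σ <+: τ ∨ τ <+: σ) → σ = τ := by
      intro e σ τ s t x y h1 h2 hst hp
      obtain ⟨-, a2, -⟩ := h1
      obtain ⟨-, b2, b3⟩ := h2
      simp only at a2 b2 b3
      have a2' := Nat.Partrec.Code.evaln_mono hst a2
      have ha := Nat.Partrec.Code.evaln_bound a2'
      have hb := Nat.Partrec.Code.evaln_bound b2
      have h1 := b3 _ ha _ hb
      have h2 := b3 _ hb _ ha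
      have a3 : Nat.Partrec.Code.evaln t (Denumerable.ofNat Nat.Partrec.Code e)
        (Encodable.encode σ) = some x.2 := a2'
      simp [a3, b2] at h1 h2
      rcases hp with hp | hp
      · tauto
      · exact (h2.resolve_left (fun h => h hp)).symm
    rintro e σ ⟨s, x, h1⟩ τ ⟨t, y, h2⟩ hp
    rcases le_total s t with h | h
    · exact key e σ τ s t x y h1 h2 h (Or.inl hp)
    · exact (key e τ σ t s y x h2 h1 h (Or.inr hp)).symm
  let f : ℕ → List Bool → ℕ × ℕ := fun e σ => (σ.length + 2 * e + 2,
    if h : ∃ y, y ∈ (Denumerable.ofNat Nat.Partrec.Code e).eval (Encodable.encode σ) then h.choose else 0)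
  have hsub : {x | Rset x} ⊆ ⋃ e, f e '' D e := by
    rintro ⟨q, x⟩ ⟨⟨e, σ, s⟩, h⟩
    refine Set.mem_iUnion.2 ⟨e, σ, ⟨s, _, h⟩, ?_⟩
    have hx := Nat.Partrec.Code.evaln_sound (show x ∈ _ from h.2.1)
    simp only at hx
    have hex : ∃ y, y ∈ (Denumerable.ofNat Nat.Partrec.Code e).eval (Encodable.encode σ) := ⟨x, hx⟩
    simp only [f, dif_pos hex]
    have := Part.mem_unique hex.choose_spec hx
    rw [this]
    have := h.1
    simp only at this
    rw [this]
  refine lt_of_le_of_lt ((wtf_mono _ hsub).trans (wtf_iUnion _ _)) ?_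
  have hb : ∀ e, wtf Prod.fst (f e '' D e) ≤ 2⁻¹ ^ e := by
    intro e
    refine (wtf_image_le (fun σ => σ.length + (2 * e + 2)) Prod.fst (f e) (D e)
      (fun σ _ => by simp [f]; omega)).trans ?_
    rw [wtf_shift]
    have h1 : wtf List.length (D e) ≤ 1 := by
      have := weight_le_of_above (hD e) (τ := []) (by simp)
      simpa [weight_eq] using this
    calc wtf List.length (D e) * 2⁻¹ ^ (2 * e + 2) ≤ 1 * 2⁻¹ ^ (2 * e + 2) := by gcongr
      _ ≤ 2⁻¹ ^ e := by
        rw [one_mul]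
        exact pow_le_pow_right_of_le_one' (by simp) (by omega)
  refine lt_of_le_of_lt (ENNReal.tsum_le_tsum hb) ?_
  rw [tsum_geom]; simp

/-- a stage function for bounding complexity from above -/
theorem exists_Ok : ∃ (Ok : (ℕ × ℕ) × ℕ → Bool) (d : ℕ), Primrec Ok ∧
    (∀ q x s t, s ≤ t → Ok ((q, x), s) = true → Ok ((q, x), t) = true) ∧
    (∀ q q' x s, q ≤ q' → Ok ((q, x), s) = true → Ok ((q', x), s) = true) ∧
    (∀ q x, Kcpx x ≤ q → ∃ s, Ok ((q, x), s) = true) ∧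
    (∀ q x s, Ok ((q, x), s) = true → Kcpx x ≤ q + d) ∧
    (∀ q x, (∃ s, Ok ((q, x), s) = true) ↔ ∃ r ≤ q, Rset (r, x)) := by
  obtain ⟨f, hf, hfm, hfs⟩ := re_stage re_Rset
  obtain ⟨d, hd⟩ := kraft re_Rset Rset_wt
  have hOk : Primrec (fun x : (ℕ × ℕ) × ℕ => decide (∃ r ≤ x.1.1, f ((r, x.1.2), x.2) = true)) := by
    fun_prop
  have hiff : ∀ q x, (∃ s, decide (∃ r ≤ q, f ((r, x), s) = true) = true) ↔ ∃ r ≤ q, Rset (r, x) := by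
    intro q x
    simp only [decide_eq_true_eq]
    constructor
    · rintro ⟨s, r, h1, h2⟩; exact ⟨r, h1, (hfs _).2 ⟨s, h2⟩⟩
    · rintro ⟨r, h1, h2⟩
      obtain ⟨s, hs⟩ := (hfs _).1 h2
      exact ⟨s, r, h1, hs⟩
  refine ⟨_, d, hOk, ?_, ?_, ?_, ?_, hiff⟩
  · intro q x s t hst
    simp only [decide_eq_true_eq]
    rintro ⟨r, h1, h2⟩
    exact ⟨r, h1, hfm _ _ _ hst h2⟩
  · intro q q' x s hq
    simp only [decide_eq_true_eq]
    rintro ⟨r, h1, h2⟩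
    exact ⟨r, h1.trans hq, h2⟩
  · intro q x h
    exact (hiff q x).2 ⟨_, h, Rset_K x⟩
  · intro q x s h
    obtain ⟨r, h1, h2⟩ := (hiff q x).1 ⟨s, h⟩
    have := hd r x h2
    omega

/-! ### K-trivial sets: limit approximation -/

theorem wtf_disj {α ι : Type} (r : α → ℕ) (S : ι → Set α) (T : Set α) (hT : ∀ i, S i ⊆ T)
    (hd : ∀ i j x, x ∈ S i → x ∈ S j → i = j) : ∑' i, wtf r (S i) ≤ wtf r T := by
  unfold wtf
  rw [← ENNReal.tsum_sigma' (fun x : (Σ i, S i) => (2⁻¹ : ℝ≥0∞) ^ r x.2.1)]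
  refine ENNReal.tsum_comp_le_tsum_of_injective
    (f := fun x : (Σ i, S i) => (⟨x.2.1, hT _ x.2.2⟩ : T)) ?_ (fun x : T => (2⁻¹ : ℝ≥0∞) ^ r x)
  rintro ⟨i, x, hx⟩ ⟨j, y, hy⟩ h
  simp only [Subtype.mk.injEq] at h
  subst h
  have := hd i j x hx hy
  subst this
  rfl

theorem wtf_nat_univ : wtf (id : ℕ → ℕ) Set.univ = 2 :=
  (tsum_univ (fun n : ℕ => (2⁻¹ : ℝ≥0∞) ^ n)).trans tsum_geom

theorem wtf_le_two_mul (w : ℝ≥0∞) : wtf (id : ℕ → ℕ) {r | 2⁻¹ ^ r ≤ w} ≤ 2 * w := by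
  classical
  by_cases h : ∃ r : ℕ, (2⁻¹ : ℝ≥0∞) ^ r ≤ w
  · have h1 := Nat.find_spec h
    set r0 := Nat.find h
    have hmin : ∀ r : ℕ, (2⁻¹ : ℝ≥0∞) ^ r ≤ w → r0 ≤ r := fun r hr => Nat.find_min' h hr
    have h2 := wtf_inj_le id (fun n => id n + r0) (fun n => n - r0) {r : ℕ | (2⁻¹ : ℝ≥0∞) ^ r ≤ w} Set.univ
      (by
        intro a ha b hb hab
        have := hmin a ha; have := hmin b hb; simp only at hab; omega) (fun _ _ => trivial)
      (by intro a ha; have := hmin a ha; simp only [id]; omega)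
    rw [wtf_shift, wtf_nat_univ] at h2
    refine h2.trans ?_
    gcongr
  · have : {r : ℕ | (2⁻¹ : ℝ≥0∞) ^ r ≤ w} = ∅ := by
      ext r; simp only [Set.mem_ofPred_eq, Set.mem_empty_iff_false, iff_false]; exact fun hr => h ⟨r, hr⟩
    rw [this]; simp [wtf]

/-- `x` has a description of length at most `q` -/
def Okp (q x : ℕ) : Prop := ∃ r ≤ q, Rset (r, x)

theorem Okp_mono {q q' x : ℕ} (h : q ≤ q') (hq : Okp q x) : Okp q' x := by
  obtain ⟨r, h1, h2⟩ := hq; exact ⟨r, h1.trans h, h2⟩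

theorem Okp_K {q x : ℕ} (h : Kcpx x ≤ q) : Okp q x := ⟨_, h, Rset_K x⟩

/-- code of `1^n` -/
def one (n : ℕ) : ℕ := Encodable.encode (List.replicate n true)

theorem one_inj {m n : ℕ} (h : one m = one n) : m = n := by
  have := Encodable.encode_injective h
  simpa using congrArg List.length this

@[fun_prop] theorem pr_one {α : Type} [Primcodable α] {f : α → ℕ} (hf : Primrec f) :
    Primrec (fun a => one (f a)) := by unfold one; fun_prop

@[fun_prop] theorem re_Okp {α : Type} [Primcodable α] {f g : α → ℕ} (hf : Primrec f) (hg : Primrec g) :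
    REPred (fun a => Okp (f a) (g a)) := by
  have : REPred (fun x : α × ℕ => Rset (x.2, g x.1)) := re_comp re_Rset (by fun_prop)
  unfold Okp; fun_prop

/-- descriptions of strings of length `n` -/
def RL (n : ℕ) : Set (ℕ × ℕ) := {x | Rset x ∧ ∃ σ : List Bool, σ.length = n ∧ x.2 = Encodable.encode σ}

theorem card_RL {n q : ℕ} {F : Finset (List Bool)} (hF : ∀ σ ∈ F, σ.length = n ∧ Okp q (Encodable.encode σ)) :
    (F.card : ℝ≥0∞) * 2⁻¹ ^ q ≤ wtf Prod.fst (RL n) := by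
  classical
  have h : ∀ σ ∈ F, ∃ r, r ≤ q ∧ Rset (r, Encodable.encode σ) := fun σ hσ => by
    obtain ⟨r, h1, h2⟩ := (hF σ hσ).2; exact ⟨r, h1, h2⟩
  choose! g hg using h
  have := wtf_inj_le (fun _ : List Bool => q) Prod.fst (fun σ => (g σ, Encodable.encode σ)) (F : Set (List Bool))
    (RL n) (by
      intro a _ b _ hab
      simp only [Prod.mk.injEq] at hab
      exact Encodable.encode_injective hab.2)
    (fun σ hσ => ⟨(hg σ hσ).2, σ, (hF σ hσ).1, rfl⟩) (fun σ hσ => (hg σ hσ).1)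
  rw [wtf_finset] at this
  simpa using this

theorem sum_RL : ∑' n, wtf Prod.fst (RL n) ≤ wtf Prod.fst {x | Rset x} := by
  refine wtf_disj _ _ _ (fun n x hx => hx.1) ?_
  rintro i j x ⟨-, σ, h1, h2⟩ ⟨-, τ, h3, h4⟩
  rw [h2] at h4
  have := Encodable.encode_injective h4
  rw [← h1, ← h3, this]

theorem level_bound (b : ℕ) : ∃ N, ∀ n q, (∀ q' < q, ¬ Okp q' (one n)) → ∀ F : Finset (List Bool),
    (∀ σ ∈ F, σ.length = n ∧ Okp (q + b) (Encodable.encode σ)) → F.card ≤ N := by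
  classical
  let L : ℕ × ℕ → Prop := fun x => ∃ n q : ℕ, x.2 = one n ∧ ∃ F : List (List Bool), (2 ^ q ≤ F.length * 2 ^ x.1) ∧
    (∀ i < F.length, ∀ j < F.length, i = j ∨ F.getD i [] ≠ F.getD j []) ∧
    (∀ σ ∈ F, σ.length = n ∧ Okp q (Encodable.encode σ))
  have hL : REPred L := by unfold L; fun_prop
  have hLw : ∀ r n, L (r, one n) → (2⁻¹ : ℝ≥0∞) ^ r ≤ wtf Prod.fst (RL n) := by
    rintro r n ⟨n', q, h1, F, h2, h3, h4⟩
    have := one_inj h1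
    subst this
    have hnd : F.Nodup := by
      rw [List.nodup_iff_getElem?_ne_getElem?]
      intro i j hij hj
      have := (h3 i (hij.trans hj) j hj).resolve_left (by omega)
      rw [List.getD_eq_getElem _ _ (hij.trans hj), List.getD_eq_getElem _ _ hj] at this
      rw [List.getElem?_eq_getElem (hij.trans hj), List.getElem?_eq_getElem hj]
      simpa using this
    have := card_RL (n := n) (q := q) (F := F.toFinset) (fun σ hσ => h4 σ (by simpa using hσ))
    refine le_trans ?_ this
    rw [List.toFinset_card_of_nodup hnd]
    have h5 : (2 : ℝ≥0∞) ^ q ≤ F.length * 2 ^ r := by exact_mod_cast h2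
    rw [← ENNReal.inv_pow, ← ENNReal.inv_pow, ← div_eq_mul_inv, ENNReal.inv_le_iff_le_mul (by simp) (by simp),
      ← mul_div_assoc, ENNReal.le_div_iff_mul_le (by simp) (by simp), one_mul, mul_comm]
    exact h5
  have hLb : wtf Prod.fst {x | L x} < ⊤ := by
    have hsub : {x | L x} ⊆ ⋃ n, (fun r => (r, one n)) '' {r : ℕ | 2⁻¹ ^ r ≤ wtf Prod.fst (RL n)} := by
      rintro ⟨r, x⟩ h
      obtain ⟨n, q, h1, -⟩ := id h
      simp only at h1
      subst h1
      exact Set.mem_iUnion.2 ⟨n, r, hLw r n h, rfl⟩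
    refine lt_of_le_of_lt ((wtf_mono _ hsub).trans (wtf_iUnion _ _)) ?_
    refine lt_of_le_of_lt (ENNReal.tsum_le_tsum (g := fun n => 2 * wtf Prod.fst (RL n)) fun n => ?_) ?_
    · exact (wtf_image_le id Prod.fst _ _ (fun _ _ => rfl)).trans (wtf_le_two_mul _)
    · rw [ENNReal.tsum_mul_left]
      exact ENNReal.mul_lt_top (by simp) (lt_of_le_of_lt sum_RL Rset_wt)
  obtain ⟨d, hd⟩ := kraft hL hLb
  obtain ⟨M, hM⟩ := exists_pow_ge Rset_wt
  refine ⟨2 ^ (b + d + 1 + M), fun n q hq F hF => ?_⟩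
  by_contra hc
  push Not at hc
  have hW : (F.card : ℝ≥0∞) * 2⁻¹ ^ (q + b) ≤ 2 ^ M :=
    (card_RL hF).trans ((ENNReal.le_tsum n).trans (sum_RL.trans hM))
  have hW2 : F.card ≤ 2 ^ (q + b + M) := by
    rw [← ENNReal.inv_pow, ← div_eq_mul_inv, ENNReal.div_le_iff (by simp) (by simp), ← pow_add] at hW
    rw [show q + b + M = M + (q + b) by omega]
    exact_mod_cast hW
  have h1 : b + d + 1 + M < q + b + M := (Nat.pow_lt_pow_iff_right (a := 2) (by norm_num)).1 (hc.trans_le hW2)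
  have hmem : L (q + b - (b + d + 1), one n) := by
    refine ⟨n, q + b, rfl, F.toList, ?_, ?_, ?_⟩
    · rw [Finset.length_toList]
      calc 2 ^ (q + b) = 2 ^ (b + d + 1) * 2 ^ (q + b - (b + d + 1)) := by rw [← pow_add]; congr 1; omega
        _ ≤ _ := by
          apply Nat.mul_le_mul_right
          refine le_trans ?_ hc.le
          exact Nat.pow_le_pow_right (by norm_num) (by omega)
    · intro i hi j hj
      by_cases hij : i = j
      · exact Or.inl hij
      · right
        rw [List.getD_eq_getElem _ _ hi, List.getD_eq_getElem _ _ hj]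
        intro h
        exact hij ((F.nodup_toList.getElem_inj_iff).1 h)
    · intro σ hσ; exact hF σ (by simpa using hσ)
  have h2 := hd _ _ hmem
  exact hq _ (by omega) (Okp_K h2)

/-- K-triviality in terms of descriptions -/
theorem kt_Okp {A : ℕ → Bool} (hA : KTrivial A) :
    ∃ b, ∀ n q, Okp q (one n) → Okp (q + b) (Encodable.encode (strPrefix A n)) := by
  obtain ⟨c, hc⟩ := hA
  obtain ⟨d, hd⟩ := kraft re_Rset Rset_wt
  refine ⟨d + c, fun n q ⟨r, h1, h2⟩ => Okp_K ?_⟩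
  have := hd r _ h2
  have h3 := hc n
  unfold KofNat at h3
  unfold one at this
  omega

theorem paths_finite (b : ℕ) : {Y : ℕ → Bool | ∀ n q, Okp q (one n) →
    Okp (q + b) (Encodable.encode (strPrefix Y n))}.Finite := by
  classical
  obtain ⟨N, hN⟩ := level_bound b
  by_contra hinf
  obtain ⟨F, hF, hc⟩ := (show Set.Infinite _ from hinf).exists_subset_card_eq (N + 1)
  -- a level separating the members of F
  have hsep : ∃ m, ∀ Y ∈ F, ∀ Z ∈ F, strPrefix Y m = strPrefix Z m → Y = Z := by
    have h1 : ∀ Y Z : ℕ → Bool, ∃ i, Y ≠ Z → Y i ≠ Z i := by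
      intro Y Z
      by_cases h : Y = Z
      · exact ⟨0, fun h' => absurd h h'⟩
      · obtain ⟨i, hi⟩ := Function.ne_iff.1 h
        exact ⟨i, fun _ => hi⟩
    choose g hg using h1
    refine ⟨F.sup (fun Y => F.sup (fun Z => g Y Z + 1)), fun Y hY Z hZ h => ?_⟩
    by_contra hne
    have h2 : g Y Z + 1 ≤ F.sup (fun Y => F.sup (fun Z => g Y Z + 1)) :=
      (Finset.le_sup (f := fun Z => g Y Z + 1) hZ).trans
        (Finset.le_sup (f := fun Y => F.sup (fun Z => g Y Z + 1)) hY)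
    apply hg Y Z hne
    have := congrArg (fun l => l.getD (g Y Z) false) h
    rwa [sp_getD _ h2, sp_getD _ h2] at this
  obtain ⟨m, hm⟩ := hsep
  have hex : ∃ q, Okp q (one m) := ⟨_, Okp_K le_rfl⟩
  have := hN m (Nat.find hex) (fun q' h => Nat.find_min hex h) (F.image (fun Y => strPrefix Y m)) (by
    intro σ hσ
    obtain ⟨Y, hY, rfl⟩ := Finset.mem_image.1 hσ
    exact ⟨sp_length .., hF hY m _ (Nat.find_spec hex)⟩)
  rw [Finset.card_image_of_injOn (fun Y hY Z hZ h => hm Y hY Z hZ h), hc] at this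
  omega

/-- the longest string in a list -/
def longest (l : List (List Bool)) : List Bool :=
  l.foldl (fun acc σ => if acc.length < σ.length then σ else acc) []

@[fun_prop] theorem pr_longest {α : Type} [Primcodable α] {f : α → List (List Bool)} (hf : Primrec f) :
    Primrec (fun a => longest (f a)) := by unfold longest; fun_prop

theorem longest_mem (l : List (List Bool)) : longest l = [] ∨ longest l ∈ l := by
  induction l using List.reverseRecOn with
  | nil => simp [longest]
  | append_singleton l σ ih =>
    have : longest (l ++ [σ]) = if (longest l).length < σ.length then σ else longest l := by
      unfold longest; rw [List.foldl_append]; rfl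
    rw [this]
    split_ifs
    · simp
    · rcases ih with h | h
      · exact Or.inl h
      · right; simp [h]

theorem length_le_longest {l : List (List Bool)} {σ : List Bool} (h : σ ∈ l) :
    σ.length ≤ (longest l).length := by
  induction l using List.reverseRecOn with
  | nil => simp at h
  | append_singleton l τ ih =>
    have : longest (l ++ [τ]) = if (longest l).length < τ.length then τ else longest l := by
      unfold longest; rw [List.foldl_append]; rfl
    rw [this]
    rw [List.mem_append, List.mem_singleton] at h
    split_ifs with h1
    · rcases h with h | rfl
      · exact (ih h).trans h1.le
      · exact le_rfl
    · rcases h with h | rfl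
      · exact ih h
      · omega

theorem kt_approx {A : ℕ → Bool} (hA : KTrivial A) : ∃ as : ℕ → List Bool, Primrec as ∧
    ∀ n, ∃ s0, ∀ s ≥ s0, strPrefix A n <+: as s := by
  classical
  obtain ⟨b, hb⟩ := kt_Okp hA
  obtain ⟨Ok, -, hOk, hmono, hmonoq, -, -, hOkp⟩ := exists_Ok
  have hOkp' : ∀ q x, (∃ s, Ok ((q, x), s) = true) ↔ Okp q x := hOkp
  -- isolate A
  have hfin := paths_finite b
  obtain ⟨m0, hm0⟩ : ∃ m, ∀ Y : ℕ → Bool, (∀ n q, Okp q (one n) →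
      Okp (q + b) (Encodable.encode (strPrefix Y n))) → strPrefix Y m = strPrefix A m → Y = A := by
    have h1 : ∀ Y : ℕ → Bool, ∃ i, Y ≠ A → Y i ≠ A i := by
      intro Y
      by_cases h : Y = A
      · exact ⟨0, fun h' => absurd h h'⟩
      · obtain ⟨i, hi⟩ := Function.ne_iff.1 h
        exact ⟨i, fun _ => hi⟩
    choose g hg using h1
    refine ⟨hfin.toFinset.sup (fun Y => g Y + 1), fun Y hY h => ?_⟩
    by_contra hne
    have h2 : g Y + 1 ≤ hfin.toFinset.sup (fun Y => g Y + 1) :=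
      Finset.le_sup (f := fun Y => g Y + 1) (hfin.mem_toFinset.2 hY)
    apply hg Y hne
    have := congrArg (fun l => l.getD (g Y) false) h
    rwa [sp_getD _ h2, sp_getD _ h2] at this
  set w0 := strPrefix A m0 with hw0
  let Ts : ℕ → List Bool → Prop := fun s σ => w0 <+: σ ∧ ∀ n ≤ σ.length, ∀ q ≤ s, Ok ((q, one n), s) = false ∨
    Ok ((q + b, Encodable.encode (σ.take n)), s) = true
  let as : ℕ → List Bool := fun s => longest (((List.range s).map fun i =>
    (Encodable.decode i : Option (List Bool)).getD []).filter fun σ => decide (Ts s σ))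
  have has : Primrec as := by unfold as Ts; fun_prop
  refine ⟨as, has, ?_⟩
  have hmem : ∀ s, as s = [] ∨ Ts s (as s) := by
    intro s
    rcases longest_mem (((List.range s).map fun i =>
      (Encodable.decode i : Option (List Bool)).getD []).filter fun σ => decide (Ts s σ)) with h | h
    · exact Or.inl h
    · right
      rw [List.mem_filter] at h
      simpa using h.2
  have hAT : ∀ n, m0 ≤ n → ∀ᶠ s in Filter.atTop, Ts s (strPrefix A n) := by
    intro n hn
    have : ∀ m ∈ Set.Iic n, ∀ᶠ s in Filter.atTop, ∀ q ≤ s, Ok ((q, one m), s) = false ∨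
      Ok ((q + b, Encodable.encode ((strPrefix A n).take m)), s) = true := by
      intro m hm
      have hm' : m ≤ n := hm
      have hex : ∃ q, Okp q (one m) := ⟨_, Okp_K le_rfl⟩
      obtain ⟨s1, hs1⟩ := (hOkp' _ _).2 (hb m _ (Nat.find_spec hex))
      filter_upwards [Filter.eventually_ge_atTop s1] with s hs q _
      by_cases h : Ok ((q, one m), s) = false
      · exact Or.inl h
      · right
        have h2 : Okp q (one m) := (hOkp' _ _).1 ⟨s, by simpa using h⟩
        have h3 := Nat.find_min' hex h2
        rw [sp_take, min_eq_left hm']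
        exact hmonoq _ _ _ _ (by omega) (hmono _ _ _ _ hs hs1)
    have := (Filter.eventually_all_finite (Set.finite_Iic n)).2 this
    filter_upwards [this] with s hs
    refine ⟨sp_mono A hn, fun m hm => hs m (by simpa [sp_length] using hm)⟩
  have hlen : ∀ n, ∀ᶠ s in Filter.atTop, n ≤ (as s).length := by
    intro n
    filter_upwards [hAT (max n m0) (le_max_right _ _),
      Filter.eventually_gt_atTop (Encodable.encode (strPrefix A (max n m0)))] with s h1 h2
    have : strPrefix A (max n m0) ∈ (((List.range s).map fun i =>
      (Encodable.decode i : Option (List Bool)).getD []).filter fun σ => decide (Ts s σ)) := by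
      rw [List.mem_filter]
      refine ⟨List.mem_map.2 ⟨_, List.mem_range.2 h2, by simp⟩, by simpa using h1⟩
    have := length_le_longest this
    rw [sp_length] at this
    exact (le_max_left _ _).trans this
  intro n
  rw [← Filter.eventually_atTop]
  by_contra hcon
  have hfreq : ∃ᶠ s in Filter.atTop, ¬ strPrefix A n <+: as s :=
    Filter.not_eventually.1 hcon
  obtain ⟨U, hU, hUn⟩ : ∃ U : Ultrafilter ℕ, (U : Filter ℕ) ≤ Filter.atTop ∧
      ∀ᶠ s in (U : Filter ℕ), ¬ strPrefix A n <+: as s := by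
    have h1 : ¬ ({s | strPrefix A n <+: as s} ∈ (Filter.atTop : Filter ℕ)) := hcon
    rw [Filter.mem_iff_ultrafilter] at h1
    push Not at h1
    obtain ⟨U, hU, h2⟩ := h1
    exact ⟨U, hU, Ultrafilter.eventually_not.2 h2⟩
  let Y : ℕ → Bool := fun i => decide (∀ᶠ s in (U : Filter ℕ), (as s).getD i false = true)
  have hY : ∀ i, ∀ᶠ s in (U : Filter ℕ), (as s).getD i false = Y i := by
    intro i
    by_cases h : ∀ᶠ s in (U : Filter ℕ), (as s).getD i false = true
    · have : Y i = true := by simp only [Y]; exact decide_eq_true h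
      rw [this]; exact h
    · have : Y i = false := by simp only [Y]; exact decide_eq_false h
      rw [this]
      have := Ultrafilter.eventually_not.2 h
      filter_upwards [this] with s hs
      simpa using hs
  have hYp : ∀ m, ∀ᶠ s in (U : Filter ℕ), strPrefix Y m <+: as s := by
    intro m
    have h1 := (Filter.eventually_all_finite (Set.finite_Iio m)).2 (fun i _ => hY i)
    filter_upwards [h1, hU (hlen m)] with s h2 h3
    rw [List.prefix_iff_eq_take, sp_length]
    apply List.ext_getElem
    · simpa [sp_length] using h3
    · intro i h4 h5
      have h6 : i < m := by simpa [sp_length] using h4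
      have := h2 i h6
      rw [List.getD_eq_getElem _ _ (by omega)] at this
      rw [List.getElem_take, this]
      simp [strPrefix]
  have hlenU : ∀ n, ∀ᶠ s in (U : Filter ℕ), n ≤ (as s).length := fun n => hU (hlen n)
  have hgeU : ∀ n, ∀ᶠ s in (U : Filter ℕ), n ≤ s := fun n => hU (Filter.eventually_ge_atTop n)
  have hYA : Y = A := by
    apply hm0
    · intro m q hq
      obtain ⟨s1, hs1⟩ := (hOkp' _ _).2 hq
      obtain ⟨s, h1, h2, h3⟩ := ((hYp m).and ((hlenU (m + 1)).and
        (hgeU (max s1 q)))).exists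
      rcases hmem s with h | h
      · rw [h] at h2; simp at h2
      · have h4 := h.2 m (by omega) q ((le_max_right _ _).trans h3)
        have h5 := hmono _ _ _ _ ((le_max_left _ _).trans h3) hs1
        rw [h5] at h4
        have h6 : (as s).take m = strPrefix Y m := by
          have := List.prefix_iff_eq_take.1 h1
          rw [sp_length] at this
          exact this.symm
        rw [h6] at h4
        exact (hOkp' _ _).1 ⟨s, by simpa using h4⟩
    · obtain ⟨s, h1, h2⟩ := ((hYp m0).and (hU (hlen (m0 + 1)))).exists
      rcases hmem s with h | h
      · rw [h] at h2; simp at h2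
      · have h3 := h.1
        have h4 := List.prefix_of_prefix_length_le h1 h3 (by simp [hw0, sp_length])
        exact h4.eq_of_length (by simp [hw0, sp_length])
  have := (hYp n).and hUn
  rw [hYA] at this
  obtain ⟨s, h1, h2⟩ := this.exists
  exact h2 h1

/-! ### The golden run machine -/

abbrev Item := List Bool × ℕ × ℕ
abbrev Frame := List Bool × ℕ × ℕ × ℕ × List Item × List Item

def fV (F : Frame) : List Bool := F.1
def fH (F : Frame) : ℕ := F.2.1
def fE (F : Frame) : ℕ := F.2.2.1
def fJ (F : Frame) : ℕ := F.2.2.2.1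
def fL (F : Frame) : List Item := F.2.2.2.2.1
def fD (F : Frame) : List Item := F.2.2.2.2.2

section prf
variable {α : Type} [Primcodable α] {f : α → Frame}
@[fun_prop] theorem pr_fV (hf : Primrec f) : Primrec (fun a => fV (f a)) := by unfold fV; fun_prop
@[fun_prop] theorem pr_fH (hf : Primrec f) : Primrec (fun a => fH (f a)) := by unfold fH; fun_prop
@[fun_prop] theorem pr_fE (hf : Primrec f) : Primrec (fun a => fE (f a)) := by unfold fE; fun_prop
@[fun_prop] theorem pr_fJ (hf : Primrec f) : Primrec (fun a => fJ (f a)) := by unfold fJ; fun_prop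
@[fun_prop] theorem pr_fL (hf : Primrec f) : Primrec (fun a => fL (f a)) := by unfold fL; fun_prop
@[fun_prop] theorem pr_fD (hf : Primrec f) : Primrec (fun a => fD (f a)) := by unfold fD; fun_prop
end prf

def wlt (l : List Item) (c x : ℕ) : Prop :=
  (l.map fun i => 2 ^ ((l.map fun i => i.2.1).sum + x - i.2.1)).sum < c * 2 ^ (l.map fun i => i.2.1).sum

instance (l : List Item) (c x : ℕ) : Decidable (wlt l c x) := by unfold wlt; infer_instance

@[fun_prop] theorem pr_wlt {α : Type} [Primcodable α] {f : α → List Item} {g h : α → ℕ}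
    (hf : Primrec f) (hg : Primrec g) (hh : Primrec h) : PrimrecPred (fun a => wlt (f a) (g a) (h a)) := by
  unfold wlt; fun_prop

def atv (v : List Bool) (l : List Item) : List Item := l.filter fun i => decide (i.1 = v)

@[fun_prop] theorem pr_atv {α : Type} [Primcodable α] {f : α → List Item} {g : α → List Bool}
    (hf : Primrec f) (hg : Primrec g) : Primrec (fun a => atv (g a) (f a)) := by
  unfold atv; fun_prop

/-- sum of a valuation over a list of items -/
noncomputable def SS (φ : ℕ × ℕ → ℝ) (l : List Item) : ℝ := (l.map fun i => φ i.2).sum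

noncomputable def wφ : ℕ × ℕ → ℝ := fun x => (1 / 2) ^ x.1
noncomputable def WW (l : List Item) : ℝ := SS wφ l

theorem SS_nil (φ : ℕ × ℕ → ℝ) : SS φ [] = 0 := rfl
theorem SS_cons (φ : ℕ × ℕ → ℝ) (i : Item) (l : List Item) : SS φ (i :: l) = φ i.2 + SS φ l := by
  simp [SS]
theorem SS_append (φ : ℕ × ℕ → ℝ) (l l' : List Item) : SS φ (l ++ l') = SS φ l + SS φ l' := by
  simp [SS]
theorem SS_nonneg {φ : ℕ × ℕ → ℝ} (h : ∀ x, 0 ≤ φ x) (l : List Item) : 0 ≤ SS φ l := by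
  induction l with
  | nil => simp [SS]
  | cons i l ih => rw [SS_cons]; have := h i.2; linarith
theorem SS_filter (φ : ℕ × ℕ → ℝ) (p : Item → Bool) (l : List Item) :
    SS φ (l.filter p) + SS φ (l.filter fun i => !p i) = SS φ l := by
  induction l with
  | nil => simp [SS]
  | cons i l ih =>
    by_cases h : p i = true
    · rw [List.filter_cons_of_pos h, List.filter_cons_of_neg (by simp [h]), SS_cons, SS_cons]; linarith
    · rw [List.filter_cons_of_neg h, List.filter_cons_of_pos (by simpa using h), SS_cons, SS_cons]; linarith
theorem SS_retag (φ : ℕ × ℕ → ℝ) (v : List Bool) (l : List Item) :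
    SS φ (l.map fun i => (v, i.2)) = SS φ l := by
  simp [SS, Function.comp_def]
theorem wφ_nonneg (x : ℕ × ℕ) : 0 ≤ wφ x := by unfold wφ; positivity
theorem WW_nonneg (l : List Item) : 0 ≤ WW l := SS_nonneg wφ_nonneg l
theorem SS_filter_le {φ : ℕ × ℕ → ℝ} (h : ∀ x, 0 ≤ φ x) (p : Item → Bool) (l : List Item) :
    SS φ (l.filter p) ≤ SS φ l := by
  have := SS_filter φ p l
  have := SS_nonneg h (l.filter fun i => !p i)
  linarith

theorem wlt_iff (l : List Item) (c x : ℕ) : wlt l c x ↔ WW l < c * (1 / 2) ^ x := by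
  have key : ∀ (l : List Item) (S : ℕ), (∀ i ∈ l, i.2.1 ≤ S) →
      ((l.map fun i => 2 ^ (S - i.2.1)).sum : ℝ) = 2 ^ S * WW l := by
    intro l S
    induction l with
    | nil => simp [WW, SS]
    | cons i l ih =>
      intro h
      have h1 := ih (fun j hj => h j (by simp [hj]))
      have h2 := h i (by simp)
      rw [List.map_cons, List.sum_cons, h1]
      unfold WW
      rw [SS_cons]
      have : (2 : ℝ) ^ (S - i.2.1) = 2 ^ S * (1 / 2) ^ i.2.1 := by
        rw [one_div, inv_pow, pow_sub₀ _ (by norm_num) h2]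
      rw [this]; unfold wφ; ring
  have hle : ∀ i ∈ l, i.2.1 ≤ (l.map fun i => i.2.1).sum + x := fun i hi =>
    (List.single_le_sum (by simp) _ (List.mem_map.2 ⟨i, hi, rfl⟩) : i.2.1 ≤ (l.map fun i => i.2.1).sum).trans (Nat.le_add_right _ _)
  have h1 := key l _ hle
  unfold wlt
  rw [← Nat.cast_lt (α := ℝ)]
  push_cast
  rw [List.map_map, show (Nat.cast ∘ fun i : Item => 2 ^ ((l.map fun i => i.2.1).sum + x - i.2.1)) =
    fun i : Item => (2 : ℝ) ^ ((l.map fun i => i.2.1).sum + x - i.2.1) from by ext i; simp, h1, pow_add]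
  set S := (l.map fun i => i.2.1).sum
  have hS : (0 : ℝ) < 2 ^ S := by positivity
  have hx : (0 : ℝ) < 2 ^ x := by positivity
  rw [one_div, inv_pow]
  constructor
  · intro h
    rw [lt_mul_inv_iff₀ hx]
    nlinarith
  · intro h
    rw [lt_mul_inv_iff₀ hx] at h
    nlinarith

section machine
variable (as : ℕ → List Bool) (Ok : (ℕ × ℕ) × ℕ → Bool) (c : List Bool → ℕ) (m k d : ℕ)

def okI (s : ℕ) (i : Item) : Prop :=
  i.2.2 ≤ (as s).length ∧ Ok ((i.2.1 + 2 * d, Encodable.encode ((as s).take i.2.2)), s) = true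
instance (s : ℕ) (i : Item) : Decidable (okI as Ok d s i) := by unfold okI; infer_instance
def ready (s : ℕ) (F : Frame) : Prop := ∀ i ∈ fL F, okI as Ok d s i
instance (s : ℕ) (F : Frame) : Decidable (ready as Ok d s F) := by unfold ready; infer_instance
def lvv (s : ℕ) (F : Frame) : List Item := (fL F).filter fun i => decide (i.1 <+: as s)
def dvv (s : ℕ) (F : Frame) : List Item := fD F ++ (fL F).filter fun i => !decide (i.1 <+: as s)
def pcd (s : ℕ) (F : Frame) : Prop :=
  ¬ fV F <+: as s ∨ (ready as Ok d s F ∧ ¬ wlt (dvv as s F) 1 (fH F))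
instance (s : ℕ) (F : Frame) : Decidable (pcd as Ok d s F) := by unfold pcd; infer_instance
def retD (s : ℕ) (F : Frame) : List Item := if fV F <+: as s then dvv as s F else fD F
def cand (s : ℕ) (F : Frame) (l : ℕ) : Prop := (fV F).length < l ∧ l ≤ (as s).length ∧
  wlt (atv ((as s).take l) (lvv as s F)) (c ((as s).take l)) (fE F + m + l)
instance (s : ℕ) (F : Frame) (l : ℕ) : Decidable (cand as c m s F l) := by unfold cand; infer_instance
def fnd (s : ℕ) (F : Frame) : Option ℕ := (List.range s).find? fun l => decide (cand as c m s F l)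
def chl (s : ℕ) (b : Bool) (F : Frame) : List Frame := ((fnd as c m s F).map fun l =>
  if b = true then [((as s).take l, fE F + m + l, fE F + m + l + fJ F, 0, [], [])] else []).getD []
def iss (s : ℕ) (b : Bool) (F : Frame) : List Item := ((fnd as c m s F).map fun l =>
  if b = true then [] else [((as s).take l, fE F + m + l, s)]).getD []
def newF (s : ℕ) (b : Bool) (F : Frame) : Frame :=
  (fV F, fH F, fE F, fJ F, iss as c m s b F ++ lvv as s F, dvv as s F)
def upd (P : Frame) (v : List Bool) (D : List Item) : Frame :=
  (fV P, fH P, fE P, fJ P + 1, fL P ++ D.map (fun i => (v, i.2)), fD P)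
def popTo (v : List Bool) (D : List Item) (l : List Frame) : List Frame :=
  (l.head?.map fun P => upd P v D :: l.tail).getD []
def bt (l : List Frame) : Bool := decide (l.length < k)
def stepF (s : ℕ) (st : List Frame) (F : Frame) : List Frame :=
  if pcd as Ok d s F then popTo (fV F) (retD as s F) st.tail else
  if ready as Ok d s F then chl as c m s (bt k st) F ++ newF as c m s (bt k st) F :: st.tail else st
def stepR (s : ℕ) (st : List Frame) (F : Frame) : List Item :=
  if pcd as Ok d s F then [] else if ready as Ok d s F then iss as c m s (bt k st) F else []
def mstep (s : ℕ) (x : List Frame × List Item) : List Frame × List Item :=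
  (x.1.head?.map fun F => (stepF as Ok c m k d s x.1 F, stepR as Ok c m k d s x.1 F ++ x.2)).getD x
def mst (s : ℕ) : List Frame × List Item :=
  (List.range s).foldl (fun x t => mstep as Ok c m k d t x) ([([], 0, 0, 0, [], [])], [])

theorem mst_succ (s : ℕ) : mst as Ok c m k d (s + 1) = mstep as Ok c m k d s (mst as Ok c m k d s) := by
  unfold mst; rw [List.range_succ, List.foldl_append]; rfl

theorem mstep_cons (s : ℕ) (F : Frame) (rest : List Frame) (rq : List Item) :
    mstep as Ok c m k d s (F :: rest, rq) = (stepF as Ok c m k d s (F :: rest) F,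
      stepR as Ok c m k d s (F :: rest) F ++ rq) := rfl

end machine

theorem pr_mst {as : ℕ → List Bool} {Ok : (ℕ × ℕ) × ℕ → Bool} {c : List Bool → ℕ} {kk : ℕ → ℕ} (m : ℕ)
    (has : Primrec as) (hOk : Primrec Ok) (hc : Primrec c) (hk : Primrec kk) :
    Primrec (fun x : ℕ × ℕ => mst as Ok c m (kk x.1) x.1 x.2) := by
  have h0 : Primrec (fun x : (ℕ × ℕ) × Frame => lvv as x.1.2 x.2) := by unfold lvv; fun_prop
  have h1 : Primrec (fun x : (ℕ × ℕ) × Frame => dvv as x.1.2 x.2) := by unfold dvv; fun_prop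
  have h2 : PrimrecPred (fun x : (ℕ × ℕ) × Frame => ready as Ok x.1.1 x.1.2 x.2) := by
    unfold ready okI; fun_prop
  have h3 : PrimrecPred (fun x : (ℕ × ℕ) × Frame => pcd as Ok x.1.1 x.1.2 x.2) := by
    unfold pcd; fun_prop
  have h4 : Primrec (fun x : (ℕ × ℕ) × Frame => retD as x.1.2 x.2) := by unfold retD; fun_prop
  have h5 : PrimrecPred (fun x : ((ℕ × ℕ) × Frame) × ℕ => cand as c m x.1.1.2 x.1.2 x.2) := by
    unfold cand
    have : Primrec (fun x : ((ℕ × ℕ) × Frame) × ℕ => lvv as x.1.1.2 x.1.2) :=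
      h0.comp (by fun_prop : Primrec (fun x : ((ℕ × ℕ) × Frame) × ℕ => x.1))
    fun_prop
  have h6 : Primrec (fun x : (ℕ × ℕ) × Frame => fnd as c m x.1.2 x.2) := by unfold fnd; fun_prop
  have h7 : Primrec (fun x : ((ℕ × ℕ) × Frame) × Bool => chl as c m x.1.1.2 x.2 x.1.2) := by
    unfold chl
    have : Primrec (fun x : ((ℕ × ℕ) × Frame) × Bool => fnd as c m x.1.1.2 x.1.2) :=
      h6.comp (by fun_prop : Primrec (fun x : ((ℕ × ℕ) × Frame) × Bool => x.1))
    fun_prop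
  have h8 : Primrec (fun x : ((ℕ × ℕ) × Frame) × Bool => iss as c m x.1.1.2 x.2 x.1.2) := by
    unfold iss
    have : Primrec (fun x : ((ℕ × ℕ) × Frame) × Bool => fnd as c m x.1.1.2 x.1.2) :=
      h6.comp (by fun_prop : Primrec (fun x : ((ℕ × ℕ) × Frame) × Bool => x.1))
    fun_prop
  have h9 : Primrec (fun x : ((ℕ × ℕ) × Frame) × Bool => newF as c m x.1.1.2 x.2 x.1.2) := by
    unfold newF
    have e1 : Primrec (fun x : ((ℕ × ℕ) × Frame) × Bool => lvv as x.1.1.2 x.1.2) :=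
      h0.comp (by fun_prop : Primrec (fun x : ((ℕ × ℕ) × Frame) × Bool => x.1))
    have e2 : Primrec (fun x : ((ℕ × ℕ) × Frame) × Bool => dvv as x.1.1.2 x.1.2) :=
      h1.comp (by fun_prop : Primrec (fun x : ((ℕ × ℕ) × Frame) × Bool => x.1))
    fun_prop
  have h10 : Primrec (fun x : (List Bool × List Item) × List Frame => popTo x.1.1 x.1.2 x.2) := by
    unfold popTo upd; fun_prop
  have hb : Primrec (fun x : ℕ × List Frame => bt (kk x.1) x.2) := by unfold bt; fun_prop
  have h11 : Primrec (fun x : ((ℕ × ℕ) × List Frame) × Frame =>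
      stepF as Ok c m (kk x.1.1.1) x.1.1.1 x.1.1.2 x.1.2 x.2) := by
    unfold stepF
    have f1 : Primrec (fun x : ((ℕ × ℕ) × List Frame) × Frame => (x.1.1, x.2)) := by fun_prop
    have f2 : Primrec (fun x : ((ℕ × ℕ) × List Frame) × Frame => ((x.1.1, x.2), bt (kk x.1.1.1) x.1.2)) := by
      have : Primrec (fun x : ((ℕ × ℕ) × List Frame) × Frame => bt (kk x.1.1.1) x.1.2) :=
        hb.comp (by fun_prop : Primrec (fun x : ((ℕ × ℕ) × List Frame) × Frame => (x.1.1.1, x.1.2)))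
      fun_prop
    have g4 := h4.comp f1
    have g10 := h10.comp (by fun_prop : Primrec (fun x : ((ℕ × ℕ) × List Frame) × Frame =>
      ((fV x.2, retD as x.1.1.2 x.2), x.1.2.tail)))
    have g7 := h7.comp f2
    have g9 := h9.comp f2
    exact Primrec.ite (h3.comp f1) g10 (Primrec.ite (h2.comp f1) (by fun_prop) (by fun_prop))
  have h12 : Primrec (fun x : ((ℕ × ℕ) × List Frame) × Frame =>
      stepR as Ok c m (kk x.1.1.1) x.1.1.1 x.1.1.2 x.1.2 x.2) := by
    unfold stepR
    have f1 : Primrec (fun x : ((ℕ × ℕ) × List Frame) × Frame => (x.1.1, x.2)) := by fun_prop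
    have f2 : Primrec (fun x : ((ℕ × ℕ) × List Frame) × Frame => ((x.1.1, x.2), bt (kk x.1.1.1) x.1.2)) := by
      have : Primrec (fun x : ((ℕ × ℕ) × List Frame) × Frame => bt (kk x.1.1.1) x.1.2) :=
        hb.comp (by fun_prop : Primrec (fun x : ((ℕ × ℕ) × List Frame) × Frame => (x.1.1.1, x.1.2)))
      fun_prop
    have g8 := h8.comp f2
    exact Primrec.ite (h3.comp f1) (by fun_prop) (Primrec.ite (h2.comp f1) g8 (by fun_prop))
  have h13 : Primrec (fun x : (ℕ × ℕ) × (List Frame × List Item) =>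
      mstep as Ok c m (kk x.1.1) x.1.1 x.1.2 x.2) := by
    unfold mstep
    have f1 : Primrec (fun x : ((ℕ × ℕ) × (List Frame × List Item)) × Frame => ((x.1.1, x.1.2.1), x.2)) := by
      fun_prop
    have g11 := h11.comp f1
    have g12 := h12.comp f1
    simp only at g11 g12
    fun_prop
  unfold mst
  have f1 : Primrec (fun x : (ℕ × ℕ) × ((List Frame × List Item) × ℕ) => ((x.1.1, x.2.2), x.2.1)) := by
    fun_prop
  have g13 := h13.comp f1
  simp only at g13
  fun_prop

/-! ### Invariants of the golden run machine -/

def Has (d q : ℕ) (v : List Bool) (x : ℕ × ℕ) : Prop := ∃ F : Finset (List Bool), q ≤ F.card ∧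
  ∀ σ ∈ F, v <+: σ ∧ σ.length = x.2 ∧ Okp (x.1 + 2 * d) (Encodable.encode σ)

theorem Has_zero (d : ℕ) (v : List Bool) (x : ℕ × ℕ) : Has d 0 v x := ⟨∅, by simp, by simp⟩

structure FI (c : List Bool → ℕ) (m d q : ℕ) (F : Frame) : Prop where
  hl : ∀ i ∈ fL F, fV F <+: i.1 ∧ (fV F).length < i.1.length ∧ i.1.length ≤ i.2.2 ∧ Has d q i.1 i.2
  hp : ∃ w, ∀ i ∈ fL F, i.1 <+: w
  hd : ∀ i ∈ fD F, (fV F).length ≤ i.2.2 ∧ Has d (q + 1) (fV F) i.2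
  hw : ∀ v, WW (atv v (fL F)) ≤ (c v + 2) * (1 / 2) ^ (fE F + m + v.length)
  hwd : WW (fD F) < (1 / 2) ^ (fH F)
  he : fH F ≤ fE F

structure Lnk (c : List Bool → ℕ) (m : ℕ) (C F : Frame) : Prop where
  h1 : fV F <+: fV C
  h2 : (fV F).length < (fV C).length
  h3 : ∃ w, fV C <+: w ∧ ∀ i ∈ fL F, i.1 <+: w
  h4 : fH C = fE F + m + (fV C).length
  h5 : fE C = fE F + m + (fV C).length + fJ F
  h6 : WW (atv (fV C) (fL F)) ≤ c (fV C) * (1 / 2) ^ (fE F + m + (fV C).length)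

theorem WW_append (l l' : List Item) : WW (l ++ l') = WW l + WW l' := SS_append ..
theorem WW_nil : WW [] = 0 := rfl
theorem atv_append (v : List Bool) (l l' : List Item) : atv v (l ++ l') = atv v l ++ atv v l' := by
  simp [atv]
theorem WW_atv_filter (v : List Bool) (p : Item → Bool) (l : List Item) :
    WW (atv v (l.filter p)) ≤ WW (atv v l) := by
  unfold atv
  rw [List.filter_comm]
  exact SS_filter_le wφ_nonneg _ _

theorem path_sum (w : List Bool) (l : List Item) (h : ∀ i ∈ l, i.1 <+: w ∧ 0 < i.1.length) :
    WW l = ∑ t ∈ Finset.range w.length, WW (atv (w.take (t + 1)) l) := by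
  induction l with
  | nil => simp [atv, WW_nil]
  | cons i l ih =>
    have h1 := ih (fun j hj => h j (by simp [hj]))
    obtain ⟨h2, h3⟩ := h i (by simp)
    have h4 : ∀ t, WW (atv (w.take (t + 1)) (i :: l)) =
        (if w.take (t + 1) = i.1 then wφ i.2 else 0) + WW (atv (w.take (t + 1)) l) := by
      intro t
      by_cases ht : w.take (t + 1) = i.1
      · simp [atv, ht, WW, SS_cons]
      · rw [if_neg ht, zero_add]; unfold atv
        rw [List.filter_cons_of_neg (by simpa using fun h => ht (Eq.symm h))]
    simp only [h4]
    rw [Finset.sum_add_distrib, ← h1]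
    have h5 : ∑ t ∈ Finset.range w.length, (if w.take (t + 1) = i.1 then wφ i.2 else 0) = wφ i.2 := by
      rw [Finset.sum_eq_single (i.1.length - 1)]
      · rw [if_pos]
        rw [Nat.sub_add_cancel h3]
        exact (List.prefix_iff_eq_take.1 h2).symm
      · intro t ht hne
        rw [if_neg]
        intro he
        have := congrArg List.length he
        rw [List.length_take, min_eq_left (by have := Finset.mem_range.1 ht; omega)] at this
        omega
      · intro hn
        have := h2.length_le
        exact absurd (Finset.mem_range.2 (by omega)) hn
    rw [h5]
    simp [WW, SS_cons]

section inv
variable {as : ℕ → List Bool} {Ok : (ℕ × ℕ) × ℕ → Bool} {c : List Bool → ℕ} {m k d M : ℕ}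

theorem geo_le (n : ℕ) : ∑ t ∈ Finset.range n, (1 / 2 : ℝ) ^ (t + 1) ≤ 1 := by
  have : ∑ t ∈ Finset.range n, (1 / 2 : ℝ) ^ (t + 1) = 1 - (1 / 2) ^ n := by
    induction n with
    | zero => simp
    | succ n ih => rw [Finset.sum_range_succ, ih]; ring
  rw [this]
  have : (0 : ℝ) ≤ (1 / 2) ^ n := by positivity
  linarith

theorem live_le (hM : ∀ w : List Bool, ∑ t ∈ Finset.range w.length, (c (w.take (t + 1)) : ℝ) * (1 / 2) ^ (t + 1) ≤ M)
    (hm : M + 2 ≤ 2 ^ m) {q : ℕ} {F : Frame} (h : FI c m d q F) : WW (fL F) ≤ (1 / 2) ^ (fE F) := by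
  obtain ⟨w, hw⟩ := h.hp
  rw [path_sum w (fL F) (fun i hi => ⟨hw i hi, by have := (h.hl i hi).2.1; omega⟩)]
  calc ∑ t ∈ Finset.range w.length, WW (atv (w.take (t + 1)) (fL F))
      ≤ ∑ t ∈ Finset.range w.length, ((1 / 2 : ℝ) ^ (fE F + m) * ((c (w.take (t + 1)) : ℝ) * (1 / 2) ^ (t + 1))
        + 2 * (1 / 2 : ℝ) ^ (fE F + m) * (1 / 2) ^ (t + 1)) := by
        apply Finset.sum_le_sum
        intro t ht
        refine (h.hw _).trans (le_of_eq ?_)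
        rw [List.length_take, min_eq_left (by have := Finset.mem_range.1 ht; omega)]
        ring
    _ = (1 / 2 : ℝ) ^ (fE F + m) * (∑ t ∈ Finset.range w.length, (c (w.take (t + 1)) : ℝ) * (1 / 2) ^ (t + 1))
        + 2 * (1 / 2 : ℝ) ^ (fE F + m) * ∑ t ∈ Finset.range w.length, (1 / 2 : ℝ) ^ (t + 1) := by
        rw [Finset.sum_add_distrib, Finset.mul_sum, Finset.mul_sum]
    _ ≤ (1 / 2 : ℝ) ^ (fE F + m) * M + 2 * (1 / 2 : ℝ) ^ (fE F + m) * 1 := by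
        gcongr
        · exact hM w
        · exact geo_le _
    _ = (1 / 2 : ℝ) ^ (fE F) * ((1 / 2) ^ m * (M + 2)) := by rw [pow_add]; ring
    _ ≤ (1 / 2 : ℝ) ^ (fE F) * 1 := by
        gcongr
        have : (M + 2 : ℝ) ≤ 2 ^ m := by exact_mod_cast hm
        rw [one_div, inv_pow, inv_mul_le_iff₀ (by positivity), mul_one]
        exact this
    _ = _ := mul_one _

theorem fnd_some {s l : ℕ} {F : Frame} (h : fnd as c m s F = some l) : cand as c m s F l ∧ l < s := by
  unfold fnd at h
  have h1 := List.find?_some h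
  have h2 := List.mem_of_find?_eq_some h
  exact ⟨by simpa using h1, List.mem_range.1 h2⟩

theorem dvv_has (hOk : ∀ q x s, Ok ((q, x), s) = true → Okp q x) {s q : ℕ} {F : Frame} (h : FI c m d q F)
    (hr : ready as Ok d s F) (hv : fV F <+: as s) :
    ∀ i ∈ dvv as s F, (fV F).length ≤ i.2.2 ∧ Has d (q + 1) (fV F) i.2 := by
  classical
  intro i hi
  rw [dvv, List.mem_append] at hi
  rcases hi with hi | hi
  · exact h.hd i hi
  · rw [List.mem_filter] at hi
    obtain ⟨hi1, hi2⟩ := hi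
    have hi2 : ¬ i.1 <+: as s := by simpa using hi2
    obtain ⟨h1, h2, h3, G, hG, hG2⟩ := h.hl i hi1
    obtain ⟨h4, h5⟩ := hr i hi1
    refine ⟨by omega, insert ((as s).take i.2.2) G, ?_, ?_⟩
    · rw [Finset.card_insert_of_notMem]
      · omega
      · intro hmem
        exact hi2 ((hG2 _ hmem).1.trans (List.take_prefix _ _))
    · intro σ hσ
      rcases Finset.mem_insert.1 hσ with rfl | hσ
      · refine ⟨?_, by simpa using h4, hOk _ _ _ h5⟩
        rw [List.prefix_take_iff]
        exact ⟨hv, by omega⟩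
      · obtain ⟨e1, e2, e3⟩ := hG2 σ hσ
        exact ⟨h1.trans e1, e2, e3⟩

theorem FI_newF (hOk : ∀ q x s, Ok ((q, x), s) = true → Okp q x) {s q : ℕ} {F : Frame} (h : FI c m d q F)
    (hr : ready as Ok d s F) (hv : fV F <+: as s) (hw : wlt (dvv as s F) 1 (fH F)) {b : Bool}
    (hb : b = true ∨ q = 0) : FI c m d q (newF as c m s b F) := by
  have hiss : ∀ i ∈ iss as c m s b F, ∃ l, cand as c m s F l ∧ l < s ∧ i = ((as s).take l, fE F + m + l, s) ∧
      b = false := by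
    intro i hi
    unfold iss at hi
    cases hf : fnd as c m s F with
    | none => simp [hf] at hi
    | some l =>
      obtain ⟨h1, h2⟩ := fnd_some hf
      cases b with
      | true => simp [hf] at hi
      | false => exact ⟨l, h1, h2, by simpa [hf] using hi, rfl⟩
  refine ⟨?_, ⟨as s, ?_⟩, dvv_has hOk h hr hv, ?_, ?_, h.he⟩
  · intro i hi
    change i ∈ iss as c m s b F ++ lvv as s F at hi
    change fV F <+: i.1 ∧ (fV F).length < i.1.length ∧ _
    rw [List.mem_append] at hi
    rcases hi with hi | hi
    · obtain ⟨l, ⟨h1, h2, h3⟩, h4, rfl, h5⟩ := hiss i hi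
      have hq : q = 0 := by rcases hb with hb | hb; · simp [hb] at h5
                            · exact hb
      subst hq
      refine ⟨?_, by simp; omega, by simp; omega, Has_zero ..⟩
      rw [List.prefix_take_iff]
      exact ⟨hv, h1.le⟩
    · exact h.hl i (List.mem_filter.1 hi).1
  · intro i hi
    change i ∈ iss as c m s b F ++ lvv as s F at hi
    rw [List.mem_append] at hi
    rcases hi with hi | hi
    · obtain ⟨l, -, -, rfl, -⟩ := hiss i hi
      exact List.take_prefix _ _
    · simpa using (List.mem_filter.1 hi).2
  · intro v
    change WW (atv v (iss as c m s b F ++ lvv as s F)) ≤ (c v + 2) * (1 / 2) ^ (fE F + m + v.length)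
    have h0 : WW (atv v (lvv as s F)) ≤ (c v + 2) * (1 / 2) ^ (fE F + m + v.length) :=
      (WW_atv_filter _ _ _).trans (h.hw v)
    rw [atv_append, WW_append]
    cases hf : fnd as c m s F with
    | none => simpa [iss, hf, atv, WW_nil] using h0
    | some l =>
      obtain ⟨⟨h1, h2, h3⟩, h4⟩ := fnd_some hf
      cases b with
      | true => simpa [iss, hf, atv, WW_nil] using h0
      | false =>
        by_cases hvt : (as s).take l = v
        · have e : atv v (iss as c m s false F) = [((as s).take l, fE F + m + l, s)] := by
            simp [iss, hf, atv, hvt]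
          rw [e]
          rw [wlt_iff, hvt] at h3
          have e2 : WW [((as s).take l, fE F + m + l, s)] = (1 / 2) ^ (fE F + m + l) := by
            simp [WW, SS, wφ]
          have e3 : v.length = l := by rw [← hvt]; simp [h2]
          rw [e2, e3]
          have : (0 : ℝ) ≤ (1 / 2) ^ (fE F + m + l) := by positivity
          nlinarith
        · have e : atv v (iss as c m s false F) = [] := by
            simp [iss, hf, atv, hvt]
          rw [e, WW_nil, zero_add]; exact h0
  · have := (wlt_iff _ _ _).1 hw
    rw [Nat.cast_one, one_mul] at this
    exact this

theorem chl_cases (s : ℕ) (b : Bool) (F : Frame) : chl as c m s b F = [] ∨ ∃ l, b = true ∧ fnd as c m s F = some l ∧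
    chl as c m s b F = [((as s).take l, fE F + m + l, fE F + m + l + fJ F, 0, [], [])] ∧
    iss as c m s b F = [] := by
  cases hf : fnd as c m s F with
  | none => left; simp [chl, hf]
  | some l =>
    cases b with
    | true => right; exact ⟨l, rfl, rfl, by simp [chl, hf], by simp [iss, hf]⟩
    | false => left; simp [chl, hf]

theorem FI_child (v : List Bool) (q h e j : ℕ) (he : h ≤ e) : FI c m d q (v, h, e, j, [], []) := by
  refine ⟨by simp [fL], ⟨[], by simp [fL]⟩, by simp [fD], ?_, ?_, he⟩
  · intro v
    simp only [fL, atv, List.filter_nil, WW_nil]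
    positivity
  · simp only [fD, WW_nil, fH]; positivity

theorem Lnk_child {s l : ℕ} {F : Frame} (hv : fV F <+: as s) (hf : fnd as c m s F = some l) :
    Lnk c m ((as s).take l, fE F + m + l, fE F + m + l + fJ F, 0, [], []) (newF as c m s true F) := by
  obtain ⟨⟨h1, h2, h3⟩, h4⟩ := fnd_some hf
  have e0 : ((as s).take l).length = l := by simp [h2]
  have e1 : iss as c m s true F = [] := by simp [iss, hf]
  have e2 : fL (newF as c m s true F) = lvv as s F := by simp [newF, fL, e1]
  refine ⟨?_, ?_, ⟨as s, List.take_prefix _ _, ?_⟩, ?_, ?_, ?_⟩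
  · change fV F <+: (as s).take l
    rw [List.prefix_take_iff]; exact ⟨hv, h1.le⟩
  · change (fV F).length < ((as s).take l).length
    omega
  · intro i hi
    rw [e2] at hi
    simpa using (List.mem_filter.1 hi).2
  · change fE F + m + l = fE F + m + ((as s).take l).length
    rw [e0]
  · change fE F + m + l + fJ F = fE F + m + ((as s).take l).length + fJ F
    rw [e0]
  · change WW (atv ((as s).take l) (fL (newF as c m s true F))) ≤
      c ((as s).take l) * (1 / 2) ^ (fE F + m + ((as s).take l).length)
    rw [e0, e2]
    exact ((wlt_iff _ _ _).1 h3).le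

theorem FI_upd {q : ℕ} {C P : Frame} {D : List Item} (h : FI c m d (q + 1) P) (hL : Lnk c m C P)
    (hD : ∀ i ∈ D, (fV C).length ≤ i.2.2 ∧ Has d (q + 1) (fV C) i.2)
    (hW : WW D ≤ 2 * (1 / 2) ^ (fH C)) : FI c m d (q + 1) (upd P (fV C) D) := by
  refine ⟨?_, ?_, h.hd, ?_, h.hwd, h.he⟩
  · intro i hi
    change i ∈ fL P ++ D.map (fun i => (fV C, i.2)) at hi
    change fV P <+: i.1 ∧ (fV P).length < i.1.length ∧ _
    rw [List.mem_append, List.mem_map] at hi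
    rcases hi with hi | ⟨i, hi, rfl⟩
    · exact h.hl i hi
    · exact ⟨hL.h1, hL.h2, hD i hi⟩
  · obtain ⟨w, h1, h2⟩ := hL.h3
    refine ⟨w, ?_⟩
    intro i hi
    change i ∈ fL P ++ D.map (fun i => (fV C, i.2)) at hi
    rw [List.mem_append, List.mem_map] at hi
    rcases hi with hi | ⟨i, hi, rfl⟩
    · exact h2 i hi
    · exact h1
  · intro v
    change WW (atv v (fL P ++ D.map (fun i => (fV C, i.2)))) ≤ (c v + 2) * (1 / 2) ^ (fE P + m + v.length)
    rw [atv_append, WW_append]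
    by_cases hv : fV C = v
    · subst hv
      have : atv (fV C) (D.map (fun i => (fV C, i.2))) = D.map (fun i => (fV C, i.2)) := by
        unfold atv; rw [List.filter_eq_self]
        intro i hi
        obtain ⟨j, -, rfl⟩ := List.mem_map.1 hi
        simp
      rw [this]
      have e := SS_retag wφ (fV C) D
      have e' : WW (D.map (fun i => (fV C, i.2))) = WW D := e
      have := hL.h6
      rw [hL.h4] at hW
      rw [e']; linarith
    · have : atv v (D.map (fun i => (fV C, i.2))) = [] := by
        unfold atv; rw [List.filter_eq_nil_iff]
        intro i hi
        obtain ⟨j, -, rfl⟩ := List.mem_map.1 hi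
        simpa using hv
      rw [this, WW_nil, add_zero]
      exact h.hw v

end inv

/-- invariant for the frames below the top -/
def SB (c : List Bool → ℕ) (m k d : ℕ) : List Frame → Frame → Prop
  | [], F => fV F = [] ∧ fH F = 0 ∧ fE F = 0
  | P :: r, F => Lnk c m F P ∧ FI c m d (k - (r.length + 1)) P ∧ SB c m k d r P

theorem Lnk_congr {c : List Bool → ℕ} {m : ℕ} {F F' P : Frame} (h1 : fV F' = fV F) (h2 : fH F' = fH F)
    (h3 : fE F' = fE F) (h : Lnk c m F P) : Lnk c m F' P := by
  obtain ⟨a, b, e, f, g, i⟩ := h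
  constructor <;> simp only [h1, h2, h3] <;> assumption

theorem SB_congr {c : List Bool → ℕ} {m k d : ℕ} {r : List Frame} {F F' : Frame} (h1 : fV F' = fV F)
    (h2 : fH F' = fH F) (h3 : fE F' = fE F) (h : SB c m k d r F) : SB c m k d r F' := by
  cases r with
  | nil => simpa only [SB, h1, h2, h3] using h
  | cons P r => exact ⟨Lnk_congr h1 h2 h3 h.1, h.2⟩

noncomputable def tot (φ : ℕ × ℕ → ℝ) (st : List Frame) : ℝ := (st.map fun F => SS φ (fL F) + SS φ (fD F)).sum
noncomputable def tau (m : ℕ) (F : Frame) : ℝ := ∑ i ∈ Finset.range (fJ F), (1 / 2 : ℝ) ^ (fE F + m + i)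
noncomputable def totW (m : ℕ) (st : List Frame) : ℝ := (st.map fun F => WW (fL F) + WW (fD F) + tau m F).sum

theorem tot_cons (φ : ℕ × ℕ → ℝ) (F : Frame) (st : List Frame) :
    tot φ (F :: st) = SS φ (fL F) + SS φ (fD F) + tot φ st := by simp [tot]
theorem totW_cons (m : ℕ) (F : Frame) (st : List Frame) :
    totW m (F :: st) = WW (fL F) + WW (fD F) + tau m F + totW m st := by simp [totW]

theorem tau_le {m : ℕ} (hm : 1 ≤ m) (F : Frame) : tau m F ≤ (1 / 2) ^ (fE F) := by
  unfold tau
  have : ∀ i, (1 / 2 : ℝ) ^ (fE F + m + i) = ((1 / 2) ^ (fE F) * ((1 / 2) ^ m * 2)) * (1 / 2) ^ (i + 1) := by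
    intro i; rw [pow_add, pow_add, pow_succ]; ring
  simp only [this]
  rw [← Finset.mul_sum]
  have h1 := geo_le (fJ F)
  have h2 : (1 / 2 : ℝ) ^ m * 2 ≤ 1 := by
    obtain ⟨n, rfl⟩ := Nat.exists_eq_add_of_le hm
    rw [pow_add]
    have : (1 / 2 : ℝ) ^ n ≤ 1 := pow_le_one₀ (by norm_num) (by norm_num)
    linarith
  have h3 : (0 : ℝ) < (1 / 2) ^ (fE F) := by positivity
  calc _ ≤ (1 / 2 : ℝ) ^ (fE F) * 1 * 1 := by gcongr
    _ = _ := by ring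

noncomputable def cφ (N : ℕ) : ℕ × ℕ → ℝ := fun x => if x.2 = N then 1 else 0
theorem cφ_nonneg (N : ℕ) (x : ℕ × ℕ) : 0 ≤ cφ N x := by unfold cφ; split_ifs <;> norm_num

theorem SS_count (N : ℕ) (l : List Item) : SS (cφ N) l = ((l.map fun i => i.2.2).count N : ℝ) := by
  induction l with
  | nil => simp [SS]
  | cons i l ih =>
    rw [SS_cons, ih, List.map_cons, List.count_cons, cφ]
    by_cases h : i.2.2 = N <;> simp [h, add_comm]

theorem WW_ofReal (l : List Item) : ENNReal.ofReal (WW l) = (l.map fun i => (2⁻¹ : ℝ≥0∞) ^ i.2.1).sum := by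
  induction l with
  | nil => simp [WW, SS]
  | cons i l ih =>
    rw [show WW (i :: l) = wφ i.2 + WW l from SS_cons .., ENNReal.ofReal_add (wφ_nonneg _) (WW_nonneg l), List.map_cons, List.sum_cons, ← ih]
    congr 1
    unfold wφ
    rw [ENNReal.ofReal_pow (by norm_num), one_div, ENNReal.ofReal_inv_of_pos (by norm_num)]
    simp

theorem no_bot {d k R : ℕ} (hR : wtf Prod.fst {x | Rset x} ≤ 2 ^ R) (hk : 2 ^ (2 * d + R) < k) (D : List Item)
    (hD : ∀ i ∈ D, Has d k [] i.2) (hc : ∀ N, SS (cφ N) D ≤ 1) : WW D < 1 := by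
  classical
  by_contra hcon
  push Not at hcon
  have hnd : (D.map fun i => i.2.2).Nodup := by
    rw [List.nodup_iff_count_le_one]
    intro N
    have := hc N
    rw [SS_count] at this
    exact_mod_cast this
  have h1 : ∀ i ∈ D, (k : ℝ≥0∞) * 2⁻¹ ^ (2 * d) * 2⁻¹ ^ i.2.1 ≤ wtf Prod.fst (RL i.2.2) := by
    intro i hi
    obtain ⟨F, hF, hF2⟩ := hD i hi
    refine le_trans ?_ (card_RL (F := F) (q := i.2.1 + 2 * d) (fun σ hσ => (hF2 σ hσ).2))
    rw [mul_assoc, ← pow_add, add_comm]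
    gcongr
  have h2 : ∀ l : List Item, (∀ i ∈ l, (k : ℝ≥0∞) * 2⁻¹ ^ (2 * d) * 2⁻¹ ^ i.2.1 ≤ wtf Prod.fst (RL i.2.2)) →
      (k : ℝ≥0∞) * 2⁻¹ ^ (2 * d) * (l.map fun i => (2⁻¹ : ℝ≥0∞) ^ i.2.1).sum ≤
      ((l.map fun i => i.2.2).map fun n => wtf Prod.fst (RL n)).sum := by
    intro l
    induction l with
    | nil => simp
    | cons i l ih =>
      intro h
      simp only [List.map_cons, List.sum_cons, mul_add]
      exact add_le_add (h i (by simp)) (ih (fun j hj => h j (by simp [hj])))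
  have h3 := h2 D h1
  rw [← WW_ofReal, ← List.sum_toFinset _ hnd] at h3
  have h4 := h3.trans ((ENNReal.sum_le_tsum _).trans (sum_RL.trans hR))
  have h5 : (k : ℝ≥0∞) * 2⁻¹ ^ (2 * d) * 1 ≤ 2 ^ R := by
    refine le_trans ?_ h4
    gcongr
    rw [← ENNReal.ofReal_one]
    exact ENNReal.ofReal_le_ofReal hcon
  rw [mul_one, ← ENNReal.inv_pow, ← div_eq_mul_inv, ENNReal.div_le_iff (by simp) (by simp), ← pow_add] at h5
  have h6 : k ≤ 2 ^ (R + 2 * d) := by exact_mod_cast h5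
  rw [add_comm] at hk
  omega

structure MInv (c : List Bool → ℕ) (m k d s : ℕ) (x : List Frame × List Item) : Prop where
  ne : ∃ F rest, x.1 = F :: rest ∧ FI c m d (k - (rest.length + 1)) F ∧ SB c m k d rest F ∧ rest.length + 1 ≤ k
  cnt : ∀ N, tot (cφ N) x.1 ≤ if N < s then 1 else 0
  rq : WW x.2 ≤ totW m x.1
  mem : ∀ F ∈ x.1, ∀ i ∈ fL F ++ fD F, i.2 ∈ x.2.map fun i => i.2

section step
variable {as : ℕ → List Bool} {Ok : (ℕ × ℕ) × ℕ → Bool} {c : List Bool → ℕ} {m k d M R : ℕ}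

theorem SS_newF (φ : ℕ × ℕ → ℝ) (s : ℕ) (b : Bool) (F : Frame) :
    SS φ (fL (newF as c m s b F)) + SS φ (fD (newF as c m s b F)) =
      SS φ (iss as c m s b F) + (SS φ (fL F) + SS φ (fD F)) := by
  change SS φ (iss as c m s b F ++ lvv as s F) + SS φ (dvv as s F) = _
  unfold lvv dvv
  rw [SS_append, SS_append, ← SS_filter φ (fun i => decide (i.1 <+: as s)) (fL F)]
  ring

theorem SS_dvv_le {φ : ℕ × ℕ → ℝ} (hφ : ∀ x, 0 ≤ φ x) (s : ℕ) (F : Frame) :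
    SS φ (dvv as s F) ≤ SS φ (fL F) + SS φ (fD F) := by
  unfold dvv
  rw [SS_append]
  have := SS_filter_le hφ (fun i => !decide (i.1 <+: as s)) (fL F)
  linarith

theorem SS_retD {φ : ℕ × ℕ → ℝ} (hφ : ∀ x, 0 ≤ φ x) (s : ℕ) (F : Frame) :
    SS φ (fD F) ≤ SS φ (retD as s F) ∧ SS φ (retD as s F) ≤ SS φ (fL F) + SS φ (fD F) := by
  unfold retD
  split_ifs
  · refine ⟨?_, SS_dvv_le hφ s F⟩
    unfold dvv
    rw [SS_append]
    have := SS_nonneg hφ ((fL F).filter fun i => !decide (i.1 <+: as s))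
    linarith
  · have := SS_nonneg hφ (fL F)
    exact ⟨le_rfl, by linarith⟩

theorem SS_iss_cnt (N s : ℕ) (b : Bool) (F : Frame) : SS (cφ N) (iss as c m s b F) ≤ if N = s then 1 else 0 := by
  cases hf : fnd as c m s F with
  | none => simp [iss, hf, SS]; split_ifs <;> norm_num
  | some l =>
    cases b with
    | true => simp [iss, hf, SS]; split_ifs <;> norm_num
    | false =>
      simp only [iss, hf, SS, cφ, Option.map_some, Option.getD_some]
      by_cases h : N = s
      · simp [h]
      · simp [h, Ne.symm h]

theorem SS_chl (φ : ℕ × ℕ → ℝ) (s : ℕ) (b : Bool) (F : Frame) : tot φ (chl as c m s b F) = 0 := by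
  rcases chl_cases (as := as) (c := c) (m := m) s b F with h | ⟨l, -, -, h, -⟩
  · rw [h]; simp [tot]
  · rw [h]; simp [tot, fL, fD, SS]

theorem tot_append (φ : ℕ × ℕ → ℝ) (l l' : List Frame) : tot φ (l ++ l') = tot φ l + tot φ l' := by simp [tot]
theorem totW_append (l l' : List Frame) : totW m (l ++ l') = totW m l + totW m l' := by simp [totW]

theorem totW_chl (s : ℕ) (b : Bool) (F : Frame) : totW m (chl as c m s b F) = 0 := by
  rcases chl_cases (as := as) (c := c) (m := m) s b F with h | ⟨l, -, -, h, -⟩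
  · rw [h]; simp [totW]
  · rw [h]; simp [totW, fL, fD, WW_nil, tau, fJ]

theorem Inv_step (hOk : ∀ q x s, Ok ((q, x), s) = true → Okp q x)
    (hM : ∀ w : List Bool, ∑ t ∈ Finset.range w.length, (c (w.take (t + 1)) : ℝ) * (1 / 2) ^ (t + 1) ≤ M)
    (hm : M + 2 ≤ 2 ^ m) (hR : wtf Prod.fst {x | Rset x} ≤ 2 ^ R) (hk : 2 ^ (2 * d + R) < k) {s : ℕ}
    {x : List Frame × List Item} (h : MInv c m k d s x) : MInv c m k d (s + 1) (mstep as Ok c m k d s x) := by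
  obtain ⟨⟨F, rest, hx, hFI, hSB, hlen⟩, hcnt, hrq, hmem⟩ := h
  obtain ⟨st, rq⟩ := x
  simp only at hx
  subst hx
  have hm1 : 1 ≤ m := by
    rcases Nat.eq_zero_or_pos m with rfl | h
    · simp at hm
    · exact h
  have hcnt' : ∀ N, tot (cφ N) (F :: rest) ≤ if N < s + 1 then 1 else 0 := by
    intro N
    refine (hcnt N).trans ?_
    split_ifs <;> first | omega | norm_num
  rw [mstep_cons]
  by_cases hpc : pcd as Ok d s F
  · -- pop
    rw [stepF, if_pos hpc, stepR, if_pos hpc, List.nil_append, List.tail_cons]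
    have hret : ∀ i ∈ retD as s F, (fV F).length ≤ i.2.2 ∧ Has d (k - (rest.length + 1) + 1) (fV F) i.2 := by
      unfold retD
      split_ifs with hv
      · refine dvv_has hOk hFI ?_ hv
        rcases hpc with h | h
        · exact absurd hv h
        · exact h.1
      · exact hFI.hd
    have hlive := live_le hM hm hFI
    cases rest with
    | nil =>
      exfalso
      obtain ⟨h1, h2, h3⟩ := hSB
      have hv : fV F <+: as s := by rw [h1]; exact List.nil_prefix
      rcases hpc with h | h
      · exact h hv
      · have h4 := h.2
        have h5 : retD as s F = dvv as s F := by rw [retD, if_pos hv]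
        rw [wlt_iff, h2, Nat.cast_one, pow_zero, mul_one] at h4
        apply h4
        rw [← h5]
        refine no_bot hR hk _ (fun i hi => ?_) (fun N => ?_)
        · have := (hret i hi).2
          rw [h1] at this
          rwa [show k - (([] : List Frame).length + 1) + 1 = k from Nat.sub_add_cancel hlen] at this
        · refine (SS_retD (cφ_nonneg N) s F).2.trans ?_
          have := hcnt N
          rw [tot_cons] at this
          simp only [tot, List.map_nil, List.sum_nil, add_zero] at this
          refine this.trans ?_
          split_ifs <;> norm_num
    | cons P r =>
      obtain ⟨hL, hP, hB⟩ := hSB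
      simp only [List.length_cons] at hlen hret hFI
      have hq : k - (r.length + 1) = k - (r.length + 1 + 1) + 1 := by omega
      rw [hq] at hP
      have hWret : WW (retD as s F) ≤ 2 * (1 / 2) ^ (fH F) := by
        refine (SS_retD wφ_nonneg s F).2.trans ?_
        have h1 : WW (fL F) ≤ (1 / 2) ^ (fE F) := hlive
        have h2 := hFI.hwd
        have h3 : (1 / 2 : ℝ) ^ (fE F) ≤ (1 / 2) ^ (fH F) :=
          pow_le_pow_of_le_one (by norm_num) (by norm_num) hFI.he
        unfold WW at h1 h2
        linarith
      change MInv c m k d (s + 1) (upd P (fV F) (retD as s F) :: r, rq)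
      refine ⟨⟨_, r, rfl, ?_, SB_congr (F := P) rfl rfl rfl hB, by omega⟩, ?_, ?_, ?_⟩
      · rw [hq]; exact FI_upd hP hL hret hWret
      · intro N
        refine le_trans ?_ (hcnt' N)
        have h2 := (SS_retD (as := as) (cφ_nonneg N) s F).2
        simp only [tot_cons]
        change SS (cφ N) (fL P ++ (retD as s F).map (fun i => (fV F, i.2))) + SS (cφ N) (fD P) + _ ≤ _
        rw [SS_append, SS_retag]
        linarith
      · refine hrq.trans ?_
        simp only [totW_cons]
        have e1 : WW (fL (upd P (fV F) (retD as s F))) = WW (fL P) + WW (retD as s F) := by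
          change SS wφ (fL P ++ (retD as s F).map (fun i => (fV F, i.2))) = _
          rw [SS_append, SS_retag]; rfl
        have e2 : tau m (upd P (fV F) (retD as s F)) = tau m P + (1 / 2) ^ (fE P + m + fJ P) := by
          change ∑ i ∈ Finset.range (fJ P + 1), (1 / 2 : ℝ) ^ (fE P + m + i) = _
          rw [Finset.sum_range_succ]; rfl
        have e3 : WW (fD (upd P (fV F) (retD as s F))) = WW (fD P) := rfl
        have h1 : WW (fD F) ≤ WW (retD as s F) := (SS_retD wφ_nonneg s F).1
        have h2 := tau_le hm1 F
        have h3 : (1 / 2 : ℝ) ^ (fE F) ≤ (1 / 2) ^ (fE P + m + fJ P + 1) :=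
          pow_le_pow_of_le_one (by norm_num) (by norm_num) (by have := hL.h5; have := hL.h2; omega)
        rw [pow_succ] at h3
        rw [e1, e2, e3]
        linarith
      · intro G hG i hi
        rcases List.mem_cons.1 hG with rfl | hG
        · change i ∈ (fL P ++ (retD as s F).map (fun i => (fV F, i.2))) ++ fD P at hi
          simp only [List.mem_append, List.mem_map] at hi
          rcases hi with (hi | ⟨j, hj, rfl⟩) | hi
          · exact hmem P (by simp) i (by simp [hi])
          · have : j ∈ fL F ++ fD F := by
              unfold retD dvv at hj
              split_ifs at hj
              · rw [List.mem_append, List.mem_filter] at hj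
                rw [List.mem_append]
                tauto
              · simp [hj]
            exact hmem F (by simp) j this
          · exact hmem P (by simp) i (by simp [hi])
        · exact hmem G (by simp [hG]) i hi
  · rw [stepF, if_neg hpc, stepR, if_neg hpc]
    by_cases hr : ready as Ok d s F
    swap
    · rw [if_neg hr, if_neg hr]
      exact ⟨⟨F, rest, rfl, hFI, hSB, hlen⟩, hcnt', hrq, hmem⟩
    rw [if_pos hr, if_pos hr, List.tail_cons]
    set b := bt k (F :: rest) with hb
    have hv : fV F <+: as s := by
      by_contra hv; exact hpc (Or.inl hv)
    have hw : wlt (dvv as s F) 1 (fH F) := by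
      by_contra hw; exact hpc (Or.inr ⟨hr, hw⟩)
    have hbq : b = true ∨ k - (rest.length + 1) = 0 := by
      by_cases h : rest.length + 1 < k
      · left; simp [hb, bt, h]
      · right; omega
    have hN := FI_newF hOk hFI hr hv hw hbq
    refine ⟨?_, ?_, ?_, ?_⟩
    · rcases chl_cases (as := as) (c := c) (m := m) s b F with h | ⟨l, h1, h2, h3, h4⟩
      · rw [h]; exact ⟨_, rest, rfl, hN, SB_congr (F := F) rfl rfl rfl hSB, hlen⟩
      · refine ⟨_, newF as c m s b F :: rest, by rw [h3]; rfl, FI_child _ _ _ _ _ (Nat.le_add_right _ _),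
          ⟨?_, hN, SB_congr (F := F) rfl rfl rfl hSB⟩, ?_⟩
        · rw [h1]; exact Lnk_child hv h2
        · rw [hb] at h1
          simpa [bt, Nat.succ_le_iff] using h1
    · intro N
      simp only [tot_append, tot_cons, SS_chl, SS_newF]
      have h1 := SS_iss_cnt (as := as) (c := c) (m := m) N s b F
      have h2 := hcnt N
      rw [tot_cons] at h2
      have h3 : ((if N = s then 1 else 0) + (if N < s then 1 else 0) : ℝ) ≤ if N < s + 1 then 1 else 0 := by
        split_ifs <;> first | omega | norm_num
      linarith
    · simp only [totW_append, totW_cons, totW_chl, WW_append]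
      have h1 := SS_newF (as := as) (c := c) (m := m) wφ s b F
      have h2 := hrq
      simp only [totW_cons] at h2
      have h3 : tau m (newF as c m s b F) = tau m F := rfl
      rw [h3]
      unfold WW at *
      linarith
    · intro G hG i hi
      simp only [List.mem_append, List.mem_cons] at hG
      rw [List.map_append, List.mem_append]
      rcases hG with hG | rfl | hG
      · rcases chl_cases (as := as) (c := c) (m := m) s b F with h | ⟨l, h1, h2, h3, h4⟩
        · rw [h] at hG; simp at hG
        · rw [h3, List.mem_singleton] at hG
          subst hG
          simp [fL, fD] at hi
      · change i ∈ (iss as c m s b F ++ lvv as s F) ++ dvv as s F at hi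
        unfold lvv dvv at hi
        simp only [List.mem_append, List.mem_filter] at hi
        rcases hi with (hi | hi) | hi | hi
        · left; exact List.mem_map.2 ⟨i, hi, rfl⟩
        · right; exact hmem F (by simp) i (by simp [hi.1])
        · right; exact hmem F (by simp) i (by simp [hi])
        · right; exact hmem F (by simp) i (by simp [hi.1])
      · right; exact hmem G (by simp [hG]) i hi

theorem Inv_mst (hOk : ∀ q x s, Ok ((q, x), s) = true → Okp q x)
    (hM : ∀ w : List Bool, ∑ t ∈ Finset.range w.length, (c (w.take (t + 1)) : ℝ) * (1 / 2) ^ (t + 1) ≤ M)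
    (hm : M + 2 ≤ 2 ^ m) (hR : wtf Prod.fst {x | Rset x} ≤ 2 ^ R) (hk : 2 ^ (2 * d + R) < k) (s : ℕ) :
    MInv c m k d s (mst as Ok c m k d s) := by
  induction s with
  | zero =>
    have : 0 < 2 ^ (2 * d + R) := by positivity
    refine ⟨⟨([], 0, 0, 0, [], []), [], rfl, FI_child _ _ _ _ _ le_rfl, ⟨rfl, rfl, rfl⟩, by simp only [List.length_nil]; omega⟩, ?_, ?_, ?_⟩
    · intro N; simp [mst, tot, fL, fD, SS]
    · simp [mst, totW, WW, SS, tau, fJ, fL, fD]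
    · simp [mst, fL, fD]
  | succ s ih => rw [mst_succ]; exact Inv_step hOk hM hm hR hk ih

theorem totW_le (hM : ∀ w : List Bool, ∑ t ∈ Finset.range w.length, (c (w.take (t + 1)) : ℝ) * (1 / 2) ^ (t + 1) ≤ M)
    (hm : M + 2 ≤ 2 ^ m) (hm1 : 1 ≤ m) : ∀ (rest : List Frame) (F : Frame), ∀ q, FI c m d q F → SB c m k d rest F →
    totW m (F :: rest) ≤ 6 - 3 * (1 / 2) ^ (fE F)
  | [], F, q, h, hB => by
    have h1 := live_le hM hm h
    have h2 := h.hwd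
    have h3 := tau_le hm1 F
    obtain ⟨-, e1, e2⟩ := hB
    rw [totW_cons]
    rw [e2, pow_zero] at h1 h3 ⊢
    rw [e1, pow_zero] at h2
    simp only [totW, List.map_nil, List.sum_nil]
    linarith
  | P :: r, F, q, h, hB => by
    have h1 := live_le hM hm h
    have h2 := h.hwd
    have h3 := tau_le hm1 F
    obtain ⟨e1, e2, e3⟩ := hB
    have h4 := totW_le hM hm hm1 r P _ e2 e3
    have h5 : (1 / 2 : ℝ) ^ (fE F) ≤ (1 / 2) ^ (fH F) := pow_le_pow_of_le_one (by norm_num) (by norm_num) h.he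
    have h6 : (1 / 2 : ℝ) ^ (fH F) ≤ (1 / 2) ^ (fE P + 1) :=
      pow_le_pow_of_le_one (by norm_num) (by norm_num) (by have := e1.h4; omega)
    rw [pow_succ] at h6
    rw [totW_cons]
    linarith

theorem Inv_rq (hM : ∀ w : List Bool, ∑ t ∈ Finset.range w.length, (c (w.take (t + 1)) : ℝ) * (1 / 2) ^ (t + 1) ≤ M)
    (hm : M + 2 ≤ 2 ^ m) {s : ℕ} {x : List Frame × List Item} (h : MInv c m k d s x) : WW x.2 ≤ 6 := by
  obtain ⟨⟨F, rest, hx, hFI, hSB, hlen⟩, hcnt, hrq, hmem⟩ := h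
  have hm1 : 1 ≤ m := by
    rcases Nat.eq_zero_or_pos m with rfl | h
    · simp at hm
    · exact h
  have h1 := totW_le hM hm hm1 rest F _ hFI hSB
  rw [hx] at hrq
  have : (0 : ℝ) ≤ (1 / 2) ^ (fE F) := by positivity
  linarith

end step

theorem WW_atv_le_of_split (v : List Bool) (p : Item → Bool) (l : List Item) :
    WW (atv v (l.filter p)) + WW (atv v (l.filter fun i => !p i)) = WW (atv v l) := by
  unfold atv
  have e1 : ∀ q : Item → Bool, List.filter (fun i => decide (i.1 = v)) (List.filter q l) =
      List.filter q (List.filter (fun i => decide (i.1 = v)) l) := fun q => List.filter_comm ..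
  rw [e1, e1]
  exact SS_filter wφ p _

theorem sum_atv_le (S : Finset (List Bool)) (l : List Item) : ∑ v ∈ S, WW (atv v l) ≤ WW l := by
  classical
  induction l with
  | nil => simp [atv, WW_nil]
  | cons i l ih =>
    have h4 : ∀ v, WW (atv v (i :: l)) = (if i.1 = v then wφ i.2 else 0) + WW (atv v l) := by
      intro v
      by_cases ht : i.1 = v
      · simp [atv, ht, WW, SS_cons]
      · rw [if_neg ht, zero_add]; unfold atv
        rw [List.filter_cons_of_neg (by simpa using ht)]
    simp only [h4]
    rw [Finset.sum_add_distrib, show WW (i :: l) = wφ i.2 + WW l from SS_cons ..]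
    refine add_le_add ?_ ih
    rw [Finset.sum_ite_eq]
    split_ifs
    · exact le_rfl
    · exact wφ_nonneg _

theorem exists_liminf (f : ℕ → ℕ) (K : ℕ) (hf : ∀ s, f s ≤ K) :
    ∃ p s0, f s0 = p ∧ (∀ s ≥ s0, p ≤ f s) ∧ ∀ t, ∃ s ≥ t, f s = p := by
  classical
  have hex : ∃ p, ∀ t, ∃ s ≥ t, f s = p := by
    by_contra hcon
    push Not at hcon
    choose g hg using hcon
    have h1 : ∀ p ≤ K, g p ≤ (Finset.range (K + 1)).sup g := fun p hp => Finset.le_sup (by simp; omega)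
    exact hg (f ((Finset.range (K + 1)).sup g)) _ (h1 _ (hf _)) rfl
  have hp := Nat.find_spec hex
  have hmin : ∀ q < Nat.find hex, ∃ t, ∀ s ≥ t, f s ≠ q := by
    intro q hq
    have := Nat.find_min hex hq
    push Not at this
    exact this
  set p := Nat.find hex
  choose! g hg using hmin
  obtain ⟨s0, h0, h1⟩ := hp ((Finset.range p).sup g)
  refine ⟨p, s0, h1, fun s hs => ?_, hp⟩
  by_contra hlt
  push Not at hlt
  exact hg (f s) hlt s (le_trans (Finset.le_sup (f := g) (by simpa using hlt)) (h0.trans hs)) rfl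

section golden
variable {as : ℕ → List Bool} {Ok : (ℕ × ℕ) × ℕ → Bool} {c : List Bool → ℕ} {m k d M R : ℕ}

theorem mstep_struct (s : ℕ) (X : List Frame) (C : Frame) (Y : List Frame) (rq : List Item) :
    (∃ X' C', (mstep as Ok c m k d s (X ++ C :: Y, rq)).1 = X' ++ C' :: Y ∧ fV C' = fV C ∧ fH C' = fH C ∧
      (X ≠ [] → 2 ≤ X.length → C' = C)) ∨
    (X = [] ∧ pcd as Ok d s C ∧ (mstep as Ok c m k d s (X ++ C :: Y, rq)).1 = popTo (fV C) (retD as s C) Y) := by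
  cases X with
  | nil =>
    rw [List.nil_append, mstep_cons]
    simp only [stepF, List.tail_cons]
    split_ifs with h1 h2
    · right; exact ⟨trivial, h1, rfl⟩
    · left; exact ⟨_, _, rfl, rfl, rfl, by simp⟩
    · left; exact ⟨[], C, rfl, rfl, rfl, by simp⟩
  | cons D X =>
    left
    rw [List.cons_append, mstep_cons]
    simp only [stepF, List.tail_cons]
    split_ifs with h1 h2
    · cases X with
      | nil => exact ⟨[], _, rfl, rfl, rfl, by simp⟩
      | cons E X => exact ⟨_ :: X, C, rfl, rfl, rfl, by simp⟩
    · exact ⟨chl as c m s _ D ++ newF as c m s _ D :: X, C, by rw [List.append_assoc]; rfl, rfl, rfl, by simp⟩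
    · exact ⟨D :: X, C, rfl, rfl, rfl, by simp⟩

/-- how the frame right above `R` evolves -/
theorem mstep_frame (s : ℕ) (X : List Frame) (F : Frame) (Y : List Frame) (rq : List Item) :
    -- top frame acting
    (X = [] ∧ pcd as Ok d s F ∧ (mstep as Ok c m k d s (X ++ F :: Y, rq)).1 = popTo (fV F) (retD as s F) Y) ∨
    (X = [] ∧ ¬ pcd as Ok d s F ∧ ¬ ready as Ok d s F ∧ (mstep as Ok c m k d s (X ++ F :: Y, rq)).1 = F :: Y) ∨
    (X = [] ∧ ¬ pcd as Ok d s F ∧ ready as Ok d s F ∧ ∃ b, (mstep as Ok c m k d s (X ++ F :: Y, rq)).1 =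
      chl as c m s b F ++ newF as c m s b F :: Y) ∨
    (∃ C, X = [C] ∧ pcd as Ok d s C ∧ (mstep as Ok c m k d s (X ++ F :: Y, rq)).1 =
      upd F (fV C) (retD as s C) :: Y) ∨
    (∃ X1 C X2 C', X = X1 ++ [C] ∧ (mstep as Ok c m k d s (X ++ F :: Y, rq)).1 = X2 ++ C' :: F :: Y ∧
      fV C' = fV C ∧ fH C' = fH C) := by
  rcases List.eq_nil_or_concat X with rfl | ⟨X1, C, rfl⟩
  · rw [List.nil_append, mstep_cons]
    simp only [stepF, List.tail_cons]
    by_cases h1 : pcd as Ok d s F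
    · left; simp [h1]
    · right
      by_cases h2 : ready as Ok d s F
      · right; left; exact ⟨trivial, h1, h2, bt k (F :: Y), by simp [h1, h2]⟩
      · left; simp [h1, h2]
  · right; right; right
    rw [List.concat_eq_append, List.append_assoc, List.singleton_append]
    rcases mstep_struct (as := as) (Ok := Ok) (c := c) (m := m) (k := k) (d := d) s X1 C (F :: Y) rq with
      ⟨X', C', h1, h2, h3, -⟩ | ⟨rfl, h1, h2⟩
    · right; exact ⟨X1, C, X', C', rfl, h1, h2, h3⟩
    · left; exact ⟨C, rfl, h1, h2⟩

end golden

theorem golden_abs {as : ℕ → List Bool} {Ok : (ℕ × ℕ) × ℕ → Bool} {c : List Bool → ℕ} {m k d : ℕ} {A : ℕ → Bool}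
    (hlen : ∀ s, (mst as Ok c m k d s).1 ≠ [] ∧ (mst as Ok c m k d s).1.length ≤ k)
    (hW : ∀ s, ∀ F ∈ (mst as Ok c m k d s).1, WW (fL F) + WW (fD F) ≤ 6)
    (has : ∀ n, ∃ s0, ∀ s ≥ s0, strPrefix A n <+: as s)
    (hreq : ∀ s, ∀ F ∈ (mst as Ok c m k d s).1, ∀ i ∈ fL F, ∃ s0, ∀ t ≥ s0,
      Ok ((i.2.1 + 2 * d, Encodable.encode (strPrefix A i.2.2)), t) = true) :
    ∃ s0 p a l0 : ℕ, (∀ l > l0, ∃ s ≥ s0, ∃ F, (mst as Ok c m k d s).1.reverse[p]? = some F ∧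
      ¬ wlt (atv (strPrefix A l) (fL F)) (c (strPrefix A l)) (a + l)) ∧
    ∀ S : Finset (List Bool), (∀ v ∈ S, ∃ s ≥ s0, ∃ F, (mst as Ok c m k d s).1.reverse[p]? = some F ∧
      ¬ wlt (atv v (fL F)) (c v) (a + v.length)) → ∑ v ∈ S, (c v : ℝ) * (1 / 2) ^ (a + v.length) ≤ 6 := by
  classical
  set st : ℕ → List Frame := fun s => (mst as Ok c m k d s).1 with hst
  have hstep : ∀ s X F Y, st s = X ++ F :: Y → st (s + 1) =
      (mstep as Ok c m k d s (X ++ F :: Y, (mst as Ok c m k d s).2)).1 := by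
    intro s X F Y h
    change (mst as Ok c m k d (s + 1)).1 = _
    rw [mst_succ, ← h]
  obtain ⟨p, s0, hp0, hp1, hp2⟩ := exists_liminf (fun s => (st s).length) k (fun s => (hlen s).2)
  obtain ⟨F0, Y, hY⟩ := List.exists_cons_of_ne_nil (hlen s0).1
  change st s0 = F0 :: Y at hY
  have hpY : p = Y.length + 1 := by rw [← hp0, hY]; simp
  -- one step
  have hfr : ∀ s ≥ s0, ∀ X F, st s = X ++ F :: Y →
      (X = [] ∧ fV F <+: as s ∧ ¬ ready as Ok d s F ∧ st (s + 1) = F :: Y) ∨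
      (X = [] ∧ fV F <+: as s ∧ ready as Ok d s F ∧ ∃ b, st (s + 1) = chl as c m s b F ++ newF as c m s b F :: Y) ∨
      (∃ C, X = [C] ∧ pcd as Ok d s C ∧ st (s + 1) = upd F (fV C) (retD as s C) :: Y) ∨
      (∃ X1 C X2 C', X = X1 ++ [C] ∧ st (s + 1) = X2 ++ C' :: F :: Y ∧ fV C' = fV C ∧ fH C' = fH C) := by
    intro s hs X F h
    have hv : ¬ pcd as Ok d s F → fV F <+: as s := by
      intro h; by_contra hv; exact h (Or.inl hv)
    rcases mstep_frame (as := as) (Ok := Ok) (c := c) (m := m) (k := k) (d := d) s X F Y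
      (mst as Ok c m k d s).2 with ⟨-, -, h3⟩ | ⟨h1, h2, h3, h4⟩ | ⟨h1, h2, h3, h4⟩ | h1 | h1
    · exfalso
      rw [← hstep s X F Y h] at h3
      have h4 := hp1 (s + 1) (by omega)
      rw [h3, hpY] at h4
      cases Y with
      | nil => simp [popTo] at h4
      | cons P r => simp [popTo] at h4
    · left; exact ⟨h1, hv h2, h3, by rw [hstep s X F Y h, h4]⟩
    · right; left; rw [hstep s X F Y h]; exact ⟨h1, hv h2, h3, h4⟩
    · right; right; left; rw [hstep s X F Y h]; exact h1
    · right; right; right; rw [hstep s X F Y h]; exact h1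
  have hex : ∀ s ≥ s0, ∃ X F, st s = X ++ F :: Y ∧ fV F = fV F0 ∧ fE F = fE F0 := by
    intro s hs
    induction s, hs using Nat.le_induction with
    | base => exact ⟨[], F0, hY, rfl, rfl⟩
    | succ s hs ih =>
      obtain ⟨X, F, h, h1, h2⟩ := ih
      rcases hfr s hs X F h with ⟨-, -, -, h3⟩ | ⟨-, -, -, b, h3⟩ | ⟨C, -, -, h3⟩ | ⟨X1, C, X2, C', -, h3, -, -⟩
      · exact ⟨[], F, h3, h1, h2⟩
      · exact ⟨_, _, h3, h1, h2⟩
      · exact ⟨[], _, h3, h1, h2⟩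
      · exact ⟨X2 ++ [C'], F, by rw [h3]; simp, h1, h2⟩
  choose! Xf Ff hXF hFV hFE using hex
  have huniq : ∀ s ≥ s0, ∀ X F, st s = X ++ F :: Y → Xf s = X ∧ Ff s = F := by
    intro s hs X F h
    have h1 := hXF s hs
    rw [h] at h1
    have h2 : X.length = (Xf s).length := by
      have := congrArg List.length h1; simp at this; omega
    have h3 := List.append_inj h1 h2
    exact ⟨h3.1.symm, by have := h3.2; simp at this; exact this.symm⟩
  have hfr' := fun s (hs : s ≥ s0) => hfr s hs _ _ (hXF s hs)
  have hrev : ∀ s ≥ s0, (st s).reverse[Y.length]? = some (Ff s) := by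
    intro s hs
    rw [hXF s hs]
    simp
  set v0 := fV F0
  set a := fE F0 + m with ha
  set lw : ℕ → List Bool → ℝ := fun s v => WW (atv v (fL (Ff s))) with hlw
  set dw : ℕ → List Bool → ℝ := fun s v => WW (atv v (fD (Ff s))) with hdw
  -- total weight at `v` is monotone
  have hmono2 : ∀ v, ∀ s ≥ s0, lw s v + dw s v ≤ lw (s + 1) v + dw (s + 1) v := by
    intro v s hs
    rcases hfr' s hs with ⟨-, -, -, h3⟩ | ⟨-, -, -, b, h3⟩ | ⟨C, -, -, h3⟩ | ⟨X1, C, X2, C', -, h3, -, -⟩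
    · have := (huniq (s + 1) (by omega) [] _ h3).2
      simp only [hlw, hdw, this]; exact le_rfl
    · have := (huniq (s + 1) (by omega) _ _ h3).2
      simp only [hlw, hdw, this]
      change _ ≤ WW (atv v (iss as c m s b (Ff s) ++ lvv as s (Ff s))) + WW (atv v (dvv as s (Ff s)))
      unfold lvv dvv
      rw [atv_append, atv_append, WW_append, WW_append,
        ← WW_atv_le_of_split v (fun i => decide (i.1 <+: as s)) (fL (Ff s))]
      have := WW_nonneg (atv v (iss as c m s b (Ff s)))
      linarith
    · have := (huniq (s + 1) (by omega) [] _ h3).2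
      simp only [hlw, hdw, this]
      change _ ≤ WW (atv v (fL (Ff s) ++ (retD as s C).map _)) + WW (atv v (fD (Ff s)))
      rw [atv_append, WW_append]
      have := WW_nonneg (atv v ((retD as s C).map (fun i => (fV C, i.2))))
      linarith
    · have := (huniq (s + 1) (by omega) (X2 ++ [C']) (Ff s) (by rw [h3]; simp)).2
      simp only [hlw, hdw, this]; exact le_rfl
  have hmono2' : ∀ v, ∀ s ≥ s0, ∀ t ≥ s, lw s v + dw s v ≤ lw t v + dw t v := by
    intro v s hs t ht
    induction t, ht using Nat.le_induction with
    | base => exact le_rfl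
    | succ t ht ih => exact ih.trans (hmono2 v t (hs.trans ht))
  have hlvv : ∀ v s, v <+: as s → atv v (lvv as s (Ff s)) = atv v (fL (Ff s)) := by
    intro v s hv
    unfold atv lvv
    rw [List.filter_filter]
    apply List.filter_congr
    intro i _
    by_cases h : i.1 = v
    · simp [h, hv]
    · simp [h]
  have hmono3 : ∀ v, ∀ s ≥ s0, v <+: as s → lw s v ≤ lw (s + 1) v := by
    intro v s hs hv
    rcases hfr' s hs with ⟨-, -, -, h3⟩ | ⟨-, -, -, b, h3⟩ | ⟨C, -, -, h3⟩ | ⟨X1, C, X2, C', -, h3, -, -⟩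
    · have := (huniq (s + 1) (by omega) [] _ h3).2
      simp only [hlw, this]; exact le_rfl
    · have := (huniq (s + 1) (by omega) _ _ h3).2
      simp only [hlw, this]
      change _ ≤ WW (atv v (iss as c m s b (Ff s) ++ lvv as s (Ff s)))
      rw [atv_append, WW_append, hlvv v s hv]
      have := WW_nonneg (atv v (iss as c m s b (Ff s)))
      linarith
    · have := (huniq (s + 1) (by omega) [] _ h3).2
      simp only [hlw, this]
      change _ ≤ WW (atv v (fL (Ff s) ++ (retD as s C).map _))
      rw [atv_append, WW_append]
      have := WW_nonneg (atv v ((retD as s C).map (fun i => (fV C, i.2))))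
      linarith
    · have := (huniq (s + 1) (by omega) (X2 ++ [C']) (Ff s) (by rw [h3]; simp)).2
      simp only [hlw, this]; exact le_rfl
  have hmono3' : ∀ v, ∀ s ≥ s0, (∀ t ≥ s, v <+: as t) → ∀ t ≥ s, lw s v ≤ lw t v := by
    intro v s hs hv t ht
    induction t, ht using Nat.le_induction with
    | base => exact le_rfl
    | succ t ht ih => exact ih.trans (hmono3 v t (hs.trans ht) (hv t ht))
  have htop : ∀ s ≥ s0, (st s).length = p → Xf s = [] := by
    intro s hs h
    rw [hXF s hs, hpY] at h
    simp only [List.length_append, List.length_cons] at h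
    exact List.length_eq_zero_iff.1 (by omega)
  have hv0A : v0 = strPrefix A v0.length := by
    obtain ⟨s1, h1⟩ := has v0.length
    obtain ⟨s, hs, hsp⟩ := hp2 (max s0 s1)
    have hs0 : s ≥ s0 := le_trans (le_max_left _ _) hs
    have h2 : v0 <+: as s := by
      have := htop s hs0 hsp
      rw [← hFV s hs0]
      rcases hfr' s hs0 with ⟨-, h, -, -⟩ | ⟨-, h, -, -⟩ | ⟨C, h, -⟩ | ⟨X1, C, X2, C', h, -⟩
      · exact h
      · exact h
      · rw [this] at h; simp at h
      · rw [this] at h; simp at h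
    have h3 := h1 s (le_trans (le_max_right _ _) hs)
    have h4 := List.prefix_of_prefix_length_le h2 h3 (by rw [sp_length])
    exact h4.eq_of_length (by rw [sp_length])
  -- acting stages
  have hact : ∀ s1 ≥ s0, ∃ s2 ≥ s1, Xf s2 = [] ∧ ready as Ok d s2 (Ff s2) := by
    intro s1 hs1
    obtain ⟨s, hs, hsp⟩ := hp2 s1
    have hs0 : s ≥ s0 := le_trans hs1 hs
    by_contra hcon
    push Not at hcon
    have hst : ∀ t ≥ s, Xf t = [] ∧ Ff t = Ff s := by
      intro t ht
      induction t, ht using Nat.le_induction with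
      | base => exact ⟨htop s hs0 hsp, rfl⟩
      | succ t ht ih =>
        have hts : t ≥ s0 := hs0.trans ht
        rcases hfr' t hts with ⟨-, -, h, h'⟩ | ⟨-, -, h, -⟩ | ⟨C, h, -⟩ | ⟨X1, C, X2, C', h, -⟩
        · have := huniq (t + 1) (by omega) [] _ h'
          rw [this.1, this.2]; exact ⟨rfl, ih.2⟩
        · exact absurd h (hcon t (hs.trans ht) ih.1)
        · rw [ih.1] at h; simp at h
        · rw [ih.1] at h; simp at h
    have hev : ∀ᶠ t in Filter.atTop, ∀ i ∈ {i | i ∈ fL (Ff s)}, okI as Ok d t i := by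
      refine (Filter.eventually_all_finite (List.finite_toSet (fL (Ff s)))).2 ?_
      intro i hi
      have hFm : Ff s ∈ (mst as Ok c m k d s).1 := by
        have := hXF s hs0
        simp only [st] at this
        rw [this]; simp
      obtain ⟨t1, ht1⟩ := hreq s (Ff s) hFm i hi
      obtain ⟨t2, ht2⟩ := has i.2.2
      filter_upwards [Filter.eventually_ge_atTop t1, Filter.eventually_ge_atTop t2] with t h1 h2
      have h3 := ht2 t h2
      have h4 := h3.length_le
      rw [sp_length] at h4
      refine ⟨h4, ?_⟩
      have h5 := List.prefix_iff_eq_take.1 h3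
      rw [sp_length] at h5
      rw [← h5]
      exact ht1 t h1
    obtain ⟨t, ht, ht2⟩ := (hev.and (Filter.eventually_ge_atTop s)).exists
    obtain ⟨h1, h2⟩ := hst t ht2
    apply hcon t (hs.trans ht2) h1
    rw [h2]
    exact ht
  -- progress
  have hprog : ∀ l, v0.length < l → ∃ S ≥ s0, ∀ s ≥ S, (c (strPrefix A l) : ℝ) * (1 / 2) ^ (a + l) ≤ lw s (strPrefix A l) := by
    intro l
    induction l using Nat.strong_induction_on with
    | _ l ih =>
    intro hl
    set v := strPrefix A l with hv
    obtain ⟨S1, hS1, hS1s, hS1l, hS1c⟩ : ∃ S1 ≥ s0, (∀ s ≥ S1, v <+: as s) ∧ l < S1 ∧ ∀ s ≥ S1, ∀ l' < l, v0.length < l' →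
        (c (strPrefix A l') : ℝ) * (1 / 2) ^ (a + l') ≤ lw s (strPrefix A l') := by
      obtain ⟨s1, h1⟩ := has l
      choose! g hg0 hg using ih
      refine ⟨max (max s0 (l + 1)) (max s1 ((Finset.range l).sup g)), by simp, fun s hs => ?_, by simp, fun s hs l' hl' hl2 => ?_⟩
      · refine h1 s ?_; simp at hs; omega
      · refine hg l' hl' hl2 s ?_
        have := Finset.le_sup (f := g) (Finset.mem_range.2 hl')
        simp only [ge_iff_le, max_le_iff] at hs
        omega
    by_contra hcon
    push Not at hcon
    have hunc : ∀ s ≥ S1, lw s v < (c v : ℝ) * (1 / 2) ^ (a + l) := by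
      intro s hs
      obtain ⟨t, ht, h1⟩ := hcon s (hS1.trans hs)
      exact lt_of_le_of_lt (hmono3' v s (hS1.trans hs) (fun t ht => hS1s t (hs.trans ht)) t ht) h1
    have hpos : (0 : ℝ) < (1 / 2) ^ (a + l) := by positivity
    have key : ∀ i : ℕ, ∃ s ≥ S1, (i : ℝ) * (1 / 2) ^ (a + l) ≤ lw s v := by
      intro i
      induction i with
      | zero => exact ⟨S1, le_rfl, by simpa using WW_nonneg _⟩
      | succ i ih =>
        obtain ⟨s, hs, hi⟩ := ih
        obtain ⟨s2, hs2, hX, hr⟩ := hact s (hS1.trans hs)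
        have hs2S : s2 ≥ S1 := hs.trans hs2
        have hs20 : s2 ≥ s0 := hS1.trans hs2S
        have hi2 : (i : ℝ) * (1 / 2) ^ (a + l) ≤ lw s2 v :=
          hi.trans (hmono3' v s (hS1.trans hs) (fun t ht => hS1s t (hs.trans ht)) s2 hs2)
        have hvs := hS1s s2 hs2S
        have htk : ∀ l' ≤ l, (as s2).take l' = strPrefix A l' := by
          intro l' hl'
          have h1 := (sp_mono A hl').trans hvs
          have h2 := List.prefix_iff_eq_take.1 h1
          rw [sp_length] at h2
          exact h2.symm
        have hll : l ≤ (as s2).length := by have := hvs.length_le; rwa [hv, sp_length] at this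
        have hfnd : fnd as c m s2 (Ff s2) = some l := by
          unfold fnd
          rw [List.find?_range_eq_some]
          refine ⟨?_, by simp; omega, ?_⟩
          · simp only [decide_eq_true_eq]
            refine ⟨by rw [hFV s2 hs20]; exact hl, hll, ?_⟩
            rw [wlt_iff, htk l le_rfl, hlvv _ _ hvs, hFE s2 hs20]
            exact hunc s2 hs2S
          · intro l' hl'
            simp only [Bool.not_eq_true', decide_eq_false_iff_not]
            rintro ⟨h1, h2, h3⟩
            rw [hFV s2 hs20] at h1
            rw [wlt_iff, htk l' hl'.le, hlvv _ _ ((sp_mono A hl'.le).trans hvs), hFE s2 hs20] at h3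
            have := hS1c s2 hs2S l' hl' h1
            exact absurd h3 (not_lt.2 this)
        rcases hfr' s2 hs20 with ⟨-, -, h, -⟩ | ⟨-, -, -, b, h⟩ | ⟨C, h, -⟩ | ⟨X1, C, X2, C', h, -⟩
        · exact absurd hr h
        · cases b with
          | false =>
            have h1 := (huniq (s2 + 1) (by omega) _ _ h).2
            refine ⟨s2 + 1, by omega, ?_⟩
            simp only [hlw, h1]
            change _ ≤ WW (atv v (iss as c m s2 false (Ff s2) ++ lvv as s2 (Ff s2)))
            have e1 : atv v (iss as c m s2 false (Ff s2)) = [(v, fE (Ff s2) + m + l, s2)] := by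
              simp [iss, hfnd, htk l le_rfl, atv, hv]
            have e2 : WW [(v, fE (Ff s2) + m + l, s2)] = (1 / 2) ^ (a + l) := by
              simp [WW, SS, wφ, hFE s2 hs20, ha]
            rw [atv_append, WW_append, hlvv _ _ hvs, e1, e2]
            push_cast
            have : (i : ℝ) * (1 / 2) ^ (a + l) ≤ WW (atv v (fL (Ff s2))) := hi2
            linarith
          | true =>
            have e1 : chl as c m s2 true (Ff s2) = [(v, a + l, a + l + fJ (Ff s2), 0, [], [])] := by
              simp [chl, hfnd, htk l le_rfl, hv, hFE s2 hs20, ha]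
            have e3 : iss as c m s2 true (Ff s2) = [] := by simp [iss, hfnd]
            set G := newF as c m s2 true (Ff s2) with hG
            have e2 : (i : ℝ) * (1 / 2) ^ (a + l) ≤ WW (atv v (fL G)) := by
              change _ ≤ WW (atv v (iss as c m s2 true (Ff s2) ++ lvv as s2 (Ff s2)))
              rw [e3, List.nil_append, hlvv _ _ hvs]
              exact hi2
            rw [e1] at h
            have claim : ∀ s ≥ s2 + 1, (∃ X C, st s = X ++ C :: G :: Y ∧ fV C = v ∧ fH C = a + l) ∨
                ∃ s' ≥ S1, ((i + 1 : ℕ) : ℝ) * (1 / 2) ^ (a + l) ≤ lw s' v := by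
              intro t ht
              induction t, ht using Nat.le_induction with
              | base => left; exact ⟨[], _, h, rfl, rfl⟩
              | succ t ht ih =>
                rcases ih with ⟨X, C, h1, h2, h3⟩ | h1
                swap
                · exact Or.inr h1
                have hts0 : t ≥ s0 := by omega
                rcases hfr t hts0 (X ++ [C]) G (by rw [h1]; simp) with ⟨h, -⟩ | ⟨h, -⟩ | ⟨C1, h4, h5, h6⟩ |
                  ⟨X1, C1, X2, C', h4, h5, h6, h7⟩
                · simp at h
                · simp at h
                · right
                  have hC : C1 = C := by
                    have := List.append_inj' (t₁ := [C]) (s₂ := []) (t₂ := [C1]) h4 rfl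
                    simpa using this.2.symm
                  subst hC
                  have hvt : v <+: as t := hS1s t (by omega)
                  have h8 : ¬ wlt (dvv as t C1) 1 (fH C1) := by
                    rcases h5 with h | h
                    · rw [h2] at h; exact absurd hvt h
                    · exact h.2
                  rw [wlt_iff, h3, Nat.cast_one, one_mul, not_lt] at h8
                  have h9 : retD as t C1 = dvv as t C1 := by rw [retD, if_pos (by rw [h2]; exact hvt)]
                  refine ⟨t + 1, by omega, ?_⟩
                  have h10 := (huniq (t + 1) (by omega) [] _ h6).2
                  simp only [hlw, h10]
                  change _ ≤ WW (atv v (fL G ++ (retD as t C1).map (fun i => (fV C1, i.2))))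
                  have h11 : atv v ((retD as t C1).map (fun i => (fV C1, i.2))) =
                      (retD as t C1).map (fun i => (fV C1, i.2)) := by
                    unfold atv; rw [List.filter_eq_self]
                    intro i hi
                    obtain ⟨j, -, rfl⟩ := List.mem_map.1 hi
                    simpa using h2
                  have h12 : WW ((retD as t C1).map (fun i => (fV C1, i.2))) = WW (retD as t C1) :=
                    SS_retag wφ (fV C1) _
                  rw [atv_append, WW_append, h11, h12, h9]
                  push_cast
                  linarith
                · left
                  have hC : C1 = C := by
                    have := List.append_inj' (t₁ := [C]) (t₂ := [C1]) h4 rfl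
                    simpa using this.2.symm
                  subst hC
                  exact ⟨X2, C', h5, h6.trans h2, h7.trans h3⟩
            obtain ⟨t, ht, htp⟩ := hp2 (s2 + 1)
            rcases claim t ht with ⟨X, C, h1, -⟩ | h1
            · rw [h1, hpY] at htp
              simp only [List.length_append, List.length_cons] at htp
              omega
            · exact h1
        · rw [hX] at h; simp at h
        · rw [hX] at h; simp at h
    obtain ⟨s, hs, h⟩ := key (c v)
    exact absurd (hunc s hs) (not_lt.2 h)
  refine ⟨s0, Y.length, a, v0.length, ?_, ?_⟩
  · intro l hl
    obtain ⟨S, hS, h⟩ := hprog l hl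
    refine ⟨S, hS, Ff S, hrev S hS, ?_⟩
    rw [wlt_iff, not_lt]
    exact h S le_rfl
  · intro S hS
    choose! g hg0 G hG hGw using hS
    have h1 : ∀ v ∈ S, (c v : ℝ) * (1 / 2) ^ (a + v.length) ≤ lw (s0 + S.sup g) v + dw (s0 + S.sup g) v := by
      intro v hv
      have h2 := hrev (g v) (hg0 v hv)
      have h3 := hG v hv
      rw [h2, Option.some_inj] at h3
      have h4 := hGw v hv
      rw [wlt_iff, not_lt, ← h3] at h4
      have h5 := hmono2' v (g v) (hg0 v hv) (s0 + S.sup g) (by have := Finset.le_sup (f := g) hv; omega)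
      have h6 : 0 ≤ dw (g v) v := WW_nonneg _
      have h7 : (c v : ℝ) * (1 / 2) ^ (a + v.length) ≤ lw (g v) v := h4
      linarith
    refine (Finset.sum_le_sum h1).trans ?_
    rw [Finset.sum_add_distrib]
    have h2 := sum_atv_le S (fL (Ff (s0 + S.sup g)))
    have h3 := sum_atv_le S (fD (Ff (s0 + S.sup g)))
    have h4 := hW (s0 + S.sup g) (Ff (s0 + S.sup g)) (by
      have := hXF (s0 + S.sup g) (by omega)
      simp only [st] at this
      rw [this]; simp)
    exact (add_le_add h2 h3).trans h4

theorem mstep_req (as : ℕ → List Bool) (Ok : (ℕ × ℕ) × ℕ → Bool) (c : List Bool → ℕ) (m k d s : ℕ)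
    (x : List Frame × List Item) : x.2 ⊆ (mstep as Ok c m k d s x).2 := by
  obtain ⟨_ | ⟨F, rest⟩, rq⟩ := x
  · intro i hi; exact hi
  · rw [mstep_cons]; exact List.subset_append_right _ _

theorem mst_req (as : ℕ → List Bool) (Ok : (ℕ × ℕ) × ℕ → Bool) (c : List Bool → ℕ) (m k d : ℕ) {s t : ℕ}
    (h : s ≤ t) : (mst as Ok c m k d s).2 ⊆ (mst as Ok c m k d t).2 := by
  induction t, h using Nat.le_induction with
  | base => exact List.Subset.refl _
  | succ t ht ih => rw [mst_succ]; exact fun i hi => mstep_req _ _ _ _ _ _ _ _ (ih hi)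

theorem wtf_list_le {α β : Type} (r : β → ℕ) (f : α → β) (l : List α) :
    wtf r {y | ∃ i ∈ l, y = f i} ≤ (l.map fun i => (2⁻¹ : ℝ≥0∞) ^ r (f i)).sum := by
  induction l with
  | nil => simp [wtf]
  | cons i l ih =>
    have : {y | ∃ j ∈ i :: l, y = f j} ⊆ (({f i} : Finset β) : Set β) ∪ {y | ∃ j ∈ l, y = f j} := by
      rintro y ⟨j, hj, rfl⟩
      rcases List.mem_cons.1 hj with rfl | h
      · left; simp
      · right; exact ⟨j, h, rfl⟩
    refine (wtf_mono r this).trans ((wtf_union _ _ _).trans ?_)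
    rw [List.map_cons, List.sum_cons, wtf_finset, Finset.sum_singleton]
    exact add_le_add le_rfl ih

theorem wtf_directed {β : Type} (r : β → ℕ) (S : ℕ → Set β) (hS : Monotone S) (C : ℝ≥0∞)
    (h : ∀ s, wtf r (S s) ≤ C) : wtf r (⋃ s, S s) ≤ C := by
  classical
  apply wtf_le_of_finset
  intro F hF
  have : ∃ s, (F : Set β) ⊆ S s := by
    have h1 : ∀ x ∈ F, ∃ s, x ∈ S s := fun x hx => by simpa using hF hx
    choose! g hg using h1
    exact ⟨F.sup g, fun x hx => hS (Finset.le_sup (f := g) hx) (hg x hx)⟩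
  obtain ⟨s, hs⟩ := this
  rw [← wtf_finset]
  exact (wtf_mono r hs).trans (h s)

theorem mem_totW {m : ℕ} {st : List Frame} {F : Frame} (h : F ∈ st) : WW (fL F) + WW (fD F) ≤ totW m st := by
  have h0 : ∀ G : Frame, 0 ≤ WW (fL G) + WW (fD G) + tau m G := fun G =>
    add_nonneg (add_nonneg (WW_nonneg _) (WW_nonneg _)) (Finset.sum_nonneg fun _ _ => by positivity)
  have h1 : ∀ st : List Frame, 0 ≤ totW m st := by
    intro st
    exact List.sum_nonneg (by intro x hx; obtain ⟨G, -, rfl⟩ := List.mem_map.1 hx; exact h0 G)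
  have h2 : ∀ G : Frame, 0 ≤ tau m G := fun G => Finset.sum_nonneg fun _ _ => by positivity
  induction st with
  | nil => simp at h
  | cons G st ih =>
    rw [totW_cons]
    rcases List.mem_cons.1 h with rfl | h
    · have := h1 st; have := h2 F; linarith
    · have := ih h; have := h0 G; linarith

theorem golden {A : ℕ → Bool} (hA : KTrivial A) {c : List Bool → ℕ} (hc : Primrec c) {M : ℕ}
    (hM : ∀ w : List Bool, ∑ t ∈ Finset.range w.length, (c (w.take (t + 1)) : ℝ) * (1 / 2) ^ (t + 1) ≤ M) :
    ∃ Cert : List Bool → Prop, REPred Cert ∧ (∃ l0, ∀ l > l0, Cert (strPrefix A l)) ∧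
      ∃ B : ℝ, ∀ S : Finset (List Bool), (∀ v ∈ S, Cert v) → ∑ v ∈ S, (c v : ℝ) * (1 / 2) ^ v.length ≤ B := by
  obtain ⟨as, has, hasA⟩ := kt_approx hA
  obtain ⟨b, hb⟩ := kt_Okp hA
  obtain ⟨Ok, -, hOk, hmono, -, -, -, hOkp⟩ := exists_Ok
  have hOk' : ∀ q x s, Ok ((q, x), s) = true → Okp q x := fun q x s h => (hOkp q x).1 ⟨s, h⟩
  obtain ⟨R, hR⟩ := exists_pow_ge Rset_wt
  set m := M + 2 with hm0
  have hm : M + 2 ≤ 2 ^ m := Nat.lt_two_pow_self.le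
  set kk : ℕ → ℕ := fun d => 2 ^ (2 * d + R) + 1 with hkk
  have hkp : Primrec kk := by rw [hkk]; fun_prop
  have hInv : ∀ d s, MInv c m (kk d) d s (mst as Ok c m (kk d) d s) := fun d s =>
    Inv_mst hOk' hM hm hR (by simp [hkk]) s
  have hp := pr_mst (as := as) (Ok := Ok) (c := c) (kk := kk) m has hOk hc hkp
  let Ld : ℕ → ℕ → Set (ℕ × ℕ) := fun d s =>
    {x | ∃ i ∈ (mst as Ok c m (kk d) d s).2, x = (i.2.1 + (d + 1), one i.2.2)}
  have hLd : ∀ d s, wtf Prod.fst (Ld d s) ≤ ENNReal.ofReal 6 * 2⁻¹ ^ (d + 1) := by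
    intro d s
    refine (wtf_list_le Prod.fst (fun i : Item => (i.2.1 + (d + 1), one i.2.2)) _).trans ?_
    have h1 := ENNReal.ofReal_le_ofReal (Inv_rq hM hm (hInv d s))
    rw [WW_ofReal] at h1
    refine le_trans (le_of_eq ?_) (mul_le_mul_left h1 _)
    rw [← List.sum_map_mul_right]
    simp [pow_add]
  let Lp : ℕ × ℕ → Prop := fun x => ∃ y : ℕ × ℕ, ∃ i ∈ (mst as Ok c m (kk y.1) y.1 y.2).2,
    x = (i.2.1 + (y.1 + 1), one i.2.2)
  have hLre : REPred Lp := by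
    have h1 : Primrec fun z : (ℕ × ℕ) × (ℕ × ℕ) => mst as Ok c m (kk z.2.1) z.2.1 z.2.2 := hp.comp Primrec.snd
    unfold Lp
    apply re_ex
    apply re_of_pp
    fun_prop
  have hLw : wtf Prod.fst {x | Lp x} < ⊤ := by
    have h1 : {x | Lp x} ⊆ ⋃ d, ⋃ s, Ld d s := by
      rintro x ⟨⟨d, s⟩, h⟩
      exact Set.mem_iUnion.2 ⟨d, Set.mem_iUnion.2 ⟨s, h⟩⟩
    refine lt_of_le_of_lt ((wtf_mono _ h1).trans ((wtf_iUnion _ _).trans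
      (ENNReal.tsum_le_tsum fun d => wtf_directed _ (Ld d) ?_ _ (hLd d)))) ?_
    · rintro s t hst x ⟨i, hi, hx⟩
      exact ⟨i, mst_req as Ok c m (kk d) d hst hi, hx⟩
    · rw [ENNReal.tsum_mul_left]
      simp only [pow_succ]
      rw [ENNReal.tsum_mul_right, tsum_geom]
      exact ENNReal.mul_lt_top (by simp) (ENNReal.mul_lt_top (by simp) (by simp))
  obtain ⟨C, hC⟩ := kraft hLre hLw
  set d := 1 + C + b with hd
  obtain ⟨s0, p, a, l0, h1, h2⟩ := golden_abs (as := as) (Ok := Ok) (c := c) (m := m) (k := kk d) (d := d) (A := A)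
    (fun s => by
      obtain ⟨F, rest, hx, -, -, hl⟩ := (hInv d s).ne
      rw [hx]; exact ⟨by simp, by simpa using hl⟩)
    (fun s F hF => by
      obtain ⟨F0, rest, hx, h1, h2, hl⟩ := (hInv d s).ne
      have h3 := totW_le hM hm (by omega) rest F0 _ h1 h2
      have h4 := mem_totW (m := m) hF
      rw [hx] at h4
      have : (0 : ℝ) ≤ (1 / 2) ^ (fE F0) := by positivity
      linarith)
    hasA
    (fun s F hF i hi => by
      have h1 := (hInv d s).mem F hF i (List.mem_append_left _ hi)
      obtain ⟨j, hj, hji⟩ := List.mem_map.1 h1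
      have h2 : Lp (j.2.1 + (d + 1), one j.2.2) := ⟨(d, s), j, hj, rfl⟩
      have h3 := hb j.2.2 _ (Okp_K (hC _ _ h2))
      rw [hji] at h3
      have h4 : Okp (i.2.1 + 2 * d) (Encodable.encode (strPrefix A i.2.2)) := Okp_mono (by omega) h3
      obtain ⟨t, ht⟩ := (hOkp _ _).2 h4
      exact ⟨t, fun t' ht' => hmono _ _ _ _ ht' ht⟩)
  refine ⟨fun v => ∃ s ≥ s0, ∃ F, (mst as Ok c m (kk d) d s).1.reverse[p]? = some F ∧
      ¬ wlt (atv v (fL F)) (c v) (a + v.length), ?_, ⟨l0, fun l hl => ?_⟩, 6 * 2 ^ a, ?_⟩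
  · have h3 : Primrec fun z : (List Bool × ℕ) × Frame => mst as Ok c m (kk d) d z.1.2 :=
      hp.comp (by fun_prop : Primrec (fun z : (List Bool × ℕ) × Frame => (d, z.1.2)))
    apply re_ex
    refine re_and (by fun_prop) ?_
    apply re_ex
    apply re_of_pp
    unfold wlt atv fL
    fun_prop
  · obtain ⟨s, hs, F, hF, hw⟩ := h1 l hl
    exact ⟨s, hs, F, hF, by rwa [sp_length]⟩
  · intro S hS
    have := h2 S hS
    have h3 : ∑ v ∈ S, (c v : ℝ) * (1 / 2) ^ v.length = (∑ v ∈ S, (c v : ℝ) * (1 / 2) ^ (a + v.length)) * 2 ^ a := by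
      rw [Finset.sum_mul]
      refine Finset.sum_congr rfl fun v _ => ?_
      rw [pow_add]
      have : (1 / 2 : ℝ) ^ a * 2 ^ a = 1 := by rw [← mul_pow]; norm_num
      linear_combination -(c v : ℝ) * (1 / 2) ^ v.length * this
    rw [h3]
    exact mul_le_mul_of_nonneg_right this (by positivity)

section LKsec
variable (g : List Bool × ℕ → Bool) (r : ℕ → ℕ)

def LfL (v : List Bool) : List ℕ := (List.range (v.length + 1)).filter fun x => decide (r x ≤ v.length ∧ g (v, x) = true)
def NewL (v : List Bool) : List ℕ := (LfL g r v).filter fun x => decide (¬ ∃ y ∈ LfL g r v.dropLast, y = x)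
def cLK (v : List Bool) : ℕ := ((NewL g r v).map fun x => 2 ^ (v.length - r x)).sum
def okLK (M : ℕ) (v : List Bool) : Prop :=
  ((List.range v.length).map fun t => cLK g r (v.take (t + 1)) * 2 ^ (v.length - (t + 1))).sum ≤ M * 2 ^ v.length

variable {g r}
theorem pr_LfL (hg : Primrec g) (hr : Primrec r) : Primrec (LfL g r) := by unfold LfL; fun_prop
theorem pr_NewL (hg : Primrec g) (hr : Primrec r) : Primrec (NewL g r) := by
  have := pr_LfL hg hr
  unfold NewL; fun_prop
theorem pr_cLK (hg : Primrec g) (hr : Primrec r) : Primrec (cLK g r) := by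
  have := pr_NewL hg hr
  unfold cLK; fun_prop
theorem pr_okLK (hg : Primrec g) (hr : Primrec r) (M : ℕ) : PrimrecPred (okLK g r M) := by
  have := pr_cLK hg hr
  unfold okLK; fun_prop

theorem cLK_real (v : List Bool) : (cLK g r v : ℝ) * (1 / 2) ^ v.length =
    ∑ x ∈ (NewL g r v).toFinset, (1 / 2 : ℝ) ^ r x := by
  have hnd : (NewL g r v).Nodup := (List.nodup_range.filter _).filter _
  rw [List.sum_toFinset _ hnd]
  have hr : ∀ x ∈ NewL g r v, r x ≤ v.length := by
    intro x hx
    have h1 := List.mem_of_mem_filter hx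
    have h2 := List.of_mem_filter h1
    simp only [decide_eq_true_eq] at h2
    exact h2.1
  unfold cLK
  generalize NewL g r v = l at hr
  induction l with
  | nil => simp
  | cons x l ih =>
    simp only [List.map_cons, List.sum_cons]
    rw [← ih (fun y hy => hr y (List.mem_cons_of_mem _ hy))]
    have h1 := hr x (by simp)
    push_cast
    rw [add_mul]
    congr 1
    obtain ⟨j, hj⟩ := Nat.exists_eq_add_of_le h1
    · rw [hj, Nat.add_sub_cancel_left, pow_add]
      have : (2 : ℝ) ^ j * (1 / 2) ^ j = 1 := by rw [← mul_pow]; norm_num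
      linear_combination (1 / 2 : ℝ) ^ (r x) * this

theorem okLK_iff (M : ℕ) (v : List Bool) : okLK g r M v ↔
    ∑ t ∈ Finset.range v.length, (cLK g r (v.take (t + 1)) : ℝ) * (1 / 2) ^ (t + 1) ≤ M := by
  unfold okLK
  have h1 : ((List.range v.length).map fun t => cLK g r (v.take (t + 1)) * 2 ^ (v.length - (t + 1))).sum =
      ∑ t ∈ Finset.range v.length, cLK g r (v.take (t + 1)) * 2 ^ (v.length - (t + 1)) := by
    rw [← List.toFinset_range, List.sum_toFinset _ List.nodup_range]
  rw [h1]
  have h2 : ((∑ t ∈ Finset.range v.length, cLK g r (v.take (t + 1)) * 2 ^ (v.length - (t + 1)) : ℕ) : ℝ) =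
      (∑ t ∈ Finset.range v.length, (cLK g r (v.take (t + 1)) : ℝ) * (1 / 2) ^ (t + 1)) * 2 ^ v.length := by
    push_cast
    rw [Finset.sum_mul]
    refine Finset.sum_congr rfl fun t ht => ?_
    have ht := Finset.mem_range.1 ht
    obtain ⟨j, hj⟩ := Nat.exists_eq_add_of_le (show t + 1 ≤ v.length from ht)
    rw [hj, Nat.add_sub_cancel_left, pow_add _ (t + 1) j]
    have : (1 / 2 : ℝ) ^ (t + 1) * 2 ^ (t + 1) = 1 := by rw [← mul_pow]; norm_num
    linear_combination -(cLK g r (v.take (t + 1)) : ℝ) * 2 ^ j * this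
  rw [← Nat.cast_le (α := ℝ), h2]
  push_cast
  exact mul_le_mul_iff_left₀ (by positivity)

theorem LK_nat {A : ℕ → Bool} (hA : KTrivial A) {L : ℕ → Prop} {r : ℕ → ℕ} (hr : Primrec r) (hL : Sig A L)
    (hw : wtf r {x | L x} < ⊤) : ∃ L' : ℕ → Prop, REPred L' ∧ (∀ x, L x → L' x) ∧ wtf r {x | L' x} < ⊤ := by
  classical
  obtain ⟨g, hg, hgm, hgL⟩ := hL
  obtain ⟨M0, hM0⟩ := exists_pow_ge hw
  set M := 2 ^ M0 with hMd
  set c : List Bool → ℕ := fun v => if okLK g r M v then cLK g r v else 0 with hcd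
  have hc0 := pr_cLK hg hr
  have hok := pr_okLK hg hr M
  have hN := pr_NewL hg hr
  have hLf := pr_LfL hg hr
  have hc : Primrec c := by rw [hcd]; fun_prop
  have hle : ∀ v, (c v : ℝ) ≤ cLK g r v := by
    intro v; simp only [hcd]; split_ifs <;> simp
  have hM : ∀ w : List Bool, ∑ t ∈ Finset.range w.length, (c (w.take (t + 1)) : ℝ) * (1 / 2) ^ (t + 1) ≤ (M : ℕ) := by
    intro w
    have : ∀ n ≤ w.length, ∑ t ∈ Finset.range n, (c (w.take (t + 1)) : ℝ) * (1 / 2) ^ (t + 1) ≤ (M : ℕ) := by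
      intro n
      induction n with
      | zero => simp
      | succ n ih =>
        intro hn
        by_cases h : okLK g r M (w.take (n + 1))
        · have h1 := (okLK_iff M _).1 h
          rw [List.length_take, min_eq_left hn] at h1
          refine le_trans (Finset.sum_le_sum fun t ht => ?_) h1
          have ht := Finset.mem_range.1 ht
          rw [List.take_take, min_eq_left (by omega)]
          exact mul_le_mul_of_nonneg_right (hle _) (by positivity)
        · rw [Finset.sum_range_succ]
          have : c (w.take (n + 1)) = 0 := by simp only [hcd, if_neg h]
          rw [this]
          simpa using ih (by omega)
    exact this _ le_rfl
  obtain ⟨Cert, hCre, ⟨l0, hl0⟩, B, hB⟩ := golden hA hc hM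
  have mem_Lf : ∀ v x, x ∈ LfL g r v ↔ x ≤ v.length ∧ r x ≤ v.length ∧ g (v, x) = true := by
    intro v x; simp [LfL]
  have mem_New : ∀ v x, x ∈ NewL g r v ↔ x ∈ LfL g r v ∧ x ∉ LfL g r v.dropLast := by
    intro v x; simp [NewL]
  have Lf_mono : ∀ {m n}, m ≤ n → ∀ x, x ∈ LfL g r (strPrefix A m) → x ∈ LfL g r (strPrefix A n) := by
    intro m n hmn x hx
    rw [mem_Lf, sp_length] at hx ⊢
    exact ⟨by omega, by omega, hgm _ _ _ (sp_mono A hmn) hx.2.2⟩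
  have hdl : ∀ n, (strPrefix A (n + 1)).dropLast = strPrefix A n := by
    intro n; rw [sp_succ]; simp
  have hLfL : ∀ n x, x ∈ LfL g r (strPrefix A n) → L x := by
    intro n x hx
    rw [mem_Lf] at hx
    exact (hgL x).2 ⟨n, hx.2.2⟩
  have hsum : ∀ n, ∑ t ∈ Finset.range n, (cLK g r (strPrefix A (t + 1)) : ℝ) * (1 / 2) ^ (t + 1) ≤
      ∑ x ∈ (LfL g r (strPrefix A n)).toFinset, (1 / 2 : ℝ) ^ r x := by
    intro n
    induction n with
    | zero => simp; positivity
    | succ n ih =>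
      rw [Finset.sum_range_succ]
      have h1 := cLK_real (g := g) (r := r) (strPrefix A (n + 1))
      rw [sp_length] at h1
      rw [h1]
      refine (add_le_add ih le_rfl).trans ?_
      rw [← Finset.sum_union]
      · refine Finset.sum_le_sum_of_subset_of_nonneg ?_ (fun _ _ _ => by positivity)
        intro x hx
        rcases Finset.mem_union.1 hx with hx | hx
        · exact List.mem_toFinset.2 (Lf_mono (Nat.le_succ n) x (List.mem_toFinset.1 hx))
        · exact List.mem_toFinset.2 ((mem_New _ _).1 (List.mem_toFinset.1 hx)).1
      · rw [Finset.disjoint_left]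
        intro x hx hx'
        have := ((mem_New _ _).1 (List.mem_toFinset.1 hx')).2
        rw [hdl] at this
        exact this (List.mem_toFinset.1 hx)
  have hconv : ∀ F : Finset ℕ, (∑ x ∈ F, (2⁻¹ : ℝ≥0∞) ^ r x) = ENNReal.ofReal (∑ x ∈ F, (1 / 2 : ℝ) ^ r x) := by
    intro F
    rw [ENNReal.ofReal_sum_of_nonneg (fun _ _ => by positivity)]
    refine Finset.sum_congr rfl fun x _ => ?_
    rw [ENNReal.ofReal_pow (by norm_num), one_div, ENNReal.ofReal_inv_of_pos (by norm_num)]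
    simp
  have hokA : ∀ n, okLK g r M (strPrefix A n) := by
    intro n
    rw [okLK_iff, sp_length]
    have h1 : ∀ t ∈ Finset.range n, (cLK g r ((strPrefix A n).take (t + 1)) : ℝ) * (1 / 2) ^ (t + 1) =
        (cLK g r (strPrefix A (t + 1)) : ℝ) * (1 / 2) ^ (t + 1) := by
      intro t ht
      have ht := Finset.mem_range.1 ht
      rw [sp_take, min_eq_left (by omega)]
    rw [Finset.sum_congr rfl h1]
    refine (hsum n).trans ?_
    have h2 : ENNReal.ofReal (∑ x ∈ (LfL g r (strPrefix A n)).toFinset, (1 / 2 : ℝ) ^ r x) ≤ ENNReal.ofReal M := by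
      rw [← hconv, ← wtf_finset]
      refine (wtf_mono r ?_).trans (hM0.trans ?_)
      · intro x hx
        exact hLfL n x (by simpa using hx)
      · simp [hMd]
    exact (ENNReal.ofReal_le_ofReal_iff (by positivity)).1 h2
  let L1 : ℕ → Prop := fun x => ∃ v, Cert v ∧ (okLK g r M v ∧ ∃ y ∈ NewL g r v, y = x)
  let L2 : ℕ → Prop := fun x => ∃ y ∈ LfL g r (strPrefix A l0), y = x
  refine ⟨fun x => L1 x ∨ L2 x, ?_, ?_, ?_⟩
  · refine re_or ?_ ?_
    · unfold L1
      apply re_ex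
      have hok2 : PrimrecPred (fun x : ℕ × List Bool => okLK g r M x.2) := hok.comp Primrec.snd
      refine re_and (re_comp hCre (by fun_prop)) (re_of_pp (by fun_prop))
    · apply re_of_pp; unfold L2; fun_prop
  · intro x hx
    have hex : ∃ n, x ∈ LfL g r (strPrefix A n) := by
      obtain ⟨n, hn⟩ := (hgL x).1 hx
      refine ⟨max n (max x (r x)), ?_⟩
      rw [mem_Lf, sp_length]
      exact ⟨by omega, by omega, hgm _ _ _ (sp_mono A (le_max_left _ _)) hn⟩
    have h1 := Nat.find_spec hex
    rcases Nat.lt_or_ge l0 (Nat.find hex) with h | h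
    · left
      refine ⟨_, hl0 _ h, hokA _, x, ?_, rfl⟩
      rw [mem_New]
      refine ⟨h1, ?_⟩
      obtain ⟨j, hj⟩ : ∃ j, Nat.find hex = j + 1 := ⟨_, (Nat.succ_pred_eq_of_pos (by omega)).symm⟩
      rw [hj, hdl]
      exact Nat.find_min hex (by omega)
    · right
      exact ⟨x, Lf_mono h x h1, rfl⟩
  · have h1 : {x | L1 x ∨ L2 x} = {x | L1 x} ∪ {x | L2 x} := rfl
    rw [h1]
    refine lt_of_le_of_lt (wtf_union _ _ _) (ENNReal.add_lt_top.2 ⟨?_, ?_⟩)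
    · refine lt_of_le_of_lt (wtf_le_of_finset r (C := ENNReal.ofReal B) ?_) (by simp)
      intro F hF
      rw [hconv]
      apply ENNReal.ofReal_le_ofReal
      have h2 : ∀ x ∈ F, ∃ v, Cert v ∧ okLK g r M v ∧ x ∈ NewL g r v := by
        intro x hx
        obtain ⟨v, h2, h3, y, h4, rfl⟩ := hF hx
        exact ⟨v, h2, h3, h4⟩
      choose! V hV1 hV2 hV3 using h2
      rw [← Finset.sum_fiberwise_of_maps_to (g := V) (t := F.image V) (fun x hx => Finset.mem_image_of_mem V hx)]
      refine le_trans (Finset.sum_le_sum fun v hv => ?_) (hB (F.image V) ?_)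
      · obtain ⟨x, hx, rfl⟩ := Finset.mem_image.1 hv
        have : c (V x) = cLK g r (V x) := by simp only [hcd, if_pos (hV2 x hx)]
        rw [this, cLK_real]
        refine Finset.sum_le_sum_of_subset_of_nonneg ?_ (fun _ _ _ => by positivity)
        intro y hy
        rw [Finset.mem_filter] at hy
        rw [List.mem_toFinset, ← hy.2]
        exact hV3 y hy.1
      · intro v hv
        obtain ⟨x, hx, rfl⟩ := Finset.mem_image.1 hv
        exact hV1 x hx
    · apply wtf_finite
      refine Set.Finite.subset (List.finite_toSet (LfL g r (strPrefix A l0))) ?_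
      rintro x ⟨y, hy, rfl⟩; exact hy

theorem LK {A : ℕ → Bool} (hA : KTrivial A) {α : Type} [Primcodable α] {L : α → Prop} {r : α → ℕ} (hr : Primrec r)
    (hL : Sig A L) (hw : wtf r {x | L x} < ⊤) :
    ∃ L' : α → Prop, REPred L' ∧ (∀ x, L x → L' x) ∧ wtf r {x | L' x} < ⊤ := by
  set r0 : ℕ → ℕ := fun n => ((Encodable.decode n : Option α).map r).getD 0 with hr0
  have h1 : Primrec r0 := by rw [hr0]; fun_prop
  have h2 : Sig A (fun n : ℕ => ∃ x : α, L x ∧ Encodable.encode x = n) := by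
    apply sig_ex
    exact sig_and (sig_comp hL (by fun_prop)) (by fun_prop)
  obtain ⟨L', h3, h4, h5⟩ := LK_nat hA h1 h2 (by
    refine lt_of_le_of_lt ?_ hw
    refine le_trans (wtf_mono _ ?_) (wtf_image_le r r0 Encodable.encode {x | L x} (fun x _ => by simp [hr0]))
    rintro n ⟨x, hx, rfl⟩
    exact ⟨x, hx, rfl⟩)
  refine ⟨fun x => L' (Encodable.encode x), re_comp h3 (by fun_prop), fun x hx => h4 _ ⟨x, hx, rfl⟩, ?_⟩
  refine lt_of_le_of_lt (wtf_inj_le r r0 Encodable.encode _ _ Encodable.encode_injective.injOn (fun x hx => hx) ?_) h5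
  intro x _
  simp [hr0]

end LKsec

theorem e2 (k : ℕ) : (2⁻¹ : ℝ≥0∞) ^ k = ENNReal.ofReal ((1 / 2) ^ k) := by
  rw [ENNReal.ofReal_pow (by norm_num), one_div, ENNReal.ofReal_inv_of_pos (by norm_num)]
  simp

section chains
variable {α : Type} [Primcodable α]

def Ch (x0 : α) (R : α → α → Prop) : ℕ → α → Prop
  | 0, x => x = x0
  | k + 1, x => ∃ y, Ch x0 R k y ∧ R y x

theorem sig_chain {A : ℕ → Bool} (x0 : α) {R : α → α → Prop} (hR : Sig A (fun x : α × α => R x.1 x.2)) (ms : α → ℕ)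
    (hlt : ∀ x y, R x y → ms x < ms y) : Sig A (fun x => ∃ k, Ch x0 R k x) := by
  have h1 : Sig A (fun x : α => ∃ l : List α, (∃ y ∈ l, y = x) ∧ ∀ y ∈ l, y = x0 ∨ ∃ w, (∃ u ∈ l, u = w) ∧ R w y) := by
    apply sig_ex
    refine sig_and (sig_re (re_of_pp (by fun_prop))) ?_
    have h2 : Sig A (fun z : (α × List α) × α => z.2 = x0 ∨ ∃ w, (∃ u ∈ z.1.2, u = w) ∧ R w z.2) := by
      refine sig_or (sig_re (re_of_pp (by fun_prop))) ?_
      apply sig_ex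
      refine sig_and (sig_re (re_of_pp (by fun_prop))) ?_
      exact sig_comp hR (f := fun z : ((α × List α) × α) × α => (z.2, z.1.2)) (by fun_prop)
    exact sig_ball (by fun_prop) h2
  refine h1.of_eq fun x => ?_
  constructor
  · rintro ⟨l, ⟨y, hy, rfl⟩, hl⟩
    induction hn : ms y using Nat.strong_induction_on generalizing y with
    | _ n ih =>
      rcases hl y hy with rfl | ⟨w, ⟨u, hu, rfl⟩, hR⟩
      · exact ⟨0, rfl⟩
      · obtain ⟨k, hk⟩ := ih (ms u) (by rw [← hn]; exact hlt _ _ hR) u hu rfl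
        exact ⟨k + 1, u, hk, hR⟩
  · rintro ⟨k, hk⟩
    induction k generalizing x with
    | zero => exact ⟨[x], ⟨x, by simp, rfl⟩, fun y hy => Or.inl (by rw [List.mem_singleton.1 hy]; exact hk)⟩
    | succ k ih =>
      obtain ⟨y, hy, hyx⟩ := hk
      obtain ⟨l, ⟨u, hu, rfl⟩, hl⟩ := ih y hy
      refine ⟨x :: l, ⟨x, by simp, rfl⟩, ?_⟩
      intro w hw
      rcases List.mem_cons.1 hw with rfl | hw
      · right; exact ⟨u, ⟨u, List.mem_cons_of_mem _ hu, rfl⟩, hyx⟩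
      · rcases hl w hw with h | ⟨v, ⟨v', hv, rfl⟩, h⟩
        · exact Or.inl h
        · right; exact ⟨v', ⟨v', List.mem_cons_of_mem _ hv, rfl⟩, h⟩
end chains

/-- measurable-density consequence of a counting inequality -/
theorem dens_le_of_cnt {U : List Bool → Bool} {τ : List Bool} {n s : ℕ} (hs : τ.length ≤ s) {T : Set (ℕ → Bool)}
    (hT : ∀ Y, IsPrefixOf τ Y → U (strPrefix Y s) = true → Y ∈ T)
    (h : 2 ^ n * 2 ^ (s - τ.length) ≤ 2 ^ n * cnt (fun η => decide (τ <+: η) && U η) s + 2 ^ (s - τ.length)) :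
    dens τ Tᶜ ≤ 2⁻¹ ^ n := by
  set p := fun η => decide (τ <+: η) && U η with hp
  have h1 : lvl p s ⊆ cylinder τ := by
    intro Y hY
    simp only [lvl, hp, Set.mem_setOf_eq, Bool.and_eq_true, decide_eq_true_eq] at hY
    exact (sp_prefix_iff.1 hY.1).1
  have h2 : cylinder τ ∩ Tᶜ ⊆ cylinder τ \ lvl p s := by
    rintro Y ⟨h3, h4⟩
    refine ⟨h3, fun h5 => h4 ?_⟩
    simp only [lvl, hp, Set.mem_setOf_eq, Bool.and_eq_true, decide_eq_true_eq] at h5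
    exact hT Y h3 h5.2
  have h3 : μCantor (cylinder τ ∩ Tᶜ) ≤ 2⁻¹ ^ n * 2⁻¹ ^ τ.length := by
    refine (measure_mono h2).trans ?_
    rw [measure_diff h1 (measurableSet_lvl p s).nullMeasurableSet (measure_ne_top _ _), mu_cyl, mu_lvl,
      tsub_le_iff_right]
    rw [← pow_add, e2, e2, e2, ← ENNReal.ofReal_natCast, ← ENNReal.ofReal_mul (by positivity),
      ← ENNReal.ofReal_add (by positivity) (by positivity)]
    apply ENNReal.ofReal_le_ofReal
    obtain ⟨j, hj⟩ := Nat.exists_eq_add_of_le hs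
    rw [hj, Nat.add_sub_cancel_left, ← hj] at h
    have h' : (2 : ℝ) ^ n * 2 ^ j ≤ 2 ^ n * cnt p s + 2 ^ j := by exact_mod_cast h
    rw [hj] at h' ⊢
    have i1 : (1 / 2 : ℝ) ^ n * 2 ^ n = 1 := by rw [← mul_pow]; norm_num
    have i2 : (1 / 2 : ℝ) ^ j * 2 ^ j = 1 := by rw [← mul_pow]; norm_num
    have h4 := mul_le_mul_of_nonneg_left h' (show (0 : ℝ) ≤ (1 / 2) ^ n * (1 / 2) ^ (τ.length + j) by positivity)
    rw [pow_add] at h4 ⊢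
    rw [pow_add]
    have e1 : (1 / 2 : ℝ) ^ n * ((1 / 2) ^ τ.length * (1 / 2) ^ j) * (2 ^ n * 2 ^ j) = (1 / 2) ^ τ.length := by
      linear_combination (1 / 2 : ℝ) ^ τ.length * (1 / 2) ^ j * 2 ^ j * i1 + (1 / 2 : ℝ) ^ τ.length * i2
    have e3 : (1 / 2 : ℝ) ^ n * ((1 / 2) ^ τ.length * (1 / 2) ^ j) * (2 ^ n * cnt p (τ.length + j) + 2 ^ j) =
      (1 / 2) ^ n * (1 / 2) ^ τ.length + cnt p (τ.length + j) * ((1 / 2) ^ τ.length * (1 / 2) ^ j) := by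
      linear_combination (cnt p (τ.length + j) : ℝ) * (1 / 2 : ℝ) ^ τ.length * (1 / 2) ^ j * i1 +
        (1 / 2 : ℝ) ^ n * (1 / 2) ^ τ.length * i2
    linarith
  unfold dens
  calc _ ≤ 2⁻¹ ^ n * 2⁻¹ ^ τ.length * 2 ^ τ.length := mul_le_mul_left h3 _
    _ = 2⁻¹ ^ n := by
      rw [mul_assoc, ← mul_pow, ENNReal.inv_mul_cancel (by simp) (by simp), one_pow, mul_one]

theorem wt_le_of_cnt {U : List Bool → Bool} (hU : ExtC U) {τ : List Bool} {n : ℕ} :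
    wtf List.length {η | (τ <+: η ∧ U η = true ∧ (τ = η ∨ U η.dropLast = false)) ∧
      ¬ 2 ^ n * 2 ^ (η.length - τ.length) ≤ 2 ^ n * cnt (fun ξ => decide (τ <+: ξ) && U ξ) η.length +
        2 ^ (η.length - τ.length)} ≤ ENNReal.ofReal (1 - (1 / 2) ^ n) * 2⁻¹ ^ τ.length := by
  classical
  apply wtf_le_of_finset
  intro F hF
  rcases F.eq_empty_or_nonempty with rfl | hne
  · simp
  obtain ⟨η, hη, hmax⟩ := Finset.exists_max_image F List.length hne
  obtain ⟨⟨h1, -⟩, h2⟩ := hF hη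
  have hpf : PrefixFreeSet (F : Set (List Bool)) := by
    intro σ hσ ρ hρ hp
    obtain ⟨⟨a1, a2, -⟩, -⟩ := hF hσ
    obtain ⟨⟨b1, b2, b3⟩, -⟩ := hF hρ
    by_contra hne
    rcases b3 with rfl | b3
    · have := a1.length_le; have := hp.length_le
      exact hne (hp.eq_of_length (by omega))
    · rw [hU _ _ (dropLast_prefix' hp hne) a2] at b3
      simp at b3
  rw [← wtf_finset, ← weight_eq, ← mu_openOf_eq hpf]
  set p := fun ξ => decide (τ <+: ξ) && U ξ with hp
  have h3 : openOf (F : Set (List Bool)) ⊆ lvl p η.length := by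
    intro Y hY
    obtain ⟨m, hm⟩ := mem_openOf.1 hY
    obtain ⟨⟨a1, a2, -⟩, -⟩ := hF hm
    have hle : m ≤ η.length := by have := hmax _ hm; rwa [sp_length] at this
    simp only [lvl, hp, Set.mem_setOf_eq, Bool.and_eq_true, decide_eq_true_eq]
    exact ⟨a1.trans (sp_mono Y hle), hU _ _ (sp_mono Y hle) a2⟩
  refine (measure_mono h3).trans ?_
  have hn : (0 : ℝ) ≤ 1 - (1 / 2) ^ n := by
    have : (1 / 2 : ℝ) ^ n ≤ 1 := pow_le_one₀ (by norm_num) (by norm_num)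
    linarith
  rw [mu_lvl, e2, e2, ← ENNReal.ofReal_natCast, ← ENNReal.ofReal_mul (by positivity), ← ENNReal.ofReal_mul hn]
  apply ENNReal.ofReal_le_ofReal
  obtain ⟨j, hj⟩ := Nat.exists_eq_add_of_le h1.length_le
  rw [hj, Nat.add_sub_cancel_left, ← hj] at h2
  have h' : (2 : ℝ) ^ n * cnt p η.length + 2 ^ j ≤ 2 ^ n * 2 ^ j := by exact_mod_cast (not_le.1 h2).le
  generalize cnt p η.length = N at h'
  have i1 : (1 / 2 : ℝ) ^ n * 2 ^ n = 1 := by rw [← mul_pow]; norm_num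
  have i2 : (1 / 2 : ℝ) ^ j * 2 ^ j = 1 := by rw [← mul_pow]; norm_num
  have h4 := mul_le_mul_of_nonneg_left h' (show (0 : ℝ) ≤ (1 / 2) ^ n * ((1 / 2) ^ τ.length * (1 / 2) ^ j) by positivity)
  rw [hj, pow_add]
  have e1 : (1 / 2 : ℝ) ^ n * ((1 / 2) ^ τ.length * (1 / 2) ^ j) * (2 ^ n * 2 ^ j) = (1 / 2) ^ τ.length := by
    linear_combination (1 / 2 : ℝ) ^ τ.length * (1 / 2) ^ j * 2 ^ j * i1 + (1 / 2 : ℝ) ^ τ.length * i2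
  have e3 : (1 / 2 : ℝ) ^ n * ((1 / 2) ^ τ.length * (1 / 2) ^ j) * (2 ^ n * N + 2 ^ j) =
      (1 / 2) ^ n * (1 / 2) ^ τ.length + N * ((1 / 2) ^ τ.length * (1 / 2) ^ j) := by
    linear_combination (N : ℝ) * (1 / 2 : ℝ) ^ τ.length * (1 / 2) ^ j * i1 +
        (1 / 2 : ℝ) ^ n * (1 / 2) ^ τ.length * i2
  linarith

theorem wt_chain {R : List Bool → List Bool → Prop} {q : ℝ≥0∞}
    (hR : ∀ τ, wtf List.length {η | R τ η} ≤ q * 2⁻¹ ^ τ.length) (hq1 : q < 1) :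
    weight {η | ∃ k, Ch [] R k η} < ⊤ := by
  have hwt : ∀ k, wtf List.length {η | Ch [] R k η} ≤ q ^ k := by
    intro k
    induction k with
    | zero =>
      have : {η : List Bool | Ch [] R 0 η} = (({[]} : Finset (List Bool)) : Set (List Bool)) := by
        ext; simp [Ch]
      rw [this, wtf_finset]; simp
    | succ k ih =>
      have h1 : {η | Ch [] R (k + 1) η} ⊆ ⋃ τ : {η | Ch [] R k η}, {η | R τ.1 η} := by
        rintro η ⟨τ, h1, h2⟩
        exact Set.mem_iUnion.2 ⟨⟨τ, h1⟩, h2⟩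
      refine (wtf_mono _ h1).trans ((wtf_iUnion _ _).trans ?_)
      have h2 : ∀ τ : {η | Ch [] R k η}, wtf List.length {η | R τ.1 η} ≤ q * 2⁻¹ ^ τ.1.length := fun τ => hR τ.1
      refine (ENNReal.tsum_le_tsum h2).trans ?_
      rw [ENNReal.tsum_mul_left, pow_succ, mul_comm]
      exact mul_le_mul_left ih _
  rw [weight_eq]
  have h1 : {η | ∃ k, Ch [] R k η} = ⋃ k, {η | Ch [] R k η} := by ext; simp
  rw [h1]
  refine lt_of_le_of_lt ((wtf_iUnion _ _).trans (ENNReal.tsum_le_tsum hwt)) ?_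
  rw [ENNReal.tsum_geometric, ENNReal.inv_lt_top]
  exact tsub_pos_of_lt hq1

set_option maxHeartbeats 1000000 in
theorem dens_zero {A X : ℕ → Bool}
    (hS : ∀ S : List Bool → Prop, Sig A S → weight {σ | S σ} < ⊤ → {n | S (strPrefix X n)}.Finite)
    (hC : ∀ C : ℕ × List Bool × ℕ → Prop, Sig A C → ∃ Φ : List Bool × List Bool × ℕ × List Bool × ℕ → Prop,
      REPred Φ ∧ ∀ z, ¬ C z ↔ ∃ m, Φ (strPrefix A m, strPrefix X m, z)) :
    ∃ S : List Bool → Prop, Sig A S ∧ X ∉ openOf {σ | S σ} ∧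
      ∀ n, ∃ k, dens (strPrefix X k) (openOf {σ | S σ})ᶜ ≤ 2⁻¹ ^ n := by
  classical
  obtain ⟨W, hW, hWm, hWs⟩ := re_stage re_WEnum
  let V : List Bool × List Bool × ℕ × List Bool × ℕ → Bool := fun x =>
    decide (∃ m ≤ min x.1.length x.2.1.length,
      W ((x.2.2.1, Encodable.encode (x.1.take m, x.2.1.take m, x.2.2)), min x.1.length x.2.1.length) = true)
  have hV : Primrec V := by unfold V; fun_prop
  have hVm : ∀ a a' b b' z, a <+: a' → b <+: b' → V (a, b, z) = true → V (a', b', z) = true := by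
    intro a a' b b' z h1 h2 h3
    simp only [V, decide_eq_true_eq] at h3 ⊢
    obtain ⟨m, hm, h3⟩ := h3
    have l1 := h1.length_le
    have l2 := h2.length_le
    refine ⟨m, by omega, hWm _ (min a.length b.length) _ (by omega) ?_⟩
    have t1 : a'.take m = a.take m := by
      obtain ⟨t, rfl⟩ := h1; rw [List.take_append_of_le_length (by omega)]
    have t2 : b'.take m = b.take m := by
      obtain ⟨t, rfl⟩ := h2; rw [List.take_append_of_le_length (by omega)]
    rw [t1, t2]; exact h3
  let U : ℕ × List Bool × ℕ → List Bool → Bool := fun z η => V (strPrefix A η.length, η, z)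
  have hU : ∀ z, ExtC (U z) := fun z a b h1 h2 => hVm _ _ _ _ _ (sp_mono A h1.length_le) h1 h2
  have hUs : ∀ z Y, (∃ m, U z (strPrefix Y m) = true) ↔
      ∃ m, WEnum z.1 (Encodable.encode (strPrefix A m, strPrefix Y m, z)) := by
    intro z Y
    constructor
    · rintro ⟨m, hm⟩
      simp only [U, V, sp_length, min_self, decide_eq_true_eq] at hm
      obtain ⟨j, hj, hm⟩ := hm
      rw [sp_take, sp_take, min_eq_left hj] at hm
      exact ⟨j, (hWs (_, _)).2 ⟨_, hm⟩⟩
    · rintro ⟨m, hm⟩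
      obtain ⟨s, hs⟩ := (hWs (_, _)).1 hm
      refine ⟨max m s, ?_⟩
      simp only [U, V, sp_length, min_self, decide_eq_true_eq]
      refine ⟨m, le_max_left _ _, ?_⟩
      rw [sp_take, sp_take, min_eq_left (le_max_left _ _)]
      exact hWm _ _ _ (le_max_right _ _) hs
  -- finite part
  let Dp : List Bool → ℕ × List Bool × ℕ → ℕ → Prop := fun a z s =>
    2 ^ z.2.2 * 2 ^ (s - z.2.1.length) ≤ 2 ^ z.2.2 * cnt (fun η => decide (z.2.1 <+: η) && V (a.take η.length, η, z)) s +
      2 ^ (s - z.2.1.length)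
  let D : ℕ × List Bool × ℕ → ℕ → Prop := fun z s =>
    2 ^ z.2.2 * 2 ^ (s - z.2.1.length) ≤ 2 ^ z.2.2 * cnt (fun η => decide (z.2.1 <+: η) && U z η) s +
      2 ^ (s - z.2.1.length)
  have hDp : ∀ z s n, s ≤ n → (Dp (strPrefix A n) z s ↔ D z s) := by
    intro z s n hn
    have : cnt (fun η => decide (z.2.1 <+: η) && V ((strPrefix A n).take η.length, η, z)) s =
        cnt (fun η => decide (z.2.1 <+: η) && U z η) s := by
      unfold cnt
      congr 1
      apply List.filter_congr
      intro η hη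
      have : η.length = s := mem_allStr.1 hη
      simp only [U]
      rw [sp_take, this, min_eq_left hn]
    simp only [Dp, D, this]
  have hDpr : PrimrecPred (fun x : List Bool × (ℕ × List Bool × ℕ) × ℕ => Dp x.1 x.2.1 x.2.2) := by
    unfold Dp
    fun_prop
  let C : ℕ × List Bool × ℕ → Prop := fun z => ∃ s, z.2.1.length ≤ s ∧ D z s
  have hDsig : Sig A (fun x : (ℕ × List Bool × ℕ) × ℕ => D x.1 x.2) := by
    have h1 : REPred (fun x : List Bool × (ℕ × List Bool × ℕ) × ℕ => x.2.2 ≤ x.1.length ∧ Dp x.1 x.2.1 x.2.2) :=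
      re_and (by fun_prop) (re_of_pp hDpr)
    refine (sig_of_re h1).of_eq fun x => ?_
    constructor
    · rintro ⟨n, h1, h2⟩
      rw [sp_length] at h1
      exact (hDp _ _ n h1).1 h2
    · intro h; exact ⟨x.2, by rw [sp_length], (hDp _ _ _ le_rfl).2 h⟩
  have hDsig' : Sig A (fun x : (ℕ × List Bool × ℕ) × ℕ => ¬ D x.1 x.2) := by
    have h1 : REPred (fun x : List Bool × (ℕ × List Bool × ℕ) × ℕ => x.2.2 ≤ x.1.length ∧ ¬ Dp x.1 x.2.1 x.2.2) :=
      re_and (by fun_prop) (re_of_pp hDpr.not)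
    refine (sig_of_re h1).of_eq fun x => ?_
    constructor
    · rintro ⟨n, h1, h2⟩
      rw [sp_length] at h1
      exact fun h => h2 ((hDp _ _ n h1).2 h)
    · intro h; exact ⟨x.2, by rw [sp_length], fun h' => h ((hDp _ _ _ le_rfl).1 h')⟩
  have hCsig : Sig A C := sig_ex (sig_and (by fun_prop) hDsig)
  have hUsig : ∀ b : Bool, Sig A (fun x : (ℕ × List Bool × ℕ) × List Bool => U x.1 x.2 = b) := by
    intro b
    have h1 : REPred (fun x : List Bool × (ℕ × List Bool × ℕ) × List Bool =>
      x.1.length = x.2.2.length ∧ V (x.1, x.2.2, x.2.1) = b) := re_of_pp (by fun_prop)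
    refine (sig_of_re h1).of_eq fun x => ?_
    constructor
    · rintro ⟨n, h1, h2⟩
      rw [sp_length] at h1
      simp only at h1 h2
      simp only [U, ← h1]; exact h2
    · intro h; exact ⟨x.2.length, by rw [sp_length], h⟩
  obtain ⟨Φ, hΦ, hΦC⟩ := hC C hCsig
  obtain ⟨e, he⟩ := exists_WEnum (re_decode hΦ)
  have he' : ∀ a, WEnum e (Encodable.encode a) ↔ Φ a := by
    intro a; rw [he]
    constructor
    · rintro ⟨b, hb, h⟩; rwa [Encodable.encode_injective hb] at h
    · intro h; exact ⟨a, rfl, h⟩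
  have hCX : ∀ τ n, ¬ C (e, τ, n) ↔ ∃ m, U (e, τ, n) (strPrefix X m) = true := by
    intro τ n
    rw [hΦC, hUs]
    simp only [he']
  let S : List Bool → Prop := fun η => ∃ y : List Bool × ℕ, C (e, y.1, y.2) ∧ (y.1 <+: η ∧ U (e, y.1, y.2) η = true)
  refine ⟨S, ?_, ?_, ?_⟩
  · apply sig_ex
    refine sig_and (sig_comp hCsig (f := fun x : List Bool × List Bool × ℕ => (e, x.2.1, x.2.2)) (by fun_prop)) ?_
    refine sig_and (by fun_prop) ?_
    exact sig_comp (hUsig true) (f := fun x : List Bool × List Bool × ℕ => ((e, x.2.1, x.2.2), x.1)) (by fun_prop)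
  · intro h
    obtain ⟨m, ⟨τ, n⟩, h1, -, h3⟩ := mem_openOf.1 h
    exact (hCX τ n).2 ⟨m, h3⟩ h1
  · intro n
    by_cases hex : ∃ k, C (e, strPrefix X k, n)
    · obtain ⟨k, s, hs, hD⟩ := hex
      refine ⟨k, dens_le_of_cnt (U := U (e, strPrefix X k, n)) hs ?_ hD⟩
      intro Y hY hUY
      refine mem_openOf.2 ⟨s, (strPrefix X k, n), ⟨s, hs, hD⟩, ?_, hUY⟩
      exact sp_prefix_iff.2 ⟨hY, hs⟩
    · exfalso
      push Not at hex
      let R : List Bool → List Bool → Prop := fun τ η =>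
        (τ <+: η ∧ U (e, τ, n) η = true ∧ (τ = η ∨ U (e, τ, n) η.dropLast = false)) ∧ ¬ D (e, τ, n) η.length
      have hRsig : Sig A (fun x : List Bool × List Bool => R x.1 x.2) := by
        refine sig_and (sig_and (by fun_prop) (sig_and ?_ (sig_or (by fun_prop) ?_))) ?_
        · exact sig_comp (hUsig true) (f := fun x : List Bool × List Bool => ((e, x.1, n), x.2)) (by fun_prop)
        · exact sig_comp (hUsig false) (f := fun x : List Bool × List Bool => ((e, x.1, n), x.2.dropLast)) (by fun_prop)
        · exact sig_comp hDsig' (f := fun x : List Bool × List Bool => ((e, x.1, n), x.2.length)) (by fun_prop)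
      have hRlt : ∀ τ η, R τ η → τ.length < η.length := by
        rintro τ η ⟨⟨h1, h2, h3⟩, h4⟩
        rcases h1.length_le.lt_or_eq with h | h
        · exact h
        · exfalso
          have : τ = η := h1.eq_of_length h
          subst this
          apply h4
          have h5 : 1 ≤ cnt (fun η => decide (τ <+: η) && U (e, τ, n) η) τ.length := by
            unfold cnt
            rw [Nat.one_le_iff_ne_zero, ← Nat.pos_iff_ne_zero, List.length_pos_iff_exists_mem]
            exact ⟨τ, List.mem_filter.2 ⟨mem_allStr.2 rfl, by simp [h2]⟩⟩
          simp only [D, Nat.sub_self, pow_zero]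
          have : 2 ^ n * 1 ≤ 2 ^ n * cnt (fun η => decide (τ <+: η) && U (e, τ, n) η) τ.length :=
            Nat.mul_le_mul_left _ h5
          omega
      have hT := sig_chain [] hRsig List.length hRlt
      set q := ENNReal.ofReal (1 - (1 / 2) ^ n) with hq
      have hq1 : q < 1 := by
        rw [hq, ENNReal.ofReal_lt_one]
        have : (0 : ℝ) < (1 / 2) ^ n := by positivity
        linarith
      have hRw : ∀ τ, wtf List.length {η | R τ η} ≤ q * 2⁻¹ ^ τ.length := fun τ =>
        wt_le_of_cnt (hU (e, τ, n))
      have hTw : weight {η | ∃ k, Ch [] R k η} < ⊤ := wt_chain hRw hq1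
      have hfin := hS _ hT hTw
      have hall : ∀ k, ∃ j ≥ k, Ch [] R k (strPrefix X j) := by
        intro k
        induction k with
        | zero => exact ⟨0, le_rfl, rfl⟩
        | succ k ih =>
          obtain ⟨j, hj, hch⟩ := ih
          have hnC := hex j
          have hm := (hCX (strPrefix X j) n).1 hnC
          obtain ⟨m0, hm0⟩ := hm
          have hex2 : ∃ m, j ≤ m ∧ U (e, strPrefix X j, n) (strPrefix X m) = true :=
            ⟨max j m0, le_max_left _ _, hU _ _ _ (sp_mono X (le_max_right _ _)) hm0⟩
          obtain ⟨h1, h2⟩ := Nat.find_spec hex2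
          set m := Nat.find hex2
          have hR : R (strPrefix X j) (strPrefix X m) := by
            refine ⟨⟨sp_mono X h1, h2, ?_⟩, fun hD => hnC ⟨_, ?_, hD⟩⟩
            · rcases h1.lt_or_eq with h | h
              · right
                obtain ⟨m', hm'⟩ : ∃ m', m = m' + 1 := ⟨m - 1, by omega⟩
                have h3 := Nat.find_min hex2 (show m' < Nat.find hex2 by omega)
                rw [hm', sp_succ, List.dropLast_concat]
                rw [Bool.eq_false_iff]
                intro h4
                exact h3 ⟨by omega, h4⟩
              · left; rw [← h]
            · simp only [sp_length]; exact h1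
          have := hRlt _ _ hR
          rw [sp_length, sp_length] at this
          exact ⟨m, by omega, _, hch, hR⟩
      obtain ⟨N, hN⟩ := hfin.bddAbove
      obtain ⟨j, hj, hch⟩ := hall (N + 1)
      have := hN (show j ∈ {n | ∃ k, Ch [] R k (strPrefix X n)} from ⟨_, hch⟩)
      omega

theorem sig_ext {A : ℕ → Bool} {S : List Bool → Prop} (hS : Sig A S) : ∃ U : List Bool → Bool, ExtC U ∧
    openOf {σ | U σ = true} = openOf {σ | S σ} ∧ ∀ b : Bool, Sig A (fun σ => U σ = b) := by
  obtain ⟨f, hf, fm, fs⟩ := hS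
  let U : List Bool → Bool := fun η => decide (∃ m ≤ η.length, f (strPrefix A η.length, η.take m) = true)
  have hU : ExtC U := by
    intro a b h1 h2
    simp only [U, decide_eq_true_eq] at h2 ⊢
    obtain ⟨m, hm, h⟩ := h2
    have := h1.length_le
    refine ⟨m, by omega, fm _ _ _ (sp_mono A this) ?_⟩
    have t1 : b.take m = a.take m := by
      obtain ⟨t, rfl⟩ := h1; rw [List.take_append_of_le_length (by omega)]
    rw [t1]; exact h
  refine ⟨U, hU, ?_, ?_⟩
  · ext X
    rw [mem_openOf, mem_openOf]
    constructor
    · rintro ⟨n, hn⟩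
      simp only [Set.mem_ofPred_eq, U, decide_eq_true_eq, sp_length] at hn
      obtain ⟨m, hm, h⟩ := hn
      rw [sp_take, min_eq_left hm] at h
      exact ⟨m, (fs _).2 ⟨_, h⟩⟩
    · rintro ⟨n, hn⟩
      obtain ⟨m, hm⟩ := (fs _).1 hn
      refine ⟨max m n, ?_⟩
      simp only [Set.mem_ofPred_eq, U, decide_eq_true_eq, sp_length]
      refine ⟨n, le_max_right _ _, ?_⟩
      rw [sp_take, min_eq_left (le_max_right _ _)]
      exact fm _ _ _ (sp_mono A (le_max_left _ _)) hm
  · intro b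
    have h1 : REPred (fun x : List Bool × List Bool => x.1.length = x.2.length ∧
        decide (∃ m ≤ x.2.length, f (x.1, x.2.take m) = true) = b) := re_of_pp (by fun_prop)
    refine (sig_of_re h1).of_eq fun η => ?_
    constructor
    · rintro ⟨n, h1, h2⟩
      rw [sp_length] at h1
      simp only at h1 h2
      subst h1
      exact h2
    · intro h; exact ⟨η.length, by rw [sp_length], h⟩

theorem re_ext {S : List Bool → Prop} (hS : REPred S) : ∃ U : List Bool → Bool, Primrec U ∧ ExtC U ∧
    openOf {σ | U σ = true} = openOf {σ | S σ} := by
  obtain ⟨f, hf, fm, fs⟩ := re_stage hS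
  let U : List Bool → Bool := fun η => decide (∃ m ≤ η.length, f (η.take m, η.length) = true)
  have hU : ExtC U := by
    intro a b h1 h2
    simp only [U, decide_eq_true_eq] at h2 ⊢
    obtain ⟨m, hm, h⟩ := h2
    have := h1.length_le
    refine ⟨m, by omega, fm _ _ _ this ?_⟩
    have t1 : b.take m = a.take m := by
      obtain ⟨t, rfl⟩ := h1; rw [List.take_append_of_le_length (by omega)]
    rw [t1]; exact h
  refine ⟨U, by unfold U; fun_prop, hU, ?_⟩
  ext X
  rw [mem_openOf, mem_openOf]
  constructor
  · rintro ⟨n, hn⟩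
    simp only [Set.mem_ofPred_eq, U, decide_eq_true_eq, sp_length] at hn
    obtain ⟨m, hm, h⟩ := hn
    rw [sp_take, min_eq_left hm] at h
    exact ⟨m, (fs _).2 ⟨_, h⟩⟩
  · rintro ⟨n, hn⟩
    obtain ⟨m, hm⟩ := (fs _).1 hn
    refine ⟨max m n, ?_⟩
    simp only [Set.mem_ofPred_eq, U, decide_eq_true_eq, sp_length]
    refine ⟨n, le_max_right _ _, ?_⟩
    rw [sp_take, min_eq_left (le_max_right _ _)]
    exact fm _ _ _ (le_max_left _ _) hm

theorem mu_of_dens {τ : List Bool} {P : Set (ℕ → Bool)} {ε : ℝ≥0∞} (h : dens τ P ≤ ε) :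
    μCantor (cylinder τ ∩ P) ≤ ε * 2⁻¹ ^ τ.length := by
  unfold dens at h
  calc μCantor (cylinder τ ∩ P) = μCantor (cylinder τ ∩ P) * 2 ^ τ.length * 2⁻¹ ^ τ.length := by
        rw [mul_assoc, ← mul_pow, ENNReal.mul_inv_cancel (by simp) (by simp), one_pow, mul_one]
    _ ≤ _ := mul_le_mul_left h _

/-- points of `P` above `ρ` at which the density of `P` drops to `ε` have small measure -/
theorem cover_dens {P Z : Set (ℕ → Bool)} {ρ : List Bool} {ε : ℝ≥0∞} (hZ : Z ⊆ P) (hρ : Z ⊆ cylinder ρ)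
    (h : ∀ Y ∈ Z, ∃ k, ρ.length ≤ k ∧ dens (strPrefix Y k) P ≤ ε) : μCantor Z ≤ ε * 2⁻¹ ^ ρ.length := by
  classical
  let D : List Bool → Bool := fun τ => decide (∃ σ, ρ <+: σ ∧ σ <+: τ ∧ dens σ P ≤ ε)
  have hD : ExtC D := by
    intro a b h1 h2
    simp only [D, decide_eq_true_eq] at h2 ⊢
    obtain ⟨σ, a1, a2, a3⟩ := h2
    exact ⟨σ, a1, a2.trans h1, a3⟩
  have hm : ∀ τ ∈ minE D, ρ <+: τ ∧ dens τ P ≤ ε := by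
    rintro τ ⟨h1, h2⟩
    simp only [D, decide_eq_true_eq] at h1
    obtain ⟨σ, a1, a2, a3⟩ := h1
    by_cases hne : σ = τ
    · subst hne; exact ⟨a1, a3⟩
    · exfalso
      rcases h2 with rfl | h2
      · exact hne (List.prefix_nil.1 a2)
      · simp only [D, decide_eq_false_iff_not] at h2
        exact h2 ⟨σ, a1, dropLast_prefix' a2 hne, a3⟩
  have hc : Z ⊆ ⋃ τ ∈ minE D, cylinder τ ∩ P := by
    intro Y hY
    obtain ⟨k, hk, hd⟩ := h Y hY
    have h1 : D (strPrefix Y k) = true := by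
      simp only [D, decide_eq_true_eq]
      exact ⟨_, sp_prefix_iff.2 ⟨hρ hY, hk⟩, List.prefix_rfl, hd⟩
    obtain ⟨τ, hτ, hp⟩ := minE_exists h1
    exact Set.mem_biUnion hτ ⟨(sp_prefix_iff.1 hp).1, hZ hY⟩
  calc μCantor Z ≤ μCantor (⋃ τ ∈ minE D, cylinder τ ∩ P) := measure_mono hc
    _ ≤ ∑' τ : minE D, μCantor (cylinder τ ∩ P) := measure_biUnion_le _ (Set.to_countable _) _
    _ ≤ ∑' τ : minE D, ε * 2⁻¹ ^ (τ : List Bool).length := ENNReal.tsum_le_tsum fun τ => mu_of_dens (hm τ.1 τ.2).2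
    _ = ε * weight (minE D) := by rw [ENNReal.tsum_mul_left]; rfl
    _ ≤ ε * 2⁻¹ ^ ρ.length := by
      refine mul_le_mul_right ?_ _
      rw [← mu_openOf_eq (minE_prefixFree hD), ← mu_cyl]
      apply measure_mono
      intro Y hY
      obtain ⟨k, hk⟩ := mem_openOf.1 hY
      exact (sp_prefix_iff.1 (hm _ hk).1).1

theorem cnt_of_dens {U : List Bool → Bool} (hU : ExtC U) {τ : List Bool} {n : ℕ} (s0 : ℕ)
    (h : dens τ (openOf {σ | U σ = true})ᶜ < 2⁻¹ ^ n) : ∃ s ≥ s0, τ.length ≤ s ∧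
      2 ^ n * 2 ^ (s - τ.length) ≤ 2 ^ n * cnt (fun η => decide (τ <+: η) && U η) s + 2 ^ (s - τ.length) := by
  by_contra hcon
  push Not at hcon
  set p := fun η => decide (τ <+: η) && U η with hp
  have hpE : ExtC p := by
    intro a b h1 h2
    simp only [hp, Bool.and_eq_true, decide_eq_true_eq] at h2 ⊢
    exact ⟨h2.1.trans h1, hU _ _ h1 h2.2⟩
  set T := openOf {σ | U σ = true} with hT
  have h1 : cylinder τ ∩ T = ⋃ s, lvl p s := by
    ext Y
    rw [hT, openOf_eq_iUnion_lvl]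
    simp only [Set.mem_inter_iff, Set.mem_iUnion, lvl, Set.mem_ofPred_eq, hp, Bool.and_eq_true, decide_eq_true_eq, mem_cyl]
    constructor
    · rintro ⟨h1, s, h2⟩
      exact ⟨max s τ.length, sp_prefix_iff.2 ⟨h1, le_max_right _ _⟩, hU _ _ (sp_mono Y (le_max_left _ _)) h2⟩
    · rintro ⟨s, h1, h2⟩
      exact ⟨(sp_prefix_iff.1 h1).1, s, h2⟩
  have hn : (0 : ℝ) ≤ 1 - (1 / 2) ^ n := by
    have : (1 / 2 : ℝ) ^ n ≤ 1 := pow_le_one₀ (by norm_num) (by norm_num)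
    linarith
  have h2 : ∀ s, μCantor (lvl p s) ≤ ENNReal.ofReal ((1 - (1 / 2) ^ n) * (1 / 2) ^ τ.length) := by
    intro s
    refine (measure_mono (lvl_mono hpE (show s ≤ max s (max s0 τ.length) from le_max_left _ _))).trans ?_
    set t := max s (max s0 τ.length) with ht
    have h3 := hcon t (by omega) (by omega)
    rw [mu_lvl, e2, ← ENNReal.ofReal_natCast, ← ENNReal.ofReal_mul (by positivity)]
    apply ENNReal.ofReal_le_ofReal
    obtain ⟨j, hj⟩ := Nat.exists_eq_add_of_le (show τ.length ≤ t by omega)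
    rw [hj, Nat.add_sub_cancel_left, ← hj] at h3
    have h' : (2 : ℝ) ^ n * cnt p t + 2 ^ j ≤ 2 ^ n * 2 ^ j := by exact_mod_cast h3.le
    generalize cnt p t = N at h'
    have i1 : (1 / 2 : ℝ) ^ n * 2 ^ n = 1 := by rw [← mul_pow]; norm_num
    have i2 : (1 / 2 : ℝ) ^ j * 2 ^ j = 1 := by rw [← mul_pow]; norm_num
    have h4 := mul_le_mul_of_nonneg_left h' (show (0 : ℝ) ≤ (1 / 2) ^ n * ((1 / 2) ^ τ.length * (1 / 2) ^ j) by positivity)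
    rw [hj, pow_add]
    have e1 : (1 / 2 : ℝ) ^ n * ((1 / 2) ^ τ.length * (1 / 2) ^ j) * (2 ^ n * 2 ^ j) = (1 / 2) ^ τ.length := by
      linear_combination (1 / 2 : ℝ) ^ τ.length * (1 / 2) ^ j * 2 ^ j * i1 + (1 / 2 : ℝ) ^ τ.length * i2
    have e3 : (1 / 2 : ℝ) ^ n * ((1 / 2) ^ τ.length * (1 / 2) ^ j) * (2 ^ n * N + 2 ^ j) =
        (1 / 2) ^ n * (1 / 2) ^ τ.length + N * ((1 / 2) ^ τ.length * (1 / 2) ^ j) := by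
      linear_combination (N : ℝ) * (1 / 2 : ℝ) ^ τ.length * (1 / 2) ^ j * i1 +
          (1 / 2 : ℝ) ^ n * (1 / 2) ^ τ.length * i2
    linarith
  have h3 : μCantor (cylinder τ ∩ T) ≤ ENNReal.ofReal ((1 - (1 / 2) ^ n) * (1 / 2) ^ τ.length) := by
    rw [h1, (lvl_mono hpE).measure_iUnion]
    exact iSup_le h2
  have h4 : μCantor (cylinder τ) = μCantor (cylinder τ ∩ T) + μCantor (cylinder τ ∩ Tᶜ) := by
    rw [← Set.diff_eq, measure_inter_add_diff _ (measurableSet_openOf _)]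
  have h5 : μCantor (cylinder τ ∩ Tᶜ) < ENNReal.ofReal ((1 / 2) ^ n * (1 / 2) ^ τ.length) := by
    have a1 : μCantor (cylinder τ ∩ Tᶜ) * 2 ^ τ.length < 2⁻¹ ^ n := h
    rw [ENNReal.ofReal_mul (by positivity), ← e2, ← e2]
    rw [show (2⁻¹ : ℝ≥0∞) ^ τ.length = (2 ^ τ.length)⁻¹ from ENNReal.inv_pow.symm, ← div_eq_mul_inv,
      ENNReal.lt_div_iff_mul_lt (by simp) (by simp)]
    exact a1
  rw [mu_cyl] at h4
  have h6 : (2⁻¹ : ℝ≥0∞) ^ τ.length < ENNReal.ofReal ((1 - (1 / 2) ^ n) * (1 / 2) ^ τ.length) +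
      ENNReal.ofReal ((1 / 2) ^ n * (1 / 2) ^ τ.length) := by
    rw [h4]
    exact ENNReal.add_lt_add_of_le_of_lt (measure_ne_top _ _) h3 h5
  rw [← ENNReal.ofReal_add (by positivity) (by positivity), ← add_mul, e2] at h6
  simp at h6

theorem complete_of_dens_zero {X : ℕ → Bool} (hX : MLRandom X) {S : List Bool → Prop} (hS : REPred S)
    (hXS : X ∉ openOf {σ | S σ}) (hd : ∀ n, ∃ k, dens (strPrefix X k) (openOf {σ | S σ})ᶜ ≤ 2⁻¹ ^ n) :
    TuringLE zeroJump X := by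
  obtain ⟨U, hUp, hU, hUS⟩ := re_ext hS
  rw [← hUS] at hXS hd
  obtain ⟨g, hg, gm, gs⟩ := re_stage re_zeroJump
  let E : List Bool → ℕ → ℕ → Prop := fun τ n s =>
    2 ^ n * 2 ^ (s - τ.length) ≤ 2 ^ n * cnt (fun η => decide (τ <+: η) && U η) s + 2 ^ (s - τ.length)
  have hE : PrimrecPred (fun x : List Bool × ℕ × ℕ => E x.1 x.2.1 x.2.2) := by unfold E; fun_prop
  let F : ℕ → List Bool → Prop := fun n η => (g (n, η.length) = true ∧ ∀ t < η.length, g (n, t) = false) ∧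
    U η = false ∧ ∃ s ≤ η.length, ∃ k ≤ s, E (η.take k) n s
  have hF : REPred (fun η => ∃ n, F n η) := by
    apply re_ex
    apply re_of_pp
    unfold F E
    fun_prop
  have hFw : weight {η | ∃ n, F n η} < ⊤ := by
    have h1 : {η | ∃ n, F n η} = ⋃ n, {η | F n η} := by ext; simp
    rw [weight_eq, h1]
    refine lt_of_le_of_lt ((wtf_iUnion _ _).trans (ENNReal.tsum_le_tsum (g := fun n => 2⁻¹ ^ n) fun n => ?_))
      (by rw [tsum_geom]; simp)
    have hlen : ∀ η ∈ {η | F n η}, ∀ η' ∈ {η | F n η}, η.length = η'.length := by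
      rintro η ⟨⟨h1, h2⟩, -⟩ η' ⟨⟨h3, h4⟩, -⟩
      by_contra hne
      rcases Nat.lt_or_gt_of_ne hne with h | h
      · rw [h4 _ h] at h1; simp at h1
      · rw [h2 _ h] at h3; simp at h3
    have hpf : PrefixFreeSet {η | F n η} := fun σ hσ τ hτ hp => hp.eq_of_length (hlen σ hσ τ hτ)
    rw [← weight_eq, ← mu_openOf_eq hpf]
    by_cases hne : ∃ η0, F n η0
    swap
    · have : openOf {η | F n η} = ∅ := by
        ext Y; simp only [mem_openOf, Set.mem_empty_iff_false, iff_false]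
        rintro ⟨k, hk⟩; exact hne ⟨_, hk⟩
      rw [this]; simp
    obtain ⟨η0, hη0⟩ := hne
    have := cover_dens (P := (lvl U η0.length)ᶜ) (Z := openOf {η | F n η}) (ρ := []) (ε := 2⁻¹ ^ n) ?_ ?_ ?_
    · simpa using this
    · intro Y hY
      obtain ⟨k, hk⟩ := mem_openOf.1 hY
      have hl := hlen _ hk _ hη0
      rw [sp_length] at hl
      obtain ⟨-, h1, -⟩ := hk
      rw [← hl]
      simp only [lvl, Set.mem_compl_iff, Set.mem_ofPred_eq, h1]
      simp
    · intro Y _; exact isPrefixOf_nil Y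
    · intro Y hY
      obtain ⟨l, hk⟩ := mem_openOf.1 hY
      have hl := hlen _ hk _ hη0
      rw [sp_length] at hl
      obtain ⟨-, -, s, hs, k, hks, hE⟩ := hk
      rw [sp_length] at hs
      rw [sp_take, min_eq_left (by omega)] at hE
      refine ⟨k, by simp, ?_⟩
      refine dens_le_of_cnt (U := U) (s := s) (by rw [sp_length]; exact hks) ?_ hE
      intro Z _ hZ
      exact hU _ _ (sp_mono Z (by omega)) hZ
  obtain ⟨N, hN⟩ := (solovay hX hF hFw).bddAbove
  apply turingLE_of_sig
  have h1 : REPred (fun x : List Bool × ℕ => N < x.1.length ∧ g (x.2, x.1.length) = false ∧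
      ∃ k ≤ x.1.length, E (x.1.take k) x.2 x.1.length) := by
    apply re_of_pp
    unfold E
    fun_prop
  refine (sig_of_re h1).of_eq fun n => ?_
  constructor
  · rintro ⟨s, h1, h2, k, h3, h4⟩
    simp only [sp_length] at h1 h2 h3 h4
    by_contra hne
    rw [Bool.not_eq_false, gs] at hne
    have hmin := @Nat.find_min _ _ hne
    have hsp := Nat.find_spec hne
    set t := Nat.find hne
    have hst : s < t := by
      by_contra hle
      rw [gm _ _ _ (not_lt.1 hle) hsp] at h2
      simp at h2
    have : t ≤ N := hN (show ∃ n, F n (strPrefix X t) from by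
      refine ⟨n, ⟨?_, ?_⟩, ?_, s, ?_, k, h3, ?_⟩
      · rw [sp_length]; exact hsp
      · intro u hu
        rw [sp_length] at hu
        simpa using hmin hu
      · rw [Bool.eq_false_iff]
        intro hU; exact hXS (mem_openOf.2 ⟨t, hU⟩)
      · rw [sp_length]; omega
      · rw [sp_take] at h4 ⊢
        rw [min_eq_left (by omega)] at h4 ⊢
        exact h4)
    omega
  · intro hn
    obtain ⟨k, hk⟩ := hd (n + 1)
    have hlt : dens (strPrefix X k) (openOf {σ | U σ = true})ᶜ < 2⁻¹ ^ n := by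
      refine lt_of_le_of_lt hk ?_
      rw [e2, e2, ENNReal.ofReal_lt_ofReal_iff (by positivity)]
      exact pow_lt_pow_right_of_lt_one₀ (by norm_num) (by norm_num) (by omega)
    obtain ⟨s, hs, hks, h⟩ := cnt_of_dens hU (N + 1) hlt
    rw [sp_length] at hks
    refine ⟨s, ?_, ?_, k, ?_, ?_⟩
    · rw [sp_length]; omega
    · rw [Bool.eq_false_iff, sp_length]
      intro h; rw [(gs n).2 ⟨_, h⟩] at hn; simp at hn
    · rw [sp_length]; exact hks
    · simp only [sp_length]
      rw [sp_take, min_eq_left hks]; exact h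

theorem wtf_const_finite {α : Type} {S : Set α} {c : ℕ} (h : wtf (fun _ => c) S < ⊤) : S.Finite := by
  by_contra hinf
  haveI : Infinite S := Set.infinite_coe_iff.2 hinf
  unfold wtf at h
  rw [ENNReal.tsum_const_eq_top_of_ne_zero (by simp)] at h
  simp at h

theorem hC_of_ktrivial {A X : ℕ → Bool} (hA : KTrivial A) (hj : TuringLE zeroJump (joinSet A X))
    (C : ℕ × List Bool × ℕ → Prop) (hC : Sig A C) : ∃ Φ : List Bool × List Bool × ℕ × List Bool × ℕ → Prop,
      REPred Φ ∧ ∀ z, ¬ C z ↔ ∃ m, Φ (strPrefix A m, strPrefix X m, z) := by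
  obtain ⟨f, hf, fm, fs⟩ := hC
  let L : (ℕ × List Bool × ℕ) × ℕ → Prop := fun x => f (strPrefix A x.2, x.1) = true ∧
    ∀ t < x.2, f (strPrefix A t, x.1) = false
  have hL : Sig A L := by
    have h1 : REPred (fun x : List Bool × (ℕ × List Bool × ℕ) × ℕ => x.1.length = x.2.2 ∧ f (x.1, x.2.1) = true ∧
      ∀ t < x.2.2, f (x.1.take t, x.2.1) = false) := re_of_pp (by fun_prop)
    refine (sig_of_re h1).of_eq fun x => ?_
    constructor
    · rintro ⟨n, h1, h2, h3⟩
      rw [sp_length] at h1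
      simp only at h1 h2 h3
      subst h1
      refine ⟨h2, fun t ht => ?_⟩
      have := h3 t ht
      rwa [sp_take, min_eq_left ht.le] at this
    · rintro ⟨h2, h3⟩
      refine ⟨x.2, by rw [sp_length], h2, fun t ht => ?_⟩
      dsimp only
      rw [sp_take, min_eq_left ht.le]
      exact h3 t ht
  have hLw : wtf (fun x : (ℕ × List Bool × ℕ) × ℕ => Encodable.encode x.1) {x | L x} < ⊤ := by
    have h1 : wtf (fun x : (ℕ × List Bool × ℕ) × ℕ => Encodable.encode x.1) {x | L x} ≤ wtf id Set.univ := by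
      refine wtf_inj_le _ _ (fun x => Encodable.encode x.1) _ _ ?_ (by simp) (by simp)
      rintro ⟨z, s⟩ ⟨h1, h2⟩ ⟨z', s'⟩ ⟨h3, h4⟩ h
      have hz := Encodable.encode_injective h
      dsimp only at *
      subst hz
      have : s = s' := by
        by_contra hne
        rcases Nat.lt_or_gt_of_ne hne with h | h
        · rw [h4 _ h] at h1; simp at h1
        · rw [h2 _ h] at h3; simp at h3
      rw [this]
    refine lt_of_le_of_lt h1 ?_
    unfold wtf
    simp only [id]
    rw [tsum_univ (fun x : ℕ => (2⁻¹ : ℝ≥0∞) ^ x)]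
    rw [tsum_geom]; simp
  obtain ⟨L', hL', hLL, hLw'⟩ := LK hA (by fun_prop) hL hLw
  have hfin : ∀ z, {s | L' (z, s)}.Finite := by
    intro z
    apply wtf_const_finite (c := Encodable.encode z)
    refine lt_of_le_of_lt (wtf_inj_le _ _ (fun s => (z, s)) _ _ ?_ ?_ ?_) hLw'
    · intro s _ t _ h; simpa using h
    · intro s hs; exact hs
    · intro s hs; exact le_rfl
  have hD : REPred (fun x : (ℕ × List Bool × ℕ) × List ℕ => ∃ s, L' (x.1, s) ∧ ¬ ∃ t ∈ x.2, t = s) := by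
    apply re_ex
    refine re_and (re_comp hL' (f := fun x : ((ℕ × List Bool × ℕ) × List ℕ) × ℕ => (x.1.1, x.2)) (by fun_prop)) ?_
    exact re_of_pp (by fun_prop)
  obtain ⟨h, hh, hm, hs⟩ := sig_join_iff.1 (sig_co_re hj hD)
  refine ⟨fun x => ∃ F : List ℕ, h (x.1, x.2.1, (x.2.2, F)) = true ∧
    ∀ s ∈ F, s ≤ x.1.length ∧ f (x.1.take s, x.2.2) = false, ?_, ?_⟩
  · apply re_ex
    apply re_of_pp
    fun_prop
  intro z
  constructor
  · intro hz
    have hz' : ∀ n, f (strPrefix A n, z) = false := by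
      intro n
      rw [Bool.eq_false_iff]; intro hn; exact hz ((fs z).2 ⟨n, hn⟩)
    let F := (hfin z).toFinset.toList
    have hF : ∀ s, L' (z, s) → s ∈ F := by intro s hs; simpa [F] using hs
    obtain ⟨n, hn⟩ := (hs (z, F)).1 (by
      rintro ⟨s, h1, h2⟩; exact h2 ⟨s, hF s h1, rfl⟩)
    obtain ⟨M, hM⟩ : ∃ M, ∀ s ∈ F, s ≤ M := ⟨F.sum, fun s hs => List.le_sum_of_mem hs⟩
    refine ⟨max n M, F, hm _ _ _ _ _ (sp_mono A (le_max_left _ _)) (sp_mono X (le_max_left _ _)) hn, ?_⟩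
    intro s hs
    have := hM s hs
    refine ⟨by rw [sp_length]; omega, ?_⟩
    dsimp only
    rw [sp_take, min_eq_left (by omega)]; exact hz' s
  · rintro ⟨m, F, h1, h2⟩ hz
    have h3 := (hs (z, F)).2 ⟨m, h1⟩
    have hex := (fs z).1 hz
    have hL0 : L (z, Nat.find hex) := by
      refine ⟨Nat.find_spec hex, fun t ht => ?_⟩
      simpa using Nat.find_min hex ht
    have hmem : Nat.find hex ∈ F := by
      by_contra hne
      exact h3 ⟨_, hLL _ hL0, by rintro ⟨t, ht, rfl⟩; exact hne ht⟩
    obtain ⟨h4, h5⟩ := h2 _ hmem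
    dsimp only at h4 h5
    rw [sp_length] at h4
    rw [sp_take, min_eq_left h4] at h5
    have := hL0.1
    dsimp only at this
    rw [h5] at this
    simp at this

theorem not_cuppable {A : ℕ → Bool} (hA : KTrivial A) : ¬ WeaklyMLCuppable A := by
  rintro ⟨X, hX, hnX, hj⟩
  apply hnX
  have hS : ∀ S : List Bool → Prop, Sig A S → weight {σ | S σ} < ⊤ → {n | S (strPrefix X n)}.Finite := by
    intro S hS hw
    obtain ⟨S', h1, h2, h3⟩ := LK hA (r := List.length) (by fun_prop) hS hw
    exact (solovay hX h1 h3).subset fun n hn => h2 _ hn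
  obtain ⟨S, hSs, hXS, hd⟩ := dens_zero hS (hC_of_ktrivial hA hj)
  obtain ⟨U, hU, hUS, hUs⟩ := sig_ext hSs
  rw [← hUS] at hXS hd
  have hmin : Sig A (fun η => U η = true ∧ (η = [] ∨ U η.dropLast = false)) := by
    refine sig_and (hUs true) (sig_or (by fun_prop) (sig_comp (hUs false) (f := fun η : List Bool => η.dropLast) (by fun_prop)))
  have hw : weight (minE U) < ⊤ := by
    rw [← mu_openOf_eq (minE_prefixFree hU)]
    exact measure_lt_top _ _
  obtain ⟨S', h1, h2, h3⟩ := LK hA (r := List.length) (by fun_prop) hmin hw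
  obtain ⟨N, hN⟩ := (solovay hX h1 h3).bddAbove
  have hsub : openOf {σ | U σ = true} ⊆ openOf {σ | S' σ ∧ ¬ σ <+: strPrefix X N} := by
    rw [← openOf_minE]
    intro Y hY
    obtain ⟨k, hk⟩ := mem_openOf.1 hY
    refine mem_openOf.2 ⟨k, h2 _ hk, fun hp => hXS (mem_openOf.2 ⟨k, ?_⟩)⟩
    have := (sp_prefix_iff.1 hp).1
    rw [isPrefixOf_iff, sp_length] at this
    show U _ = true
    rw [this]; exact hk.1
  refine complete_of_dens_zero hX (S := fun σ => S' σ ∧ ¬ σ <+: strPrefix X N) (re_and h1 (by fun_prop)) ?_ ?_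
  · intro h
    obtain ⟨k, hk, hk2⟩ := mem_openOf.1 h
    exact hk2 (sp_mono X (hN hk))
  · intro n
    obtain ⟨k, hk⟩ := hd n
    refine ⟨k, le_trans ?_ hk⟩
    unfold dens
    refine mul_le_mul_left (measure_mono ?_) _
    exact Set.inter_subset_inter_right _ (Set.compl_subset_compl.2 hsub)

theorem generate_cyl : (MeasurableSpace.pi : MeasurableSpace (ℕ → Bool)) =
    MeasurableSpace.generateFrom (Set.range _root_.cylinder) := by
  apply le_antisymm
  · refine iSup_le fun i => ?_
    rw [← measurable_iff_comap_le]
    apply measurable_to_bool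
    have h1 : (fun b : ℕ → Bool => b i) ⁻¹' {true} = ⋃ σ ∈ {σ : List Bool | σ.getD i false = true ∧ i < σ.length}, _root_.cylinder σ := by
      ext Y
      change _ ↔ Y ∈ openOf _
      rw [mem_openOf]
      constructor
      · intro h
        refine ⟨i + 1, ?_, by rw [sp_length]; omega⟩
        rw [sp_getD Y (by omega)]; exact h
      · rintro ⟨n, h1, h2⟩
        rw [sp_length] at h2
        rw [sp_getD Y h2] at h1
        exact h1
    rw [h1]
    refine @MeasurableSet.biUnion _ _ (MeasurableSpace.generateFrom (Set.range _root_.cylinder)) _ _ (Set.to_countable _) fun σ _ => ?_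
    exact MeasurableSpace.measurableSet_generateFrom ⟨σ, rfl⟩
  · apply MeasurableSpace.generateFrom_le
    rintro _ ⟨σ, rfl⟩
    exact measurableSet_cyl σ

theorem mu_ext (ν : Measure (ℕ → Bool)) [IsFiniteMeasure ν] (h : ∀ σ, μCantor (_root_.cylinder σ) = ν (_root_.cylinder σ)) :
    μCantor = ν := by
  refine ext_of_generate_finite (Set.range _root_.cylinder) generate_cyl ?_ ?_ ?_
  · rintro _ ⟨σ, rfl⟩ _ ⟨τ, rfl⟩ hne
    by_cases h1 : σ <+: τ
    · exact ⟨τ, (Set.inter_eq_right.2 (cyl_subset h1)).symm⟩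
    · by_cases h2 : τ <+: σ
      · exact ⟨σ, (Set.inter_eq_left.2 (cyl_subset h2)).symm⟩
      · exact absurd (Set.disjoint_iff_inter_eq_empty.1 (cyl_disjoint h1 h2)) hne.ne_empty
  · rintro _ ⟨σ, rfl⟩; exact h σ
  · have := h []
    have h1 : _root_.cylinder [] = Set.univ := by ext Y; simp [mem_cyl, isPrefixOf_nil]
    rwa [h1] at this

/-- flip one bit -/
def flipAt (i : ℕ) (Y : ℕ → Bool) : ℕ → Bool := Function.update Y i (!Y i)

theorem measurable_flipAt (i : ℕ) : Measurable (flipAt i) := by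
  unfold flipAt
  rw [measurable_pi_iff]
  intro j
  by_cases h : j = i
  · subst h
    simp only [Function.update_self]
    exact (measurable_of_finite (fun b : Bool => !b)).comp (measurable_pi_apply j)
  · simp only [Function.update_of_ne h]
    exact measurable_pi_apply j

theorem flipAt_flipAt (i : ℕ) (Y : ℕ → Bool) : flipAt i (flipAt i Y) = Y := by
  unfold flipAt; simp

theorem map_flipAt (i : ℕ) : μCantor.map (flipAt i) = μCantor := by
  haveI : IsFiniteMeasure (μCantor.map (flipAt i)) := Measure.isFiniteMeasure_map _ _
  refine (mu_ext _ fun σ => ?_).symm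
  rw [Measure.map_apply (measurable_flipAt i) (measurableSet_cyl σ)]
  have h : flipAt i ⁻¹' _root_.cylinder σ = _root_.cylinder (strPrefix (flipAt i (padS σ)) σ.length) := by
    ext Y
    simp only [Set.mem_preimage, mem_cyl, isPrefixOf_iff, sp_length]
    have h2 := isPrefixOf_padS σ
    rw [isPrefixOf_iff] at h2
    nth_rewrite 2 [← h2]
    rw [sp_congr, sp_congr]
    refine forall₂_congr fun j _ => ?_
    unfold flipAt
    by_cases hji : j = i
    · subst hji; simp only [Function.update_self]; cases Y j <;> cases padS σ j <;> simp
    · simp [hji]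
  rw [h, mu_cyl, mu_cyl, sp_length]

/-- invariance under flipping bits in `F` -/
def FInv (i : ℕ) (Q : Set (ℕ → Bool)) : Prop := ∀ Y, flipAt i Y ∈ Q ↔ Y ∈ Q

def zeroOn (F : Finset ℕ) : Set (ℕ → Bool) := {Y | ∀ i ∈ F, Y i = false}

theorem measurableSet_coord (i : ℕ) (b : Bool) : MeasurableSet {Y : ℕ → Bool | Y i = b} :=
  measurableSet_eq_fun (measurable_pi_apply i) measurable_const

theorem measurableSet_zeroOn (F : Finset ℕ) : MeasurableSet (zeroOn F) := by
  have : zeroOn F = ⋂ i ∈ F, {Y | Y i = false} := by ext; simp [zeroOn]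
  rw [this]
  exact F.measurableSet_biInter fun i _ => measurableSet_coord i false

theorem mu_half {i : ℕ} {Q : Set (ℕ → Bool)} (hQ : MeasurableSet Q) (h : FInv i Q) :
    μCantor (Q ∩ {Y | Y i = false}) = 2⁻¹ * μCantor Q := by
  have h1 : μCantor (Q ∩ {Y | Y i = true}) = μCantor (Q ∩ {Y | Y i = false}) := by
    conv_lhs => rw [← map_flipAt i]
    rw [Measure.map_apply (measurable_flipAt i) (hQ.inter (measurableSet_coord i true))]
    congr 1
    ext Y
    simp only [Set.mem_preimage, Set.mem_inter_iff, h Y, Set.mem_ofPred_eq]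
    unfold flipAt; simp
  have h2 : μCantor Q = μCantor (Q ∩ {Y | Y i = false}) + μCantor (Q ∩ {Y | Y i = true}) := by
    rw [← measure_inter_add_sdiff Q (measurableSet_coord i false)]
    congr 2
    ext Y; simp
  rw [h1, ← two_mul] at h2
  rw [h2, ← mul_assoc, ENNReal.inv_mul_cancel (by simp) (by simp), one_mul]

theorem finv_inter {i : ℕ} {Q R : Set (ℕ → Bool)} (h1 : FInv i Q) (h2 : FInv i R) : FInv i (Q ∩ R) := fun Y => by
  simp only [Set.mem_inter_iff, h1 Y, h2 Y]

theorem finv_compl {i : ℕ} {Q : Set (ℕ → Bool)} (h1 : FInv i Q) : FInv i Qᶜ := fun Y => by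
  simp only [Set.mem_compl_iff, h1 Y]

theorem finv_zeroOn {i : ℕ} {F : Finset ℕ} (h : i ∉ F) : FInv i (zeroOn F) := fun Y => by
  simp only [zeroOn, Set.mem_ofPred_eq]
  refine forall₂_congr fun j hj => ?_
  have : j ≠ i := by rintro rfl; exact h hj
  unfold flipAt; simp [this]

theorem finv_cyl {i : ℕ} {ρ : List Bool} (h : ρ.length ≤ i) : FInv i (_root_.cylinder ρ) := fun Y => by
  simp only [mem_cyl, isPrefixOf_iff]
  have : strPrefix (flipAt i Y) ρ.length = strPrefix Y ρ.length := by
    rw [sp_congr]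
    intro j hj
    have : j ≠ i := by omega
    unfold flipAt; simp [this]
  rw [this]

theorem mu_zeroOn {F : Finset ℕ} {Q : Set (ℕ → Bool)} (hQ : MeasurableSet Q) (h : ∀ i ∈ F, FInv i Q) :
    μCantor (Q ∩ zeroOn F) = 2⁻¹ ^ F.card * μCantor Q := by
  classical
  induction F using Finset.induction_on with
  | empty => simp [zeroOn]
  | insert i F hi ih =>
    have h1 : Q ∩ zeroOn (insert i F) = (Q ∩ zeroOn F) ∩ {Y | Y i = false} := by
      ext Y
      simp only [zeroOn, Finset.forall_mem_insert, Set.mem_inter_iff, Set.mem_ofPred_eq]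
      tauto
    rw [h1, mu_half (hQ.inter (measurableSet_zeroOn F))
      (finv_inter (h i (Finset.mem_insert_self _ _)) (finv_zeroOn hi)),
      ih fun j hj => h j (Finset.mem_insert_of_mem hj), Finset.card_insert_of_notMem hi, pow_succ]
    ring

theorem mu_avoid {ι : Type} (G : Finset ι) (F : ι → Finset ℕ) (hd : ∀ a ∈ G, ∀ b ∈ G, a ≠ b → Disjoint (F a) (F b))
    {Q : Set (ℕ → Bool)} (hQ : MeasurableSet Q) (h : ∀ a ∈ G, ∀ i ∈ F a, FInv i Q) :
    μCantor (Q ∩ ⋂ a ∈ G, (zeroOn (F a))ᶜ) ≤ ENNReal.ofReal (Real.exp (- ∑ a ∈ G, (1 / 2) ^ (F a).card)) := by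
  classical
  have key : MeasurableSet (Q ∩ ⋂ a ∈ G, (zeroOn (F a))ᶜ) ∧ (∀ i, FInv i Q → (∀ a ∈ G, i ∉ F a) →
      FInv i (Q ∩ ⋂ a ∈ G, (zeroOn (F a))ᶜ)) ∧
      μCantor (Q ∩ ⋂ a ∈ G, (zeroOn (F a))ᶜ) ≤ ENNReal.ofReal (Real.exp (- ∑ a ∈ G, (1 / 2) ^ (F a).card)) := by
    induction G using Finset.induction_on with
    | empty =>
      simp only [Finset.notMem_empty, Set.iInter_of_empty, Set.iInter_univ, Set.inter_univ, Finset.sum_empty,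
        neg_zero, Real.exp_zero, ENNReal.ofReal_one]
      exact ⟨hQ, fun i hi _ => hi, prob_le_one⟩
    | insert a G ha ih =>
      obtain ⟨i1, i2, i3⟩ := ih (fun b hb c hc => hd b (Finset.mem_insert_of_mem hb) c (Finset.mem_insert_of_mem hc))
        (fun b hb => h b (Finset.mem_insert_of_mem hb))
      set R := Q ∩ ⋂ a ∈ G, (zeroOn (F a))ᶜ with hR
      have e : Q ∩ ⋂ b ∈ insert a G, (zeroOn (F b))ᶜ = R ∩ (zeroOn (F a))ᶜ := by
        rw [Finset.set_biInter_insert, hR, Set.inter_assoc, Set.inter_comm ((zeroOn (F a))ᶜ)]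
      rw [e]
      refine ⟨i1.inter (measurableSet_zeroOn _).compl, ?_, ?_⟩
      · intro i hi hia
        exact finv_inter (i2 i hi fun b hb => hia b (Finset.mem_insert_of_mem hb))
          (finv_compl (finv_zeroOn (hia a (Finset.mem_insert_self _ _))))
      · have h1 : ∀ i ∈ F a, FInv i R := by
          intro i hi
          refine i2 i (h a (Finset.mem_insert_self _ _) i hi) fun b hb hib => ?_
          have hne : a ≠ b := by rintro rfl; exact ha hb
          exact Finset.disjoint_left.1 (hd a (Finset.mem_insert_self _ _) b (Finset.mem_insert_of_mem hb) hne) hi hib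
        have h2 := mu_zeroOn i1 h1
        have h3 : μCantor (R ∩ (zeroOn (F a))ᶜ) = μCantor R - μCantor (R ∩ zeroOn (F a)) := by
          rw [← measure_inter_add_sdiff R (measurableSet_zeroOn (F a)), ← Set.sdiff_eq,
            ENNReal.add_sub_cancel_left (measure_ne_top _ _)]
        rw [h3, h2, tsub_le_iff_right]
        have h4 : μCantor R = ENNReal.ofReal (μCantor R).toReal := (ENNReal.ofReal_toReal (measure_ne_top _ _)).symm
        set m := (μCantor R).toReal
        have hm : 0 ≤ m := ENNReal.toReal_nonneg
        rw [h4, e2, ← ENNReal.ofReal_mul (by positivity), ← ENNReal.ofReal_add (by positivity) (by positivity)]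
        rw [h4] at i3
        apply ENNReal.ofReal_le_ofReal
        have i4 := (ENNReal.ofReal_le_ofReal_iff (by positivity)).1 i3
        rw [Finset.sum_insert ha, neg_add, Real.exp_add]
        set x : ℝ := (1 / 2) ^ (F a).card
        have h5 : 1 - x ≤ Real.exp (-x) := by have := Real.add_one_le_exp (-x); linarith
        have h6 : 0 ≤ 1 - x := by
          have : x ≤ 1 := pow_le_one₀ (by norm_num) (by norm_num)
          linarith
        have : (1 - x) * m ≤ Real.exp (-x) * Real.exp (-∑ a ∈ G, (1 / 2) ^ (F a).card) :=
          mul_le_mul h5 i4 hm (Real.exp_pos _).le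
        linarith
  exact key.2.2

noncomputable def gR : (ℕ × ℕ) × ℕ → Bool := (re_stage re_Rset).choose
theorem gR_pr : Primrec gR := (re_stage re_Rset).choose_spec.1
theorem gR_mono : ∀ a s t, s ≤ t → gR (a, s) = true → gR (a, t) = true := (re_stage re_Rset).choose_spec.2.1
theorem gR_spec : ∀ a, Rset a ↔ ∃ s, gR (a, s) = true := (re_stage re_Rset).choose_spec.2.2

def uR (u : ℕ) : ℕ := u.unpair.1
def uN (u : ℕ) : ℕ := u.unpair.2.unpair.1
def uS (u : ℕ) : ℕ := u.unpair.2.unpair.2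

theorem uN_le (u : ℕ) : uN u ≤ u := (Nat.unpair_left_le _).trans (Nat.unpair_right_le _)

/-- `u` codes the entry of a description into the enumeration -/
def valid (u : ℕ) : Prop := gR ((uR u, one (uN u)), uS u) = true ∧ ∀ t < uS u, gR ((uR u, one (uN u)), t) = false

theorem valid_inj {u v : ℕ} (hu : valid u) (hv : valid v) (h1 : uR u = uR v) (h2 : uN u = uN v) : u = v := by
  have h3 : uS u = uS v := by
    by_contra hne
    rcases Nat.lt_or_gt_of_ne hne with h | h
    · have := hv.2 _ h; rw [← h1, ← h2, hu.1] at this; simp at this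
    · have := hu.2 _ h; rw [h1, h2, hv.1] at this; simp at this
  unfold uR uN uS at *
  rw [← Nat.pair_unpair u, ← Nat.pair_unpair v, h1, ← Nat.pair_unpair u.unpair.2, ← Nat.pair_unpair v.unpair.2, h2, h3]

theorem exists_valid {r n : ℕ} (h : Rset (r, one n)) : ∃ u, valid u ∧ uR u = r ∧ uN u = n := by
  have hex := (gR_spec _).1 h
  refine ⟨Nat.pair r (Nat.pair n (Nat.find hex)), ?_, by simp [uR], by simp [uN]⟩
  simp only [valid, uR, uN, uS, Nat.unpair_pair]
  refine ⟨Nat.find_spec hex, fun t ht => ?_⟩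
  simpa using Nat.find_min hex ht

open Classical in
noncomputable def uw (u : ℕ) : ℝ≥0∞ := if valid u then 2⁻¹ ^ uR u else 0

theorem uw_sum : ∑' u, uw u < ⊤ := by
  have h1 : ∑' u, uw u = wtf uR {u | valid u} := by
    unfold wtf
    rw [tsum_subtype {u | valid u} (fun u => (2⁻¹ : ℝ≥0∞) ^ uR u)]
    congr 1
  rw [h1]
  refine lt_of_le_of_lt (wtf_inj_le _ Prod.fst (fun u => (uR u, one (uN u))) _ {x | Rset x} ?_ ?_ ?_) Rset_wt
  · intro u hu v hv h
    simp only [Prod.mk.injEq] at h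
    exact valid_inj hu hv h.1 (one_inj h.2)
  · intro u hu
    exact (gR_spec _).2 ⟨_, hu.1⟩
  · intro u _; exact le_rfl

theorem uw_tail {ε : ℝ≥0∞} (hε : 0 < ε) : ∃ T, ∀ t ≥ T, ∑' u, uw (u + t) ≤ ε := by
  have := ENNReal.tendsto_sum_nat_add uw uw_sum.ne
  have h2 := this.eventually (ge_mem_nhds hε)
  exact Filter.eventually_atTop.1 h2

/-- the block of bits attached to `(r,x)` after the first `l` bits -/
def blk (l r x : ℕ) : Finset ℕ := (Finset.range r).image fun j => l + Nat.pair (Nat.pair r x) j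

theorem blk_card (l r x : ℕ) : (blk l r x).card = r := by
  unfold blk
  rw [Finset.card_image_of_injective, Finset.card_range]
  intro i j h
  simpa using h

theorem blk_disj (l : ℕ) {a b : ℕ × ℕ} (h : a ≠ b) : Disjoint (blk l a.1 a.2) (blk l b.1 b.2) := by
  rw [Finset.disjoint_left]
  intro i h1 h2
  simp only [blk, Finset.mem_image] at h1 h2
  obtain ⟨j, -, rfl⟩ := h1
  obtain ⟨k, -, h3⟩ := h2
  have h4 := Nat.pair_eq_pair.1 (Nat.add_left_cancel h3)
  have h5 := Nat.pair_eq_pair.1 h4.1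
  exact h (Prod.ext h5.1.symm h5.2.symm)

theorem mem_zeroOn_blk {l r x : ℕ} {Y : ℕ → Bool} :
    Y ∈ zeroOn (blk l r x) ↔ ∀ j < r, Y (l + Nat.pair (Nat.pair r x) j) = false := by
  simp [zeroOn, blk]

def hit (A : ℕ → Bool) (l u : ℕ) (Y : ℕ → Bool) : Prop :=
  valid u ∧ Y ∈ zeroOn (blk l (uR u) (Encodable.encode (strPrefix A (uN u))))

theorem blk_finv {ρ : List Bool} {r x : ℕ} : ∀ i ∈ blk ρ.length r x, FInv i (_root_.cylinder ρ) := by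
  intro i hi
  simp only [blk, Finset.mem_image] at hi
  obtain ⟨j, -, rfl⟩ := hi
  exact finv_cyl (by omega)

theorem mu_hit (A : ℕ → Bool) (ρ : List Bool) (u : ℕ) :
    μCantor (_root_.cylinder ρ ∩ {Y | hit A ρ.length u Y}) ≤ uw u * 2⁻¹ ^ ρ.length := by
  unfold uw
  split_ifs with h
  · have : {Y | hit A ρ.length u Y} = zeroOn (blk ρ.length (uR u) (Encodable.encode (strPrefix A (uN u)))) := by
      ext Y; simp [hit, h]
    rw [this, mu_zeroOn (measurableSet_cyl ρ) blk_finv, blk_card, mu_cyl]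
  · have : {Y | hit A ρ.length u Y} = ∅ := by
      ext Y; simp [hit, h]
    rw [this]; simp

theorem re_disj {ρ : List Bool} {S : List Bool → Prop} (hS : REPred S) :
    REPred (fun a : ℕ × ℕ => ∀ Y ∈ _root_.cylinder ρ ∩ (openOf {σ | S σ})ᶜ, Y ∉ zeroOn (blk ρ.length a.1 a.2)) := by
  obtain ⟨U, hUp, hU, hUS⟩ := re_ext hS
  rw [← hUS]
  let V : ℕ × ℕ → List Bool → Bool := fun a η => U η || decide (ρ.length ≤ η.length ∧ ¬ ρ <+: η) ||
    decide (∃ j < a.1, ρ.length + Nat.pair (Nat.pair a.1 a.2) j < η.length ∧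
      η.getD (ρ.length + Nat.pair (Nat.pair a.1 a.2) j) false = true)
  have hV : Primrec (fun x : (ℕ × ℕ) × List Bool => V x.1 x.2) := by unfold V; fun_prop
  have hVE : ∀ a, ExtC (V a) := by
    intro a σ τ h1 h2
    have hl := h1.length_le
    simp only [V, Bool.or_eq_true, decide_eq_true_eq] at h2 ⊢
    rcases h2 with (h2 | ⟨h2, h3⟩) | ⟨j, hj, h2, h3⟩
    · exact Or.inl (Or.inl (hU _ _ h1 h2))
    · refine Or.inl (Or.inr ⟨by omega, fun h4 => h3 ?_⟩)
      exact List.prefix_of_prefix_length_le h4 h1 h2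
    · refine Or.inr ⟨j, hj, by omega, ?_⟩
      obtain ⟨t, rfl⟩ := h1
      rw [List.getD_append _ _ _ _ h2]; exact h3
  have h1 : REPred (fun a : ℕ × ℕ => ∃ N, ∀ η ∈ allStr N, V a η = true) := by
    apply re_ex
    apply re_of_pp
    fun_prop
  refine h1.of_eq fun a => ?_
  constructor
  · rintro ⟨N, hN⟩ Y ⟨h1, h2⟩ h3
    have := hVE a _ _ (sp_mono Y (show N ≤ max N ρ.length from le_max_left _ _)) (hN (strPrefix Y N) (mem_allStr.2 (sp_length _ _)))
    simp only [V, Bool.or_eq_true, decide_eq_true_eq, sp_length] at this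
    rcases this with (h | ⟨-, h⟩) | ⟨j, hj, h4, h5⟩
    · exact h2 (mem_openOf.2 ⟨_, h⟩)
    · exact h (sp_prefix_iff.2 ⟨h1, le_max_right _ _⟩)
    · rw [sp_getD Y h4, mem_zeroOn_blk.1 h3 j hj] at h5
      simp at h5
  · intro h
    obtain ⟨N, hN⟩ := bar_lemma (hVE a) (by
      intro Y
      by_cases h1 : Y ∈ _root_.cylinder ρ
      · by_cases h2 : Y ∈ openOf {σ | U σ = true}
        · obtain ⟨n, hn⟩ := mem_openOf.1 h2
          exact ⟨n, by simp only [V, Bool.or_eq_true]; exact Or.inl (Or.inl hn)⟩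
        · have h3 := h Y ⟨h1, h2⟩
          rw [mem_zeroOn_blk] at h3
          push Not at h3
          obtain ⟨j, hj, h4⟩ := h3
          refine ⟨ρ.length + Nat.pair (Nat.pair a.1 a.2) j + 1, ?_⟩
          simp only [V, Bool.or_eq_true, decide_eq_true_eq, sp_length]
          refine Or.inr ⟨j, hj, by omega, ?_⟩
          rw [sp_getD Y (by omega)]; simpa using h4
      · refine ⟨ρ.length, ?_⟩
        simp only [V, Bool.or_eq_true, decide_eq_true_eq, sp_length]
        refine Or.inl (Or.inr ⟨le_rfl, fun h => h1 (sp_prefix_iff.1 h).1⟩))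
    exact ⟨N, fun η hη => hN η (mem_allStr.1 hη)⟩

theorem claim {A : ℕ → Bool} (hA : ¬ KTrivial A) {ρ : List Bool} {S : List Bool → Prop} (hS : REPred S)
    (hμ : 0 < μCantor (_root_.cylinder ρ ∩ (openOf {σ | S σ})ᶜ)) (t : ℕ) :
    ∃ u ≥ t, ∃ Y ∈ _root_.cylinder ρ ∩ (openOf {σ | S σ})ᶜ, hit A ρ.length u Y := by
  by_contra hcon
  push Not at hcon
  apply hA
  have hre := re_disj (ρ := ρ) hS
  set P := _root_.cylinder ρ ∩ (openOf {σ | S σ})ᶜ with hP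
  have hw : wtf Prod.fst {a : ℕ × ℕ | ∀ Y ∈ P, Y ∉ zeroOn (blk ρ.length a.1 a.2)} < ⊤ := by
    refine lt_of_le_of_lt (wtf_le_of_finset _ (C := ENNReal.ofReal (- Real.log (μCantor P).toReal)) ?_) ENNReal.ofReal_lt_top
    intro G hG
    have h1 := mu_avoid G (fun a => blk ρ.length a.1 a.2) (fun a _ b _ h => blk_disj _ h) (measurableSet_cyl ρ)
      (fun a _ => blk_finv)
    have h2 : P ⊆ _root_.cylinder ρ ∩ ⋂ a ∈ G, (zeroOn (blk ρ.length a.1 a.2))ᶜ := by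
      intro Y hY
      refine ⟨hY.1, ?_⟩
      simp only [Set.mem_iInter]
      intro a ha
      exact hG ha Y hY
    have h3 := (measure_mono h2).trans h1
    simp only [blk_card] at h3
    have hfin : μCantor P ≠ ⊤ := measure_ne_top _ _
    have hpos : 0 < (μCantor P).toReal := ENNReal.toReal_pos hμ.ne' hfin
    rw [← ENNReal.ofReal_toReal hfin] at h3
    have h4 := (ENNReal.ofReal_le_ofReal_iff (Real.exp_pos _).le).1 h3
    have h5 := Real.log_le_log hpos h4
    rw [Real.log_exp] at h5
    have h6 : ∑ x ∈ G, (2⁻¹ : ℝ≥0∞) ^ x.1 = ENNReal.ofReal (∑ a ∈ G, (1 / 2 : ℝ) ^ a.1) := by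
      rw [ENNReal.ofReal_sum_of_nonneg (fun _ _ => by positivity)]
      simp only [e2]
    rw [h6]
    apply ENNReal.ofReal_le_ofReal
    linarith
  obtain ⟨d, hd⟩ := kraft hre hw
  have h1 : ∀ n ≥ t, Kcpx (Encodable.encode (strPrefix A n)) ≤ KofNat n + d := by
    intro n hn
    obtain ⟨u, h1, h2, h3⟩ := exists_valid (Rset_K (one n))
    have hut : u ≥ t := by have := uN_le u; omega
    have := hd (KofNat n) (Encodable.encode (strPrefix A n)) (by
      intro Y hY h4
      apply hcon u hut Y hY
      refine ⟨h1, ?_⟩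
      rw [h2, h3]; exact h4)
    exact this
  refine ⟨d + ∑ n ∈ Finset.range t, Kcpx (Encodable.encode (strPrefix A n)), fun n => ?_⟩
  by_cases hn : n < t
  · have := Finset.single_le_sum (f := fun n => Kcpx (Encodable.encode (strPrefix A n))) (fun _ _ => Nat.zero_le _)
      (Finset.mem_range.2 hn)
    omega
  · have := h1 n (by omega)
    omega

noncomputable def lenA (A : ℕ → Bool) (u : ℕ) : ℕ :=
  ((List.range (u + 1)).map fun v => Nat.pair (Nat.pair (uR v) (Encodable.encode (strPrefix A (uN v)))) (uR v) + 1).sum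

theorem lenA_gt (A : ℕ → Bool) {u v j : ℕ} (h : v ≤ u) (hj : j < uR v) :
    Nat.pair (Nat.pair (uR v) (Encodable.encode (strPrefix A (uN v)))) j < lenA A u := by
  have h1 : Nat.pair (Nat.pair (uR v) (Encodable.encode (strPrefix A (uN v)))) (uR v) + 1 ≤ lenA A u := by
    unfold lenA
    apply List.le_sum_of_mem
    rw [List.mem_map]
    exact ⟨v, List.mem_range.2 (by omega), rfl⟩
  have h2 := Nat.pair_lt_pair_right (Nat.pair (uR v) (Encodable.encode (strPrefix A (uN v)))) hj
  omega

theorem lenA_pos (A : ℕ → Bool) (u : ℕ) : 0 < lenA A u := by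
  unfold lenA
  rw [List.range_succ, List.map_append, List.sum_append]
  simp

theorem hit_congr {A : ℕ → Bool} {l u v : ℕ} (h : v ≤ u) {Y Z : ℕ → Bool}
    (hYZ : strPrefix Y (l + lenA A u) = strPrefix Z (l + lenA A u)) : hit A l v Y ↔ hit A l v Z := by
  unfold hit
  rw [mem_zeroOn_blk, mem_zeroOn_blk]
  refine and_congr_right fun _ => forall₂_congr fun j hj => ?_
  rw [sp_congr.1 hYZ _ (by have := lenA_gt A h hj; omega)]

def PiC (P : Set (ℕ → Bool)) : Prop := ∃ S : List Bool → Prop, REPred S ∧ P = (openOf {σ | S σ})ᶜ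

theorem PiC.inter {P Q : Set (ℕ → Bool)} (hP : PiC P) (hQ : PiC Q) : PiC (P ∩ Q) := by
  obtain ⟨S, hS, rfl⟩ := hP
  obtain ⟨T, hT, rfl⟩ := hQ
  refine ⟨fun σ => S σ ∨ T σ, re_or hS hT, ?_⟩
  rw [← Set.compl_union]
  congr 1
  ext X
  simp only [Set.mem_union, mem_openOf, Set.mem_ofPred_eq, exists_or]

theorem PiC.meas {P : Set (ℕ → Bool)} (hP : PiC P) : MeasurableSet P := by
  obtain ⟨S, hS, rfl⟩ := hP
  exact (measurableSet_openOf _).compl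

theorem piC_lvl (p : List Bool → Bool) (s : ℕ) : PiC (lvl p s) := by
  refine ⟨fun σ => ∃ b ∈ (allStr s).filter (fun η => ! p η), b = σ, re_of_pp (by fun_prop), ?_⟩
  ext X
  simp only [lvl, Set.mem_ofPred_eq, Set.mem_compl_iff, mem_openOf, List.mem_filter, mem_allStr, Bool.not_eq_true',
    exists_eq_right, sp_length]
  constructor
  · rintro h ⟨n, rfl, h2⟩; rw [h] at h2; simp at h2
  · intro h
    by_contra h2
    exact h ⟨s, rfl, by simpa using h2⟩

theorem piC_test (i n : ℕ) : PiC (testLevel i emptyOracle n)ᶜ := by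
  refine ⟨fun σ => ∃ m, OracleComputes i emptyOracle (Nat.pair n (Encodable.encode σ)) m, ?_, rfl⟩
  apply re_of_sig_empty
  apply sig_ex
  exact sig_comp (sig_oracle emptyOracle) (f := fun x : List Bool × ℕ => (i, Nat.pair n (Encodable.encode x.1), x.2)) (by fun_prop)

theorem re_W (i : ℕ) : REPred (fun σ : List Bool => WEnum i (Encodable.encode σ)) :=
  re_comp re_WEnum (f := fun σ : List Bool => (i, Encodable.encode σ)) (by fun_prop)

theorem trim {P : Set (ℕ → Bool)} (hP : PiC P) (ρ : List Bool) (e : ℕ) : ∃ P', PiC P' ∧ P' ⊆ P ∧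
    (∀ Y ∈ P', ∀ k ≥ ρ.length, 2⁻¹ ^ e ≤ dens (strPrefix Y k) P) ∧
    μCantor (_root_.cylinder ρ ∩ P) ≤ μCantor (_root_.cylinder ρ ∩ P') + 2⁻¹ ^ (e + ρ.length) := by
  obtain ⟨S, hS, rfl⟩ := hP
  obtain ⟨U, hUp, hU, hUS⟩ := re_ext hS
  rw [← hUS]
  let S' : List Bool → Prop := fun τ => U τ = true ∨ (ρ.length ≤ τ.length ∧ ∃ s, τ.length ≤ s ∧
    2 ^ e * 2 ^ (s - τ.length) ≤ 2 ^ e * cnt (fun η => decide (τ <+: η) && U η) s + 2 ^ (s - τ.length))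
  have hS' : REPred S' := by
    unfold S'
    refine re_or (re_of_pp (by fun_prop)) (re_and (re_of_pp (by fun_prop)) (re_ex (re_of_pp (by fun_prop))))
  have hsub : (openOf {σ | S' σ})ᶜ ⊆ (openOf {σ | U σ = true})ᶜ := by
    intro Y hY h
    obtain ⟨n, hn⟩ := mem_openOf.1 h
    exact hY (mem_openOf.2 ⟨n, Or.inl hn⟩)
  refine ⟨(openOf {σ | S' σ})ᶜ, ⟨S', hS', rfl⟩, hsub, ?_, ?_⟩
  · intro Y hY k hk
    by_contra hlt
    push Not at hlt
    obtain ⟨s, -, h1, h2⟩ := cnt_of_dens hU 0 hlt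
    exact hY (mem_openOf.2 ⟨k, Or.inr ⟨by rw [sp_length]; exact hk, s, h1, h2⟩⟩)
  · set Z := _root_.cylinder ρ ∩ ((openOf {σ | U σ = true})ᶜ \ (openOf {σ | S' σ})ᶜ) with hZ
    have h1 : μCantor Z ≤ 2⁻¹ ^ e * 2⁻¹ ^ ρ.length := by
      refine cover_dens (P := (openOf {σ | U σ = true})ᶜ) (fun Y hY => hY.2.1) (fun Y hY => hY.1) ?_
      rintro Y ⟨h1, h2, h3⟩
      rw [Set.mem_compl_iff, not_not] at h3
      obtain ⟨k, hk⟩ := mem_openOf.1 h3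
      rcases hk with hk | ⟨h4, s, h5, h6⟩
      · exact absurd (mem_openOf.2 ⟨k, hk⟩) h2
      · refine ⟨k, by rwa [sp_length] at h4, dens_le_of_cnt h5 ?_ h6⟩
        intro W _ hW
        exact mem_openOf.2 ⟨_, hW⟩
    calc _ ≤ μCantor (_root_.cylinder ρ ∩ (openOf {σ | S' σ})ᶜ ∪ Z) := by
          apply measure_mono
          rintro Y ⟨h1, h2⟩
          by_cases h3 : Y ∈ (openOf {σ | S' σ})ᶜ
          · exact Or.inl ⟨h1, h3⟩
          · exact Or.inr ⟨h1, h2, h3⟩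
      _ ≤ _ := measure_union_le _ _
      _ ≤ _ := by rw [pow_add]; gcongr

theorem avoid_hits (A : ℕ → Bool) {P : Set (ℕ → Bool)} (hP : PiC P) (ρ : List Bool) {t d : ℕ}
    (ht : ∑' u, uw (u + t) ≤ 2⁻¹ ^ d) (T : ℕ) :
    ∃ P', PiC P' ∧ P' ⊆ P ∧ (∀ Y ∈ P', ∀ u, t ≤ u → u < T → ¬ hit A ρ.length u Y) ∧
    μCantor (_root_.cylinder ρ ∩ P) ≤ μCantor (_root_.cylinder ρ ∩ P') + 2⁻¹ ^ (d + ρ.length) := by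
  classical
  set s := ρ.length + lenA A T with hs
  let p : List Bool → Bool := fun η => decide (∀ u, t ≤ u → u < T → ¬ hit A ρ.length u (padS η))
  have hp : ∀ Y, Y ∈ lvl p s ↔ ∀ u, t ≤ u → u < T → ¬ hit A ρ.length u Y := by
    intro Y
    simp only [lvl, Set.mem_ofPred_eq, p, decide_eq_true_eq]
    refine forall_congr' fun u => forall₂_congr fun _ hu => not_congr ?_
    apply hit_congr hu.le
    rw [← hs]
    have := sp_padS (strPrefix Y s)
    rwa [sp_length] at this
  refine ⟨P ∩ lvl p s, hP.inter (piC_lvl p s), Set.inter_subset_left, fun Y hY => (hp Y).1 hY.2, ?_⟩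
  set Z := ⋃ u ∈ Finset.Ico t T, _root_.cylinder ρ ∩ {Y | hit A ρ.length u Y} with hZ
  have h1 : μCantor Z ≤ 2⁻¹ ^ d * 2⁻¹ ^ ρ.length := by
    calc _ ≤ ∑ u ∈ Finset.Ico t T, μCantor (_root_.cylinder ρ ∩ {Y | hit A ρ.length u Y}) := measure_biUnion_finset_le _ _
      _ ≤ ∑ u ∈ Finset.Ico t T, uw u * 2⁻¹ ^ ρ.length := Finset.sum_le_sum fun u _ => mu_hit A ρ u
      _ = (∑ u ∈ Finset.range (T - t), uw (u + t)) * 2⁻¹ ^ ρ.length := by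
        rw [← Finset.sum_mul, Finset.sum_Ico_eq_sum_range]
        simp only [add_comm t]
      _ ≤ _ := by
        gcongr
        exact (ENNReal.sum_le_tsum _).trans ht
  calc _ ≤ μCantor (_root_.cylinder ρ ∩ (P ∩ lvl p s) ∪ Z) := by
        apply measure_mono
        rintro Y ⟨h1, h2⟩
        by_cases h3 : Y ∈ lvl p s
        · exact Or.inl ⟨h1, h2, h3⟩
        · right
          rw [hp] at h3
          push Not at h3
          obtain ⟨u, a1, a2, a3⟩ := h3
          rw [hZ, Set.mem_iUnion₂]
          exact ⟨u, Finset.mem_Ico.2 ⟨a1, a2⟩, h1, a3⟩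
    _ ≤ _ := measure_union_le _ _
    _ ≤ _ := by rw [pow_add]; gcongr

theorem ar1 {q x y z : ℝ≥0∞} (hq : q ≠ ⊤) (hx : x ≠ ⊤) (hy : y ≠ ⊤) (hz : z ≠ ⊤) (h1 : 64 * q ≤ x) (h2 : x ≤ y + 8 * q)
    (hz1 : z < 8 * q) : 8 * q + z < y := by
  lift q to NNReal using hq
  lift x to NNReal using hx
  lift y to NNReal using hy
  lift z to NNReal using hz
  norm_cast at *
  rw [← NNReal.coe_le_coe] at *
  rw [← NNReal.coe_lt_coe] at *
  push_cast at *
  linarith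

theorem ar2 {q b c d : ℝ≥0∞} (hq : q ≠ ⊤) (hq0 : 0 < q) (hb : b ≠ ⊤) (hc : c ≠ ⊤) (hd : d ≠ ⊤) (h1 : 8 * q ≤ b) (h2 : b ≤ c + q)
    (h3 : c ≤ d + q) (h4 : d ≤ q) : False := by
  lift q to NNReal using hq
  lift b to NNReal using hb
  lift c to NNReal using hc
  lift d to NNReal using hd
  norm_cast at *
  rw [← NNReal.coe_le_coe] at *
  rw [← NNReal.coe_lt_coe] at *
  push_cast at *
  linarith

theorem pow_q (d k : ℕ) : (2⁻¹ : ℝ≥0∞) ^ k = 2 ^ d * 2⁻¹ ^ (d + k) := by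
  rw [pow_add, ← mul_assoc, ← mul_pow, ENNReal.mul_inv_cancel (by simp) (by simp), one_pow, one_mul]

def StInv (d : ℕ) (ρ : List Bool) (P : Set (ℕ → Bool)) (t : ℕ) : Prop :=
  PiC P ∧ 2⁻¹ ^ (d + ρ.length) ≤ μCantor (_root_.cylinder ρ ∩ P) ∧ ∑' u, uw (u + t) ≤ 2⁻¹ ^ (d + 6)

def QW (i : ℕ) : Set (ℕ → Bool) := (openOf {σ | WEnum i (Encodable.encode σ)})ᶜ

theorem dens_mono (τ : List Bool) {P Q : Set (ℕ → Bool)} (h : P ⊆ Q) : dens τ P ≤ dens τ Q := by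
  unfold dens
  gcongr

theorem step {A : ℕ → Bool} (hA : ¬ KTrivial A) {d : ℕ} {ρ : List Bool} {P : Set (ℕ → Bool)} {t : ℕ} (hI : StInv d ρ P t)
    (i m : ℕ) : ∃ d' ρ' P' t', StInv d' ρ' P' t' ∧ P' ⊆ P ∧ ρ <+: ρ' ∧
      ((∀ n, μCantor (testLevel i emptyOracle n) ≤ 2⁻¹ ^ n) → ∃ n, P' ∩ testLevel i emptyOracle n = ∅) ∧
      (P' ∩ QW i = ∅ ∨ ∀ Y ∈ P', ∀ k ≥ ρ.length, 2⁻¹ ^ d' ≤ dens (strPrefix Y k) (QW i)) ∧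
      t ≤ t' ∧ m ≤ t' ∧ ρ'.length = ρ.length + lenA A t' ∧
      ∀ Y ∈ _root_.cylinder ρ', hit A ρ.length t' Y ∧ ∀ u, t ≤ u → u < t' → ¬ hit A ρ.length u Y := by
  classical
  obtain ⟨hP, hμ, htl⟩ := hI
  set q : ℝ≥0∞ := 2⁻¹ ^ (d + 6 + ρ.length) with hq
  have hq0 : 0 < q := by rw [hq]; exact ENNReal.pow_pos (by simp) _
  have hqt : q ≠ ⊤ := by rw [hq]; exact ENNReal.pow_ne_top (by simp)
  have hfin : ∀ Z, μCantor Z ≠ ⊤ := fun Z => measure_ne_top _ _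
  have h64 : 64 * q ≤ μCantor (_root_.cylinder ρ ∩ P) := by
    refine le_trans (le_of_eq ?_) hμ
    rw [pow_q 6 (d + ρ.length), hq, show 6 + (d + ρ.length) = d + 6 + ρ.length by omega]
    norm_num
  -- step (a)
  obtain ⟨Pa, hPa, hPaP, ha1, ha2⟩ : ∃ Pa, PiC Pa ∧ Pa ⊆ P ∧
      ((∀ n, μCantor (testLevel i emptyOracle n) ≤ 2⁻¹ ^ n) → ∃ n, Pa ∩ testLevel i emptyOracle n = ∅) ∧
      μCantor (_root_.cylinder ρ ∩ P) ≤ μCantor (_root_.cylinder ρ ∩ Pa) + 8 * q := by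
    by_cases ht : ∀ n, μCantor (testLevel i emptyOracle n) ≤ 2⁻¹ ^ n
    · set n := d + 3 + ρ.length with hn
      refine ⟨P ∩ (testLevel i emptyOracle n)ᶜ, hP.inter (piC_test i n), Set.inter_subset_left, fun _ => ⟨n, ?_⟩, ?_⟩
      · ext Y; simp
      · have h8 : (2⁻¹ : ℝ≥0∞) ^ n = 8 * q := by
          rw [pow_q 3 n, hq, show 3 + n = d + 6 + ρ.length by omega]; norm_num
        rw [← h8]
        calc _ ≤ μCantor (_root_.cylinder ρ ∩ (P ∩ (testLevel i emptyOracle n)ᶜ) ∪ testLevel i emptyOracle n) := by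
              apply measure_mono
              rintro Y ⟨h1, h2⟩
              by_cases h3 : Y ∈ testLevel i emptyOracle n
              · exact Or.inr h3
              · exact Or.inl ⟨h1, h2, h3⟩
          _ ≤ _ := measure_union_le _ _
          _ ≤ _ := by gcongr; exact ht n
    · exact ⟨P, hP, subset_rfl, fun h => absurd h ht, le_self_add⟩
  -- step (b)
  obtain ⟨Pb, hPb, hPbPa, hb1, hb2⟩ : ∃ Pb, PiC Pb ∧ Pb ⊆ Pa ∧ (Pb ∩ QW i = ∅ ∨ Pb ⊆ QW i) ∧
      8 * q ≤ μCantor (_root_.cylinder ρ ∩ Pb) := by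
    by_cases hc : 8 * q ≤ μCantor (_root_.cylinder ρ ∩ (Pa ∩ QW i))
    · exact ⟨Pa ∩ QW i, hPa.inter ⟨_, re_W i, rfl⟩, Set.inter_subset_left, Or.inr Set.inter_subset_right, hc⟩
    · push Not at hc
      obtain ⟨U, hUp, hU, hUS⟩ := re_ext (re_W i)
      have h1 := ar1 hqt (hfin _) (hfin _) (hfin _) h64 ha2 hc
      have h2 : μCantor (_root_.cylinder ρ ∩ Pa) ≤ μCantor (_root_.cylinder ρ ∩ (Pa ∩ (QW i)ᶜ)) + μCantor (_root_.cylinder ρ ∩ (Pa ∩ QW i)) := by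
        refine le_trans (measure_mono ?_) (measure_union_le _ _)
        rintro Y ⟨h1, h2⟩
        by_cases h3 : Y ∈ QW i
        · exact Or.inr ⟨h1, h2, h3⟩
        · exact Or.inl ⟨h1, h2, h3⟩
      have h3 : 8 * q < μCantor (_root_.cylinder ρ ∩ (Pa ∩ (QW i)ᶜ)) := lt_of_add_lt_add_right (h1.trans_le h2)
      have h4 : _root_.cylinder ρ ∩ (Pa ∩ (QW i)ᶜ) = ⋃ s, _root_.cylinder ρ ∩ (Pa ∩ lvl U s) := by
        rw [QW, compl_compl, ← hUS, openOf_eq_iUnion_lvl, Set.inter_iUnion, Set.inter_iUnion]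
      have hmono : Monotone (fun s => _root_.cylinder ρ ∩ (Pa ∩ lvl U s)) := fun a b hab =>
        Set.inter_subset_inter_right _ (Set.inter_subset_inter_right _ (lvl_mono hU hab))
      rw [h4, hmono.measure_iUnion, lt_iSup_iff] at h3
      obtain ⟨s, hs⟩ := h3
      refine ⟨Pa ∩ lvl U s, hPa.inter (piC_lvl U s), Set.inter_subset_left, Or.inl ?_, hs.le⟩
      rw [Set.eq_empty_iff_forall_notMem]
      rintro Y ⟨⟨_, h5⟩, h6⟩
      apply h6
      rw [← hUS]
      exact mem_openOf.2 ⟨s, h5⟩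
  -- step (c)
  obtain ⟨Pc, hPc, hPcPb, hc1, hc2⟩ := trim hPb ρ (d + 6)
  obtain ⟨Pe, hPe, hPePc, he1, he2⟩ := trim hPc ρ (d + 6)
  -- step (d)
  obtain ⟨T1, hT1⟩ := uw_tail (ε := 2⁻¹ ^ (d + 6 + 6)) (ENNReal.pow_pos (by simp) _)
  set T := max t (max m T1) with hT
  obtain ⟨Pd, hPd, hPdPe, hd1, hd2⟩ := avoid_hits A hPe ρ htl T
  have hpos : 0 < μCantor (_root_.cylinder ρ ∩ Pd) := by
    rw [pos_iff_ne_zero]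
    intro h0
    rw [h0, zero_add] at hd2
    exact ar2 hqt hq0 (hfin _) (hfin _) (hfin _) hb2 hc2 he2 hd2
  obtain ⟨S, hS, rfl⟩ := hPd
  obtain ⟨u0, hu0, Y, hY, hit0⟩ := claim hA hS hpos T
  have hex : ∃ u, t ≤ u ∧ hit A ρ.length u Y := ⟨u0, by omega, hit0⟩
  set t' := Nat.find hex with ht'
  obtain ⟨a1, a2⟩ := Nat.find_spec hex
  rw [← ht'] at a1 a2
  have hTt : T ≤ t' := by
    by_contra hlt
    push Not at hlt
    exact hd1 Y hY.2 t' a1 hlt a2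
  have hYe := hPdPe hY.2
  refine ⟨d + 6, strPrefix Y (ρ.length + lenA A t'), Pc, t', ⟨hPc, ?_, hT1 _ (by omega)⟩, hPcPb.trans (hPbPa.trans hPaP),
    sp_prefix_iff.2 ⟨hY.1, by omega⟩, ?_, ?_, a1, by omega, sp_length _ _, ?_⟩
  · have := he1 Y hYe (ρ.length + lenA A t') (by omega)
    unfold dens at this
    rw [sp_length] at this ⊢
    calc _ = (2⁻¹ : ℝ≥0∞) ^ (d + 6) * 2⁻¹ ^ (ρ.length + lenA A t') := by rw [pow_add]
      _ ≤ μCantor (_root_.cylinder (strPrefix Y (ρ.length + lenA A t')) ∩ Pc) * 2 ^ (ρ.length + lenA A t') * 2⁻¹ ^ (ρ.length + lenA A t') := by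
        gcongr
      _ = _ := by rw [mul_assoc, ← mul_pow, ENNReal.mul_inv_cancel (by simp) (by simp), one_pow, mul_one]
  · intro h
    obtain ⟨n, hn⟩ := ha1 h
    exact ⟨n, Set.subset_empty_iff.1 (hn ▸ Set.inter_subset_inter_left _ (hPcPb.trans hPbPa))⟩
  · rcases hb1 with h | h
    · exact Or.inl (Set.subset_empty_iff.1 (h ▸ Set.inter_subset_inter_left _ hPcPb))
    · exact Or.inr fun Z hZ k hk => (hc1 Z hZ k hk).trans (dens_mono _ h)
  · intro Z hZ
    have hYZ : strPrefix Z (ρ.length + lenA A t') = strPrefix Y (ρ.length + lenA A t') := by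
      have := isPrefixOf_iff.1 (mem_cyl.1 hZ)
      rwa [sp_length] at this
    refine ⟨(hit_congr le_rfl hYZ).2 a2, fun u h1 h2 h3 => ?_⟩
    exact Nat.find_min hex h2 ⟨h1, (hit_congr h2.le hYZ).1 h3⟩

@[fun_prop] theorem pr_uR {α : Type} [Primcodable α] {f : α → ℕ} (hf : Primrec f) : Primrec (fun a => uR (f a)) := by
  unfold uR; fun_prop
@[fun_prop] theorem pr_uN {α : Type} [Primcodable α] {f : α → ℕ} (hf : Primrec f) : Primrec (fun a => uN (f a)) := by
  unfold uN; fun_prop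
@[fun_prop] theorem pr_uS {α : Type} [Primcodable α] {f : α → ℕ} (hf : Primrec f) : Primrec (fun a => uS (f a)) := by
  unfold uS; fun_prop
@[fun_prop] theorem pp_valid {α : Type} [Primcodable α] {f : α → ℕ} (hf : Primrec f) : PrimrecPred (fun a => valid (f a)) := by
  have := gR_pr
  unfold valid; fun_prop

def lenF (σ : List Bool) (u : ℕ) : ℕ :=
  ((List.range (u + 1)).map fun v => Nat.pair (Nat.pair (uR v) (Encodable.encode (σ.take (uN v)))) (uR v) + 1).sum

def hitF (σ τ : List Bool) (l u : ℕ) : Prop :=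
  valid u ∧ ∀ j < uR u, τ.getD (l + Nat.pair (Nat.pair (uR u) (Encodable.encode (σ.take (uN u)))) j) false = false

@[fun_prop] theorem pr_lenF {α : Type} [Primcodable α] {f : α → List Bool} {g : α → ℕ} (hf : Primrec f) (hg : Primrec g) :
    Primrec (fun a => lenF (f a) (g a)) := by
  unfold lenF; fun_prop

@[fun_prop] theorem pp_hitF {α : Type} [Primcodable α] {f g : α → List Bool} {h k : α → ℕ} (hf : Primrec f) (hg : Primrec g)
    (hh : Primrec h) (hk : Primrec k) :
    PrimrecPred (fun a => hitF (f a) (g a) (h a) (k a)) := by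
  unfold hitF; fun_prop

theorem lenF_eq (A : ℕ → Bool) (u : ℕ) : lenF (strPrefix A u) u = lenA A u := by
  unfold lenF lenA
  congr 1
  apply List.map_congr_left
  intro v hv
  have := uN_le v
  rw [List.mem_range] at hv
  rw [sp_take, min_eq_left (by omega)]

theorem hitF_iff (A X : ℕ → Bool) {l u v N : ℕ} (h : v ≤ u) (hN : l + lenA A u ≤ N) :
    hitF (strPrefix A u) (strPrefix X N) l v ↔ hit A l v X := by
  unfold hitF hit
  rw [mem_zeroOn_blk]
  have := uN_le v
  rw [sp_take, min_eq_left (by omega)]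
  refine and_congr_right fun _ => forall₂_congr fun j hj => ?_
  have := lenA_gt A h hj
  rw [sp_getD X (by omega)]

section
variable {α : Type} [Primcodable α]

theorem sig_joinA {A X : ℕ → Bool} {f : α → ℕ} {g : α → List Bool} (hf : Primrec f) (hg : Primrec g) :
    Sig (joinSet A X) (fun z => strPrefix A (f z) = g z) := by
  rw [sig_join_iff]
  refine ⟨fun x => decide (f x.2.2 ≤ x.1.length ∧ x.1.take (f x.2.2) = g x.2.2), by fun_prop, ?_, fun z => ?_⟩
  · intro a a' b b' z h1 h2 h3
    simp only [decide_eq_true_eq] at h3 ⊢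
    obtain ⟨t, rfl⟩ := h1
    rw [List.take_append_of_le_length h3.1, List.length_append]
    exact ⟨by omega, h3.2⟩
  · simp only [decide_eq_true_eq, sp_length]
    constructor
    · intro h; exact ⟨f z, le_rfl, by rw [sp_take, min_self]; exact h⟩
    · rintro ⟨n, h1, h2⟩
      rwa [sp_take, min_eq_left h1] at h2

theorem sig_joinX {A X : ℕ → Bool} {f : α → ℕ} {g : α → List Bool} (hf : Primrec f) (hg : Primrec g) :
    Sig (joinSet A X) (fun z => strPrefix X (f z) = g z) := by
  rw [sig_join_iff]
  refine ⟨fun x => decide (f x.2.2 ≤ x.2.1.length ∧ x.2.1.take (f x.2.2) = g x.2.2), by fun_prop, ?_, fun z => ?_⟩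
  · intro a a' b b' z h1 h2 h3
    simp only [decide_eq_true_eq] at h3 ⊢
    obtain ⟨t, rfl⟩ := h2
    rw [List.take_append_of_le_length h3.1, List.length_append]
    exact ⟨by omega, h3.2⟩
  · simp only [decide_eq_true_eq, sp_length]
    constructor
    · intro h; exact ⟨f z, le_rfl, by rw [sp_take, min_self]; exact h⟩
    · rintro ⟨n, h1, h2⟩
      rwa [sp_take, min_eq_left h1] at h2
end

/-- one decoding step: `(i,l,t)` -/
def DR (A X : ℕ → Bool) (x y : ℕ × ℕ × ℕ) : Prop :=
  y.1 = x.1 + 1 ∧ x.2.2 ≤ y.2.2 ∧ hit A x.2.1 y.2.2 X ∧ (∀ u < y.2.2, u < x.2.2 ∨ ¬ hit A x.2.1 u X) ∧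
    y.2.1 = x.2.1 + lenA A y.2.2

theorem sig_DR (A X : ℕ → Bool) : Sig (joinSet A X) (fun z : (ℕ × ℕ × ℕ) × (ℕ × ℕ × ℕ) => DR A X z.1 z.2) := by
  have h1 : Sig (joinSet A X) (fun z : (ℕ × ℕ × ℕ) × (ℕ × ℕ × ℕ) => ∃ σ τ : List Bool, strPrefix A z.2.2.2 = σ ∧
      strPrefix X (z.1.2.1 + lenF σ z.2.2.2) = τ ∧
      (z.2.1 = z.1.1 + 1 ∧ z.1.2.2 ≤ z.2.2.2 ∧ hitF σ τ z.1.2.1 z.2.2.2 ∧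
        (∀ u < z.2.2.2, u < z.1.2.2 ∨ ¬ hitF σ τ z.1.2.1 u) ∧ z.2.2.1 = z.1.2.1 + lenF σ z.2.2.2)) := by
    refine sig_ex (sig_ex (sig_and (sig_joinA (by fun_prop) (by fun_prop)) (sig_and (sig_joinX (by fun_prop) (by fun_prop)) ?_)))
    exact sig_re (re_of_pp (by fun_prop))
  refine h1.of_eq fun z => ?_
  have key : (z.2.1 = z.1.1 + 1 ∧ z.1.2.2 ≤ z.2.2.2 ∧
      hitF (strPrefix A z.2.2.2) (strPrefix X (z.1.2.1 + lenF (strPrefix A z.2.2.2) z.2.2.2)) z.1.2.1 z.2.2.2 ∧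
        (∀ u < z.2.2.2, u < z.1.2.2 ∨ ¬ hitF (strPrefix A z.2.2.2) (strPrefix X (z.1.2.1 + lenF (strPrefix A z.2.2.2) z.2.2.2)) z.1.2.1 u) ∧
        z.2.2.1 = z.1.2.1 + lenF (strPrefix A z.2.2.2) z.2.2.2) ↔ DR A X z.1 z.2 := by
    unfold DR
    rw [lenF_eq, hitF_iff A X le_rfl le_rfl]
    refine and_congr_right fun _ => and_congr_right fun _ => and_congr_right fun _ => and_congr_left fun _ => ?_
    refine forall₂_congr fun u hu => ?_
    rw [hitF_iff A X hu.le le_rfl]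
  rw [← key]
  constructor
  · rintro ⟨σ, τ, rfl, rfl, h⟩; exact h
  · intro h; exact ⟨_, _, rfl, rfl, h⟩

theorem exists_seq {A : ℕ → Bool} (hA : ¬ KTrivial A) (m : ℕ → ℕ) :
    ∃ (d : ℕ → ℕ) (ρ : ℕ → List Bool) (P : ℕ → Set (ℕ → Bool)) (t : ℕ → ℕ), ρ 0 = [] ∧ ∀ i,
      StInv (d i) (ρ i) (P i) (t i) ∧ P (i + 1) ⊆ P i ∧ ρ i <+: ρ (i + 1) ∧
      ((∀ n, μCantor (testLevel i emptyOracle n) ≤ 2⁻¹ ^ n) → ∃ n, P (i + 1) ∩ testLevel i emptyOracle n = ∅) ∧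
      (P (i + 1) ∩ QW i = ∅ ∨ ∀ Y ∈ P (i + 1), ∀ k ≥ (ρ i).length, 2⁻¹ ^ d (i + 1) ≤ dens (strPrefix Y k) (QW i)) ∧
      t i ≤ t (i + 1) ∧ m i ≤ t (i + 1) ∧ (ρ (i + 1)).length = (ρ i).length + lenA A (t (i + 1)) ∧
      ∀ Y ∈ _root_.cylinder (ρ (i + 1)), hit A (ρ i).length (t (i + 1)) Y ∧ ∀ u, t i ≤ u → u < t (i + 1) → ¬ hit A (ρ i).length u Y := by
  obtain ⟨T, hT⟩ := uw_tail (ε := 2⁻¹ ^ (0 + 6)) (ENNReal.pow_pos (by simp) _)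
  let St := {x : ℕ × List Bool × Set (ℕ → Bool) × ℕ // StInv x.1 x.2.1 x.2.2.1 x.2.2.2}
  have hinit : StInv 0 [] Set.univ T := by
    refine ⟨⟨fun _ => False, re_const _, ?_⟩, ?_, hT T le_rfl⟩
    · ext X; simp [mem_openOf]
    · rw [Set.inter_univ, mu_cyl]; simp
  have hstep : ∀ (x : St) (i : ℕ), ∃ y : St, y.1.2.2.1 ⊆ x.1.2.2.1 ∧ x.1.2.1 <+: y.1.2.1 ∧
      ((∀ n, μCantor (testLevel i emptyOracle n) ≤ 2⁻¹ ^ n) → ∃ n, y.1.2.2.1 ∩ testLevel i emptyOracle n = ∅) ∧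
      (y.1.2.2.1 ∩ QW i = ∅ ∨ ∀ Y ∈ y.1.2.2.1, ∀ k ≥ (x.1.2.1).length, 2⁻¹ ^ y.1.1 ≤ dens (strPrefix Y k) (QW i)) ∧
      x.1.2.2.2 ≤ y.1.2.2.2 ∧ m i ≤ y.1.2.2.2 ∧ (y.1.2.1).length = (x.1.2.1).length + lenA A y.1.2.2.2 ∧
      ∀ Y ∈ _root_.cylinder y.1.2.1, hit A (x.1.2.1).length y.1.2.2.2 Y ∧
        ∀ u, x.1.2.2.2 ≤ u → u < y.1.2.2.2 → ¬ hit A (x.1.2.1).length u Y := by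
    rintro ⟨x, hx⟩ i
    obtain ⟨d', ρ', P', t', h, h'⟩ := step hA hx i (m i)
    exact ⟨⟨(d', ρ', P', t'), h⟩, h'⟩
  choose f hf using hstep
  let s : ℕ → St := fun i => Nat.rec ⟨(0, [], Set.univ, T), hinit⟩ (fun i x => f x i) i
  refine ⟨fun i => (s i).1.1, fun i => (s i).1.2.1, fun i => (s i).1.2.2.1, fun i => (s i).1.2.2.2, rfl, fun i => ⟨(s i).2, ?_⟩⟩
  exact hf (s i) i

theorem cuppable {A : ℕ → Bool} (hA : ¬ KTrivial A) : WeaklyMLCuppable A := by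
  classical
  obtain ⟨g, hg, gm, gs⟩ := re_stage re_zeroJump
  have hm : ∀ i, ∃ m, zeroJump i = true → g (i, m) = true := by
    intro i
    by_cases h : zeroJump i = true
    · obtain ⟨s, hs⟩ := (gs i).1 h; exact ⟨s, fun _ => hs⟩
    · exact ⟨0, fun h2 => absurd h2 h⟩
  choose m hm using hm
  obtain ⟨d, ρ, P, t, h0, hseq⟩ := exists_seq hA m
  have hρ : ∀ i j, i ≤ j → ρ i <+: ρ j := by
    intro i j hij
    induction hij with
    | refl => exact List.prefix_rfl
    | step _ ih => exact ih.trans (hseq _).2.2.1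
  have hPm : ∀ i j, i ≤ j → P j ⊆ P i := by
    intro i j hij
    induction hij with
    | refl => exact subset_rfl
    | step _ ih => exact (hseq _).2.1.trans ih
  have hlen : ∀ i, i ≤ (ρ i).length := by
    intro i
    induction i with
    | zero => exact Nat.zero_le _
    | succ i ih =>
      have h1 := (hseq i).2.2.2.2.2.2.2.1
      have h2 := lenA_pos A (t (i + 1))
      omega
  let X : ℕ → Bool := fun n => (ρ (n + 1)).getD n false
  have hX : ∀ i, IsPrefixOf (ρ i) X := by
    intro i j
    have hj : (j : ℕ) < (ρ (j + 1)).length := hlen (j + 1)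
    have : ∀ a b : List Bool, a <+: b → ∀ n < a.length, a.getD n false = b.getD n false := by
      rintro a b ⟨c, rfl⟩ n hn
      rw [List.getD_append _ _ _ _ hn]
    have h1 : X j = (ρ i).getD j false := by
      rcases le_total (j + 1 : ℕ) i with h | h
      · exact this _ _ (hρ _ _ h) _ hj
      · exact (this _ _ (hρ _ _ h) _ j.2).symm
    rw [h1]
    simp
  have hXc : ∀ i, X ∈ _root_.cylinder (ρ i) := fun i => mem_cyl.2 (hX i)
  have hXP : ∀ i, X ∈ P i := by
    intro i
    by_contra hcon
    obtain ⟨S, hS, hPS⟩ := (hseq i).1.1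
    rw [hPS, Set.mem_compl_iff, not_not] at hcon
    obtain ⟨n, hn⟩ := mem_openOf.1 hcon
    set k := max i n with hk
    have h1 := (hseq k).1.2.1
    have h2 : _root_.cylinder (ρ k) ∩ P k = ∅ := by
      rw [Set.eq_empty_iff_forall_notMem]
      rintro Y ⟨hY, hYP⟩
      have h3 := hPm i k (le_max_left _ _) hYP
      rw [hPS] at h3
      apply h3
      refine mem_openOf.2 ⟨n, ?_⟩
      have e1 := isPrefixOf_iff.1 (hX k)
      have e2 := isPrefixOf_iff.1 (mem_cyl.1 hY)
      have hnk : n ≤ (ρ k).length := (le_max_right i n).trans (hlen k)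
      have e3 : strPrefix Y n = strPrefix X n := by
        rw [← min_eq_left hnk, ← sp_take, ← sp_take, e1, e2]
      rw [e3]; exact hn
    rw [h2, measure_empty] at h1
    have := ENNReal.pow_pos (a := (2⁻¹ : ℝ≥0∞)) (by simp) (d k + (ρ k).length)
    exact absurd h1 (not_le.2 this)
  have hML : MLRandom X := by
    rintro G ⟨⟨e, he⟩, hμ⟩
    obtain ⟨n, hn⟩ := (hseq e).2.2.2.1 (fun n => by rw [← he]; exact hμ n)
    refine ⟨n, fun h => ?_⟩
    rw [he] at h
    have : X ∈ P (e + 1) ∩ testLevel e emptyOracle n := ⟨hXP _, h⟩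
    rw [hn] at this
    exact this
  refine ⟨X, hML, ?_, ?_⟩
  · intro hT
    obtain ⟨S, hS, hXS, hd⟩ := dens_zero (A := emptyOracle) (X := X)
      (fun S hS hw => solovay hML (re_of_sig_empty hS) hw) (by
        intro C hC
        obtain ⟨f, hf, fm, fs⟩ := sig_co_re hT (re_of_sig_empty hC)
        exact ⟨fun x => f (x.2.1, x.2.2) = true, re_of_pp (by fun_prop), fun z => fs z⟩)
    obtain ⟨i, hi⟩ := exists_WEnum (re_decode (re_of_sig_empty hS))
    have hQ : QW i = (openOf {σ | S σ})ᶜ := by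
      unfold QW
      congr 2
      ext σ
      simp only [Set.mem_ofPred_eq, hi]
      constructor
      · rintro ⟨a, h1, h2⟩; rwa [← Encodable.encode_injective h1]
      · intro h; exact ⟨σ, rfl, h⟩
    rw [← hQ] at hd
    have hXQ : X ∈ QW i := by rw [hQ]; exact hXS
    rcases (hseq i).2.2.2.2.1 with h | h
    · have : X ∈ P (i + 1) ∩ QW i := ⟨hXP _, hXQ⟩
      rw [h] at this
      exact this
    · have h1 := h X (hXP _)
      obtain ⟨k, hk⟩ := hd (d (i + 1) + (ρ i).length + 1)
      have hlt : (2⁻¹ : ℝ≥0∞) ^ (d (i + 1) + (ρ i).length + 1) < 2⁻¹ ^ (d (i + 1) + (ρ i).length) := by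
        rw [pow_succ, ← div_eq_mul_inv]
        exact ENNReal.half_lt_self (ENNReal.pow_pos (by simp) _).ne' (ENNReal.pow_ne_top (by simp))
      refine absurd (hlt.trans_le ?_) (not_lt.2 hk)
      rcases le_total (ρ i).length k with h2 | h2
      · refine le_trans ?_ (h1 k h2)
        exact pow_le_pow_of_le_one (by simp) (by simp) (by omega)
      · have h3 := h1 _ le_rfl
        unfold dens at h3 ⊢
        rw [sp_length] at h3 ⊢
        calc (2⁻¹ : ℝ≥0∞) ^ (d (i + 1) + (ρ i).length) = 2⁻¹ ^ d (i + 1) * 2⁻¹ ^ (ρ i).length := pow_add _ _ _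
          _ ≤ μCantor (_root_.cylinder (strPrefix X (ρ i).length) ∩ QW i) * 2 ^ (ρ i).length * 2⁻¹ ^ (ρ i).length := by gcongr
          _ = μCantor (_root_.cylinder (strPrefix X (ρ i).length) ∩ QW i) * 1 := by
            rw [mul_assoc, ← mul_pow, ENNReal.mul_inv_cancel (by simp) (by simp), one_pow]
          _ ≤ _ := by
            refine mul_le_mul' (measure_mono (Set.inter_subset_inter_left _ (cyl_subset (sp_mono X h2)))) ?_
            exact one_le_pow₀ (by norm_num)
  · apply turingLE_of_sig
    have hch : ∀ k x, Ch ((0, 0, t 0) : ℕ × ℕ × ℕ) (DR A X) k x ↔ x = (k, (ρ k).length, t k) := by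
      intro k
      induction k with
      | zero => intro x; simp [Ch, h0]
      | succ k ih =>
        intro x
        simp only [Ch, ih, exists_eq_left]
        obtain ⟨-, -, -, -, -, b1, -, b2, b3⟩ := hseq k
        obtain ⟨b4, b5⟩ := b3 X (hXc _)
        constructor
        · rintro ⟨c1, c2, c3, c4, c5⟩
          dsimp only at c1 c2 c3 c4 c5
          have e : x.2.2 = t (k + 1) := by
            rcases lt_trichotomy x.2.2 (t (k + 1)) with h | h | h
            · exact absurd c3 (b5 _ c2 h)
            · exact h
            · rcases c4 _ h with h | h
              · omega
              · exact absurd b4 h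
          rw [e] at c5
          refine Prod.ext c1 (Prod.ext ?_ e)
          dsimp only
          rw [c5, b2]
        · rintro rfl
          refine ⟨rfl, b1, b4, fun u hu => ?_, b2⟩
          dsimp only at hu ⊢
          by_cases h : u < t k
          · exact Or.inl h
          · exact Or.inr (b5 u (by omega) hu)
    have h1 := sig_chain ((0, 0, t 0) : ℕ × ℕ × ℕ) (sig_DR A X) (fun x => x.1) (fun x y h => by rw [h.1]; omega)
    have h2 : Sig (joinSet A X) (fun n : ℕ => ∃ z : ℕ × ℕ, (∃ k, Ch ((0, 0, t 0) : ℕ × ℕ × ℕ) (DR A X) k (n + 1, z.1, z.2)) ∧ g (n, z.2) = false) := by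
      apply sig_ex
      apply sig_and
      · exact sig_comp h1 (f := fun x : ℕ × ℕ × ℕ => (x.1 + 1, x.2.1, x.2.2)) (by fun_prop)
      · exact sig_re (re_of_pp (by fun_prop))
    refine h2.of_eq fun n => ?_
    constructor
    · rintro ⟨⟨l, s⟩, ⟨k, hk⟩, h3⟩
      rw [hch] at hk
      simp only [Prod.mk.injEq] at hk
      obtain ⟨rfl, -, rfl⟩ := hk
      dsimp only at h3
      by_contra h4
      have h5 := hm n (by simpa using h4)
      have h6 := gm _ _ _ (hseq n).2.2.2.2.2.2.1 h5
      rw [h3] at h6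
      simp at h6
    · intro h
      refine ⟨((ρ (n + 1)).length, t (n + 1)), ⟨n + 1, (hch _ _).2 rfl⟩, ?_⟩
      by_contra h4
      have : zeroJump n = true := (gs n).2 ⟨_, by simpa using h4⟩
      rw [h] at this
      simp at this

/-- main theorem of Day–Miller: a set is weakly ML-cuppable iff
it is not K-trivial. -/
theorem stmt14 (A : ℕ → Bool) : WeaklyMLCuppable A ↔ ¬ KTrivial A :=
  ⟨fun h hk => not_cuppable hk h, cuppable⟩
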